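/- arXiv:2002.04590 — 6 statements merged into one kernel-verified Lean document; each statement's English description precedes it below -/
import Mathlib

section
/- Let G and H be finite simple graphs that are both strongly regular with the same parameters (n, k, λ, μ). Let x ≠ y be vertices of G and x' ≠ y' be vertices of H such that x and y are adjacent in G if and only if x' and y' are adjacent in H. Then for every ℓ with 2 ≤ ℓ ≤ 7, the number of paths on ℓ vertices from x to y in G equals the number of paths on ℓ vertices from x' to y' in H. -/
namespace SRGPath

set_option linter.unusedSectionVars false

open Finset Function

/-! ### Iterated sums over labelled variables -/

section SumOver
variable {V : Type*} [Fintype V]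

/-- Sum of `f` over all values of the variables in the list. -/
def sumOver : List ℕ → ((ℕ → V) → ℤ) → (ℕ → V) → ℤ
  | [], f, v => f v
  | a :: as, f, v => ∑ u, sumOver as f (update v a u)

lemma sumOver_congr (vars : List ℕ) (f g : (ℕ → V) → ℤ) (v : ℕ → V)
    (h : ∀ w, (∀ i, i ∉ vars → w i = v i) → f w = g w) :
    sumOver vars f v = sumOver vars g v := by
  induction vars generalizing v with
  | nil => exact h v (fun _ _ => rfl)
  | cons a as ih =>
    simp only [sumOver]
    refine Finset.sum_congr rfl fun u _ => ih _ fun w hw => h w fun i hi => ?_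
    simp only [List.mem_cons, not_or] at hi
    rw [hw i hi.2, update_of_ne hi.1]

lemma sumOver_sub (vars : List ℕ) (f g : (ℕ → V) → ℤ) (v : ℕ → V) :
    sumOver vars (fun w => f w - g w) v = sumOver vars f v - sumOver vars g v := by
  induction vars generalizing v with
  | nil => rfl
  | cons a as ih => simp [sumOver, ih]

lemma sumOver_comm (as : List ℕ) (b : ℕ) (hb : b ∉ as) (f : (ℕ → V) → ℤ) (v : ℕ → V) :
    ∑ u, sumOver as f (update v b u) = sumOver as (fun w => ∑ u, f (update w b u)) v := by
  induction as generalizing v with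
  | nil => rfl
  | cons a as ih =>
    simp only [List.mem_cons, not_or] at hb
    simp only [sumOver]
    rw [Finset.sum_comm]
    refine Finset.sum_congr rfl fun u _ => ?_
    rw [← ih hb.2]
    refine Finset.sum_congr rfl fun t _ => ?_
    rw [update_comm hb.1]

lemma sumOver_erase (vars : List ℕ) (b : ℕ) (hb : b ∈ vars) (hn : vars.Nodup)
    (f : (ℕ → V) → ℤ) (v : ℕ → V) :
    sumOver vars f v = sumOver (vars.erase b) (fun w => ∑ u, f (update w b u)) v := by
  induction vars generalizing v with
  | nil => simp at hb
  | cons a as ih =>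
    rw [List.nodup_cons] at hn
    by_cases hab : a = b
    · subst hab
      rw [List.erase_cons_head, ← sumOver_comm as a hn.1]
      rfl
    · rw [List.erase_cons_tail (by simpa using hab)]
      simp only [sumOver]
      refine Finset.sum_congr rfl fun u _ => ih ?_ hn.2 _
      simpa [Ne.symm hab] using hb

end SumOver

/-! ### Weights in the Bose-Mesner algebra -/

section Weights
variable {V : Type*} [DecidableEq V] (G : SimpleGraph V) [DecidableRel G.Adj]

/-- The weight `c` evaluated at a pair of vertices. -/
def ev (c : ℤ × ℤ × ℤ) (u v : V) : ℤ :=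
  if u = v then c.1 else if G.Adj u v then c.2.1 else c.2.2

lemma ev_symm (c : ℤ × ℤ × ℤ) (u v : V) : ev G c u v = ev G c v u := by
  simp [ev, eq_comm, G.adj_comm]

lemma ev_mul (c d : ℤ × ℤ × ℤ) (u v : V) : ev G (c * d) u v = ev G c u v * ev G d u v := by
  unfold ev; split_ifs <;> rfl

lemma ev_one (u v : V) : ev G 1 u v = 1 := by
  unfold ev; split_ifs <;> rfl

/-- The product of weights in the Bose-Mesner algebra. -/
def conv (n k l m : ℤ) (c d : ℤ × ℤ × ℤ) : ℤ × ℤ × ℤ :=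
  let a := c.1 - c.2.2
  let b := c.2.1 - c.2.2
  let e := c.2.2
  let a' := d.1 - d.2.2
  let b' := d.2.1 - d.2.2
  let e' := d.2.2
  let j := a * e' + e * a' + k * (b * e' + e * b') + n * e * e'
  (a * a' + b * b' * k + j, a * b' + b * a' + b * b' * l + j, b * b' * m + j)

lemma conv_spec [Fintype V] {n k l m : ℕ} (h : G.IsSRGWith n k l m) (c d : ℤ × ℤ × ℤ) (u t : V) :
    ∑ z, ev G c u z * ev G d z t = ev G (conv n k l m c d) u t := by
  have hdec : ∀ (c : ℤ × ℤ × ℤ) (u v : V), ev G c u v =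
      (c.1 - c.2.2) * (if u = v then 1 else 0) +
        (c.2.1 - c.2.2) * (if G.Adj u v then 1 else 0) + c.2.2 := by
    intro c u v
    unfold ev
    by_cases h1 : u = v
    · subst h1; simp
    · by_cases h2 : G.Adj u v <;> simp [h1, h2]
  have hdeg : ∀ u, ∑ z, (if G.Adj u z then (1 : ℤ) else 0) = k := by
    intro u
    have := h.regular.degree_eq u
    rw [← this]
    simp [← SimpleGraph.card_neighborFinset_eq_degree, SimpleGraph.neighborFinset_eq_filter]
  have hdeg' : ∀ u, ∑ z, (if G.Adj z u then (1 : ℤ) else 0) = k := by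
    intro u
    rw [← hdeg u]
    simp [G.adj_comm]
  have hsq : ∑ z, (if G.Adj u z then (1 : ℤ) else 0) * (if G.Adj z t then (1 : ℤ) else 0) =
      k * (if u = t then 1 else 0) + l * (if G.Adj u t then 1 else 0) +
        m * (if Gᶜ.Adj u t then 1 else 0) := by
    have := congrFun (congrFun (h.matrix_eq (α := ℤ)) u) t
    rw [pow_two, Matrix.mul_apply] at this
    simp only [Matrix.add_apply, Matrix.smul_apply, SimpleGraph.adjMatrix_apply,
      Matrix.one_apply] at this
    simp only [nsmul_eq_mul] at this
    exact this
  have e1 : ∑ z, ev G c u z * ev G d z t =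
      (c.1 - c.2.2) * ev G d u t + (d.1 - d.2.2) * (c.2.1 - c.2.2) * (if G.Adj u t then 1 else 0)
      + (c.2.1 - c.2.2) * (d.2.1 - d.2.2) *
        (∑ z, (if G.Adj u z then (1 : ℤ) else 0) * (if G.Adj z t then (1 : ℤ) else 0))
      + (c.2.1 - c.2.2) * d.2.2 * (∑ z, (if G.Adj u z then (1 : ℤ) else 0))
      + c.2.2 * (d.1 - d.2.2)
      + c.2.2 * (d.2.1 - d.2.2) * (∑ z, (if G.Adj z t then (1 : ℤ) else 0))
      + n * c.2.2 * d.2.2 := by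
    have e2 : ∀ z, ev G c u z * ev G d z t =
      (c.1 - c.2.2) * (if u = z then ev G d z t else 0)
      + (d.1 - d.2.2) * (c.2.1 - c.2.2) * (if z = t then (if G.Adj u z then 1 else 0) else 0)
      + (c.2.1 - c.2.2) * (d.2.1 - d.2.2) *
        ((if G.Adj u z then (1 : ℤ) else 0) * (if G.Adj z t then (1 : ℤ) else 0))
      + (c.2.1 - c.2.2) * d.2.2 * (if G.Adj u z then (1 : ℤ) else 0)
      + c.2.2 * (d.1 - d.2.2) * (if z = t then 1 else 0)
      + c.2.2 * (d.2.1 - d.2.2) * (if G.Adj z t then (1 : ℤ) else 0)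
      + c.2.2 * d.2.2 := by
      intro z
      rw [hdec c u z, hdec d z t]
      by_cases h1 : u = z
      · subst h1
        by_cases h2 : u = t
        · subst h2; simp; ring
        · simp [h2]; split_ifs <;> ring
      · by_cases h2 : z = t
        · subst h2; simp [h1]; split_ifs <;> ring
        · simp only [h1, h2, if_false]; ring
    simp only [e2, Finset.sum_add_distrib, ← Finset.mul_sum]
    simp [← h.card]
    ring
  rw [e1, hsq, hdeg, hdeg', hdec d u t]
  unfold ev conv
  by_cases h1 : u = t
  · subst h1; simp; ring
  · by_cases h2 : G.Adj u t <;> simp [h1, h2] <;> ring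

end Weights

/-! ### Eliminating variables -/

section Elim
variable {V W : Type*} [Fintype V] [Fintype W] [DecidableEq V] [DecidableEq W]
    (G : SimpleGraph V) (H : SimpleGraph W) [DecidableRel G.Adj] [DecidableRel H.Adj]

/-- A pair of functions which are products of weights along the given list of pairs. -/
inductive Rep : List (ℕ × ℕ) → ((ℕ → V) → ℤ) → ((ℕ → W) → ℤ) → Prop
  | nil : Rep [] (fun _ => 1) (fun _ => 1)
  | cons (i j : ℕ) (c : ℤ × ℤ × ℤ) {E F K} : Rep E F K →
      Rep ((i, j) :: E) (fun v => ev G c (v i) (v j) * F v) (fun v => ev H c (v i) (v j) * K v)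

/-- The pair does not involve `a`. -/
def avoids (a : ℕ) (p : ℕ × ℕ) : Bool := (p.1 != a) && (p.2 != a)

/-- Either the pair does not involve `a`, or it joins `a` to `u` or `t`. -/
def okPair (a u t : ℕ) (p : ℕ × ℕ) : Bool :=
  avoids a p || (p.1 == a && (p.2 == u || p.2 == t)) || (p.2 == a && (p.1 == u || p.1 == t))

variable {G H}

lemma Rep.elim {E F F'} (h : Rep G H E F F') (a u t : ℕ) (hu : u ≠ a) (ht : t ≠ a)
    (hE : E.all (okPair a u t) = true) :
    ∃ R R' c d, Rep G H (E.filter (avoids a)) R R' ∧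
      (∀ v z, F (update v a z) = R v * (ev G c (v u) z * ev G d z (v t))) ∧
      (∀ v z, F' (update v a z) = R' v * (ev H c (v u) z * ev H d z (v t))) := by
  induction h with
  | nil => exact ⟨_, _, 1, 1, .nil, by simp [ev_one], by simp [ev_one]⟩
  | cons i j c h ih =>
    rw [List.all_cons, Bool.and_eq_true] at hE
    obtain ⟨R, R', c', d', hR, h1, h2⟩ := ih hE.2
    by_cases hav : avoids a (i, j) = true
    · rw [List.filter_cons_of_pos hav]
      simp [avoids] at hav
      refine ⟨_, _, c', d', .cons i j c hR, fun v z => ?_, fun v z => ?_⟩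
      · beta_reduce; rw [update_of_ne hav.1, update_of_ne hav.2, h1]; ring
      · beta_reduce; rw [update_of_ne hav.1, update_of_ne hav.2, h2]; ring
    · rw [List.filter_cons_of_neg hav]
      have := hE.1
      simp only [okPair, hav, Bool.false_or, Bool.or_eq_true, Bool.and_eq_true, beq_iff_eq] at this
      have key : (i = a ∧ j = u) ∨ (i = a ∧ j = t) ∨ (j = a ∧ i = u) ∨ (j = a ∧ i = t) := by
        tauto
      rcases key with ⟨rfl, rfl⟩ | ⟨rfl, rfl⟩ | ⟨rfl, rfl⟩ | ⟨rfl, rfl⟩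
      · refine ⟨R, R', c * c', d', hR, fun v z => ?_, fun v z => ?_⟩
        · beta_reduce; rw [update_self, update_of_ne hu, h1, ev_mul, ev_symm G c z]; ring
        · beta_reduce; rw [update_self, update_of_ne hu, h2, ev_mul, ev_symm H c z]; ring
      · refine ⟨R, R', c', c * d', hR, fun v z => ?_, fun v z => ?_⟩
        · beta_reduce; rw [update_self, update_of_ne ht, h1, ev_mul]; ring
        · beta_reduce; rw [update_self, update_of_ne ht, h2, ev_mul]; ring
      · refine ⟨R, R', c * c', d', hR, fun v z => ?_, fun v z => ?_⟩
        · beta_reduce; rw [update_self, update_of_ne hu, h1, ev_mul]; ring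
        · beta_reduce; rw [update_self, update_of_ne hu, h2, ev_mul]; ring
      · refine ⟨R, R', c', c * d', hR, fun v z => ?_, fun v z => ?_⟩
        · beta_reduce; rw [update_self, update_of_ne ht, h1, ev_mul, ev_symm G c _ z]; ring
        · beta_reduce; rw [update_self, update_of_ne ht, h2, ev_mul, ev_symm H c _ z]; ring

/-- The other ends of pairs involving `a`. -/
def nbrs (a : ℕ) (E : List (ℕ × ℕ)) : List ℕ :=
  E.filterMap fun p => if p.1 == a then some p.2 else if p.2 == a then some p.1 else none

/-- First end in the list. -/
def pickU (a : ℕ) (E : List (ℕ × ℕ)) : ℕ := (nbrs a E).headD 0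

/-- An end in the list different from the first, if there is one. -/
def pickT (a : ℕ) (E : List (ℕ × ℕ)) : ℕ :=
  ((nbrs a E).filter (fun i => i != pickU a E)).headD (pickU a E)

/-- The pair replacing the pairs through an eliminated variable. -/
def newPair (u t : ℕ) : ℕ × ℕ := if u == t then (0, 1) else (u, t)

/-- Series-parallel reducibility to the roots `0`, `1`. -/
def good2 : ℕ → List ℕ → List (ℕ × ℕ) → Bool
  | 0, vars, E => vars.isEmpty && E.all (fun p => Nat.blt p.1 2 && Nat.blt p.2 2)
  | f + 1, vars, E => vars.any fun a =>
      (pickU a E != a) && (pickT a E != a) && E.all (okPair a (pickU a E) (pickT a E)) &&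
        good2 f (vars.erase a) (newPair (pickU a E) (pickT a E) :: E.filter (avoids a))

/-- Matching of the two roots. -/
structure Roots (G : SimpleGraph V) (H : SimpleGraph W) (v : ℕ → V) (v' : ℕ → W) : Prop where
  ne : v 0 ≠ v 1
  ne' : v' 0 ≠ v' 1
  adj : G.Adj (v 0) (v 1) ↔ H.Adj (v' 0) (v' 1)

lemma Roots.ev_eq {v : ℕ → V} {v' : ℕ → W} (h : Roots G H v v') (c : ℤ × ℤ × ℤ) (i j : ℕ)
    (hi : i < 2) (hj : j < 2) : ev G c (v i) (v j) = ev H c (v' i) (v' j) := by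
  have h1 := h.ne
  have h2 := h.ne'
  have h3 := h.adj
  interval_cases i <;> interval_cases j <;>
    simp [ev, h1, h2, h1.symm, h2.symm, h3, G.adj_comm (v 1), H.adj_comm (v' 1)]

lemma Rep.congr {E F F' F1 F1'} (h : Rep G H E F F') (h1 : F = F1) (h2 : F' = F1') :
    Rep G H E F1 F1' := by subst h1 h2; exact h

lemma good2_sound {n k l m : ℕ} (hG : G.IsSRGWith n k l m) (hH : H.IsSRGWith n k l m)
    (f : ℕ) (vars : List ℕ) (E : List (ℕ × ℕ)) (hgood : good2 f vars E = true)
    (hnd : vars.Nodup) (hv : ∀ a ∈ vars, 2 ≤ a)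
    {F F'} (hF : Rep G H E F F') (v : ℕ → V) (v' : ℕ → W) (hr : Roots G H v v') :
    sumOver vars F v = sumOver vars F' v' := by
  induction f generalizing vars E F F' with
  | zero =>
    simp only [good2, Bool.and_eq_true, List.isEmpty_iff] at hgood
    obtain ⟨rfl, hE⟩ := hgood
    simp only [sumOver]
    induction hF with
    | nil => rfl
    | cons i j c h ih =>
      rw [List.all_cons, Bool.and_eq_true, Bool.and_eq_true] at hE
      beta_reduce
      rw [ih hE.2, hr.ev_eq c i j]
      · simpa [Nat.blt] using hE.1.1
      · simpa [Nat.blt] using hE.1.2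
  | succ f ih =>
    simp only [good2, List.any_eq_true, Bool.and_eq_true, bne_iff_ne] at hgood
    obtain ⟨a, ha, ⟨⟨hu, ht⟩, hok⟩, hg⟩ := hgood
    generalize pickU a E = u at *
    generalize pickT a E = t at *
    obtain ⟨R, R', c, d, hR, h1, h2⟩ := hF.elim a u t hu ht hok
    rw [sumOver_erase vars a ha hnd, sumOver_erase vars a ha hnd]
    simp only [h1, h2, ← Finset.mul_sum, conv_spec G hG, conv_spec H hH]
    generalize conv n k l m c d = e
    have hnd' := hnd.erase a
    have hv' : ∀ b ∈ vars.erase a, 2 ≤ b := fun b hb => hv b (List.mem_of_mem_erase hb)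
    by_cases hut : u = t
    · subst hut
      simp only [newPair, beq_self_eq_true, if_true] at hg
      refine ih _ _ hg hnd' hv' (Rep.congr (.cons 0 1 (e.1, e.1, e.1) hR) ?_ ?_)
      · funext v; simp [ev, mul_comm]
      · funext v; simp [ev, mul_comm]
    · have : newPair u t = (u, t) := by simp [newPair, hut]
      rw [this] at hg
      refine ih _ _ hg hnd' hv' (Rep.congr (.cons u t e hR) ?_ ?_)
      · funext v; simp [mul_comm]
      · funext v; simp [mul_comm]

end Elim

/-! ### Expanding the distinctness constraints -/

section Expand
variable {V : Type*} [DecidableEq V] (G : SimpleGraph V) [DecidableRel G.Adj]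

/-- Adjacency indicator. -/
def adjI (v : ℕ → V) (p : ℕ × ℕ) : ℤ := if G.Adj (v p.1) (v p.2) then 1 else 0

/-- Distinctness indicator. -/
def neqI (v : ℕ → V) (p : ℕ × ℕ) : ℤ := if v p.1 = v p.2 then 0 else 1

/-- Indicator of all adjacency and distinctness constraints. -/
def phi (E N : List (ℕ × ℕ)) (v : ℕ → V) : ℤ :=
  (E.map (adjI G v)).prod * (N.map (neqI v)).prod

/-- Replace the label `b` by `a`. -/
def sub (a b i : ℕ) : ℕ := if i = b then a else i

/-- Replace the label `b` by `a` in a pair. -/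
def subP (a b : ℕ) (p : ℕ × ℕ) : ℕ × ℕ := (sub a b p.1, sub a b p.2)

/-- The checker. -/
def good1 : ℕ → List ℕ → List (ℕ × ℕ) → List (ℕ × ℕ) → Bool
  | _, vars, E, [] => good2 vars.length vars E
  | 0, _, _, _ :: _ => false
  | f + 1, vars, E, (a, b) :: N =>
    if a = b then true
    else if (a, b) ∈ N ∨ (b, a) ∈ N ∨ (a, b) ∈ E ∨ (b, a) ∈ E ∨ (a < 2 ∧ b < 2) then
      good1 f vars E N
    else if b ∈ vars then
      good1 f vars E N && good1 f (vars.erase b) (E.map (subP a b)) (N.map (subP a b))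
    else if a ∈ vars then
      good1 f vars E N && good1 f (vars.erase a) (E.map (subP b a)) (N.map (subP b a))
    else false

lemma update_sub (w : ℕ → V) (a b i : ℕ) : update w b (w a) i = w (sub a b i) := by
  unfold sub
  by_cases h : i = b
  · subst h; simp
  · simp [h]

lemma phi_update (E N : List (ℕ × ℕ)) (w : ℕ → V) (a b : ℕ) :
    phi G E N (update w b (w a)) = phi G (E.map (subP a b)) (N.map (subP a b)) w := by
  unfold phi
  simp only [List.map_map]
  congr 3 <;> funext p <;> simp only [adjI, neqI, subP, update_sub, Function.comp] <;>
    split_ifs with hh <;> simp [hh]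

lemma phi_merge [Fintype V] (vars : List ℕ) (E N : List (ℕ × ℕ)) (a b : ℕ) (hab : a ≠ b)
    (hb : b ∈ vars) (hn : vars.Nodup) (v : ℕ → V) :
    sumOver vars (phi G E ((a, b) :: N)) v = sumOver vars (phi G E N) v -
      sumOver (vars.erase b) (phi G (E.map (subP a b)) (N.map (subP a b))) v := by
  have h1 : phi G E ((a, b) :: N) =
      fun w => phi G E N w - (if w a = w b then phi G E N w else 0) := by
    funext w
    unfold phi
    by_cases h : w a = w b <;> simp [neqI, h]
  rw [h1, sumOver_sub]
  congr 1
  rw [sumOver_erase vars b hb hn]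
  congr 1
  funext w
  rw [← phi_update]
  simp [update_of_ne hab]

lemma neqI_swap (v : ℕ → V) (a b : ℕ) : neqI v (a, b) = neqI v (b, a) := by
  simp [neqI, eq_comm]

lemma phi_swap (E N : List (ℕ × ℕ)) (a b : ℕ) :
    phi G E ((a, b) :: N) = phi G E ((b, a) :: N) := by
  funext w
  simp [phi, neqI_swap w a b]

lemma phi_drop (E N : List (ℕ × ℕ)) (a b : ℕ) (w : ℕ → V)
    (h : (a, b) ∈ N ∨ (b, a) ∈ N ∨ (a, b) ∈ E ∨ (b, a) ∈ E ∨ w a ≠ w b) :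
    phi G E ((a, b) :: N) w = phi G E N w := by
  by_cases hw : w a = w b
  · have h0 : phi G E N w = 0 := by
      unfold phi
      rcases h with h | h | h | h | h
      · rw [List.prod_eq_zero (l := N.map (neqI w)), mul_zero]
        exact List.mem_map.2 ⟨_, h, by simp [neqI, hw]⟩
      · rw [List.prod_eq_zero (l := N.map (neqI w)), mul_zero]
        exact List.mem_map.2 ⟨_, h, by simp [neqI, hw]⟩
      · rw [List.prod_eq_zero (l := E.map (adjI G w)), zero_mul]
        exact List.mem_map.2 ⟨_, h, by simp [adjI, hw]⟩
      · rw [List.prod_eq_zero (l := E.map (adjI G w)), zero_mul]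
        exact List.mem_map.2 ⟨_, h, by simp [adjI, hw]⟩
      · exact absurd hw h
    rw [h0]
    unfold phi
    simp [neqI, hw]
  · unfold phi
    simp [neqI, hw]

end Expand

section Sound
variable {V W : Type*} [Fintype V] [Fintype W] [DecidableEq V] [DecidableEq W]
    {G : SimpleGraph V} {H : SimpleGraph W} [DecidableRel G.Adj] [DecidableRel H.Adj]

lemma rep_phi (E : List (ℕ × ℕ)) : Rep G H E (phi G E []) (phi H E []) := by
  induction E with
  | nil => exact Rep.congr .nil (by funext v; simp [phi]) (by funext v; simp [phi])
  | cons p E ih =>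
    obtain ⟨i, j⟩ := p
    have key : ∀ {U : Type _} [DecidableEq U] (K : SimpleGraph U) [DecidableRel K.Adj] (u v : U),
        ev K (0, 1, 0) u v = if K.Adj u v then 1 else 0 := by
      intro U _ K _ u v
      unfold ev
      by_cases h : u = v
      · subst h; simp
      · simp [h]
    have key' : ∀ {U : Type _} [DecidableEq U] (K : SimpleGraph U) [DecidableRel K.Adj] (u v : U),
        ev K (0, 1, 0) u v = if K.Adj u v then 1 else 0 := by
      intro U _ K _ u v
      unfold ev
      by_cases h : u = v
      · subst h; simp
      · simp [h]
    refine Rep.congr (.cons i j (0, 1, 0) ih) ?_ ?_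
    · funext v; rw [key G]; simp [phi, adjI]
    · funext v; rw [key' H]; simp [phi, adjI]

lemma good1_sound {n k l m : ℕ} (hG : G.IsSRGWith n k l m) (hH : H.IsSRGWith n k l m)
    (f : ℕ) (vars : List ℕ) (E N : List (ℕ × ℕ)) (hgood : good1 f vars E N = true)
    (hnd : vars.Nodup) (hv : ∀ a ∈ vars, 2 ≤ a)
    (v : ℕ → V) (v' : ℕ → W) (hr : Roots G H v v') :
    sumOver vars (phi G E N) v = sumOver vars (phi H E N) v' := by
  induction f generalizing vars E N with
  | zero =>
    cases N with
    | nil =>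
      rw [good1] at hgood
      exact good2_sound hG hH _ _ _ hgood hnd hv (rep_phi E) v v' hr
    | cons p N => simp [good1] at hgood
  | succ f ih =>
    cases N with
    | nil =>
      rw [good1] at hgood
      exact good2_sound hG hH _ _ _ hgood hnd hv (rep_phi E) v v' hr
    | cons p N =>
      obtain ⟨a, b⟩ := p
      have hv' : ∀ c, ∀ b ∈ vars.erase c, 2 ≤ b := fun c b hb => hv b (List.mem_of_mem_erase hb)
      rw [good1] at hgood
      split_ifs at hgood with h1 h2 h3 h4
      · subst h1
        have e1 : phi G E ((a, a) :: N) = phi G [] [(0, 0)] := by funext w; simp [phi, neqI]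
        have e2 : phi H E ((a, a) :: N) = phi H [] [(0, 0)] := by funext w; simp [phi, neqI]
        have z1 : ∀ (vars : List ℕ) (v : ℕ → V), sumOver vars (phi G [] [(0, 0)]) v = 0 := by
          intro vars
          induction vars with
          | nil => intro v; simp [sumOver, phi, neqI]
          | cons a as ih => intro v; simp [sumOver, ih]
        have z2 : ∀ (vars : List ℕ) (v : ℕ → W), sumOver vars (phi H [] [(0, 0)]) v = 0 := by
          intro vars
          induction vars with
          | nil => intro v; simp [sumOver, phi, neqI]
          | cons a as ih => intro v; simp [sumOver, ih]
        rw [e1, e2, z1, z2]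
      · have n0 : 0 ∉ vars := fun h => by have := hv 0 h; omega
        have n1 : 1 ∉ vars := fun h => by have := hv 1 h; omega
        have aux : a < 2 ∧ b < 2 → (a = 0 ∧ b = 1) ∨ (a = 1 ∧ b = 0) := by omega
        rw [sumOver_congr vars (phi G E ((a, b) :: N)) (phi G E N) v,
          sumOver_congr vars (phi H E ((a, b) :: N)) (phi H E N) v']
        · exact ih _ _ _ hgood hnd hv
        · intro w hw
          apply phi_drop
          rcases h2 with h | h | h | h | h
          · tauto
          · tauto
          · tauto
          · tauto
          · have := hr.ne'
            rcases aux h with ⟨rfl, rfl⟩ | ⟨rfl, rfl⟩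
            · rw [hw 0 n0, hw 1 n1]; tauto
            · rw [hw 0 n0, hw 1 n1]; have := this.symm; tauto
        · intro w hw
          apply phi_drop
          rcases h2 with h | h | h | h | h
          · tauto
          · tauto
          · tauto
          · tauto
          · have := hr.ne
            rcases aux h with ⟨rfl, rfl⟩ | ⟨rfl, rfl⟩
            · rw [hw 0 n0, hw 1 n1]; tauto
            · rw [hw 0 n0, hw 1 n1]; have := this.symm; tauto
      · rw [Bool.and_eq_true] at hgood
        rw [phi_merge G vars E N a b h1 h3 hnd, phi_merge H vars E N a b h1 h3 hnd,
          ih _ _ _ hgood.1 hnd hv, ih _ _ _ hgood.2 (hnd.erase b) (hv' b)]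
      · rw [Bool.and_eq_true] at hgood
        rw [phi_swap G, phi_swap H, phi_merge G vars E N b a (Ne.symm h1) h4 hnd,
          phi_merge H vars E N b a (Ne.symm h1) h4 hnd,
          ih _ _ _ hgood.1 hnd hv, ih _ _ _ hgood.2 (hnd.erase a) (hv' a)]

end Sound

/-! ### Counting paths -/

section Count
variable {V : Type*} [Fintype V] [DecidableEq V] (G : SimpleGraph V) [DecidableRel G.Adj]

/-- Number of paths of length `m` from `x` to `y` avoiding `L`. -/
noncomputable def cnt (y : V) (m : ℕ) (L : List V) (x : V) : ℕ :=
  Nat.card {p : G.Walk x y // p.IsPath ∧ p.length = m ∧ ∀ w ∈ p.support, w ∉ L}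

lemma cnt_zero (y : V) (L : List V) (x : V) :
    cnt G y 0 L x = if x = y then (if x ∈ L then 0 else 1) else 0 := by
  unfold cnt
  split_ifs with h1 h2
  · subst h1
    rw [Nat.card_eq_zero]
    refine Or.inl ⟨fun p => p.2.2.2 x (by simp) h2⟩
  · subst h1
    rw [Nat.card_eq_one_iff_unique]
    refine ⟨⟨?_⟩, ⟨⟨.nil, by simp, by simp, by simpa using h2⟩⟩⟩
    rintro ⟨p, hp⟩ ⟨q, hq⟩
    have h3 := SimpleGraph.Walk.length_eq_zero_iff.1 hp.2.1
    have h4 := SimpleGraph.Walk.length_eq_zero_iff.1 hq.2.1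
    rw [← SimpleGraph.Walk.eq_nil_iff_nil] at h3 h4
    subst h3 h4
    rfl
  · rw [Nat.card_eq_zero]
    exact Or.inl ⟨fun p => h1 (SimpleGraph.Walk.eq_of_length_eq_zero p.2.2.1)⟩

instance finite_walks (x y : V) (m : ℕ) (P : G.Walk x y → Prop) :
    Finite {p : G.Walk x y // p.IsPath ∧ p.length = m ∧ P p} := by
  have : Finite {p : G.Walk x y // p.length = m} :=
    inferInstanceAs (Finite {p : G.Walk x y | p.length = m})
  exact Finite.of_injective (β := {p : G.Walk x y // p.length = m})
    (fun p => ⟨p.1, p.2.2.1⟩) (fun p q h => Subtype.ext (by simpa using h))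

lemma cnt_succ (y : V) (m : ℕ) (L : List V) (x : V) :
    cnt G y (m + 1) L x =
      ∑ z, if x ∈ L then 0 else if G.Adj x z then cnt G y m (x :: L) z else 0 := by
  by_cases hx : x ∈ L
  · simp only [hx, if_true, Finset.sum_const_zero]
    unfold cnt
    rw [Nat.card_eq_zero]
    exact Or.inl ⟨fun p => p.2.2.2 x (by simp) hx⟩
  simp only [hx, if_false]
  let e : {p : G.Walk x y // p.IsPath ∧ p.length = m + 1 ∧ ∀ w ∈ p.support, w ∉ L} ≃
      Σ z : V, {q : G.Walk z y // q.IsPath ∧ q.length = m ∧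
        (G.Adj x z ∧ ∀ w ∈ q.support, w ∉ x :: L)} :=
    { toFun := fun p => match p with
        | ⟨.cons (v := z) h q, hp⟩ => ⟨z, q, by
            rw [SimpleGraph.Walk.cons_isPath_iff] at hp
            obtain ⟨⟨h1, h2⟩, h3, h4⟩ := hp
            refine ⟨h1, by simpa using h3, h, fun w hw => ?_⟩
            have := h4 w (by simp [hw])
            simp only [List.mem_cons, not_or]
            exact ⟨fun hh => h2 (hh ▸ hw), this⟩⟩
      invFun := fun q => ⟨.cons q.2.2.2.2.1 q.2.1, by
        obtain ⟨z, q, h1, h2, h3, h4⟩ := q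
        refine ⟨?_, by simpa using h2, ?_⟩
        · rw [SimpleGraph.Walk.cons_isPath_iff]
          exact ⟨h1, fun hh => h4 x hh (by simp)⟩
        · intro w hw
          rw [SimpleGraph.Walk.support_cons, List.mem_cons] at hw
          rcases hw with rfl | hw
          · exact hx
          · have := h4 w hw
            simp only [List.mem_cons, not_or] at this
            exact this.2⟩
      left_inv := by
        rintro ⟨p, hp⟩
        cases p with
        | nil => simp at hp
        | cons h q => rfl
      right_inv := by
        rintro ⟨z, q, hq⟩
        rfl }
  unfold cnt
  rw [Nat.card_congr e, Nat.card_sigma]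
  refine Finset.sum_congr rfl fun z _ => ?_
  split_ifs with h
  · simp [h]
  · simp [h]

/-- Variables of the path pattern. -/
def genV : ℕ → ℕ → List ℕ
  | 0, _ => []
  | m + 1, z => z :: genV m (z + 1)

/-- Edges of the path pattern. -/
def genE : ℕ → ℕ → ℕ → List (ℕ × ℕ) → List (ℕ × ℕ)
  | 0, c, _, E => (c, 1) :: E
  | m + 1, c, z, E => genE m z (z + 1) ((c, z) :: E)

/-- Distinctness constraints of the path pattern. -/
def genN : ℕ → ℕ → ℕ → List ℕ → List (ℕ × ℕ) → List (ℕ × ℕ)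
  | 0, c, _, L, N => L.map (fun i => (c, i)) ++ (L.map (fun i => (1, i)) ++ N)
  | m + 1, c, z, L, N => genN m z (z + 1) (c :: L) (L.map (fun i => (c, i)) ++ N)

lemma prod_neq (v : ℕ → V) (c : ℕ) (L : List ℕ) :
    ((L.map (fun i => (c, i))).map (neqI v)).prod = if v c ∈ L.map v then 0 else 1 := by
  induction L with
  | nil => simp
  | cons a L ih =>
    simp only [List.map_cons, List.prod_cons, ih, List.mem_cons]
    by_cases h1 : v c = v a <;> simp [neqI, h1]

lemma phi_fresh (E N : List (ℕ × ℕ)) (v : ℕ → V) (z : ℕ) (u : V)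
    (hE : ∀ p ∈ E, p.1 < z ∧ p.2 < z) (hN : ∀ p ∈ N, p.1 < z ∧ p.2 < z) :
    phi G E N (update v z u) = phi G E N v := by
  unfold phi
  congr 2
  · refine List.map_congr_left fun p hp => ?_
    have := hE p hp
    simp [adjI, update_of_ne this.1.ne, update_of_ne this.2.ne]
  · refine List.map_congr_left fun p hp => ?_
    have := hN p hp
    simp [neqI, update_of_ne this.1.ne, update_of_ne this.2.ne]

lemma cnt_eq (m c z : ℕ) (L : List ℕ) (E N : List (ℕ × ℕ)) (v : ℕ → V)
    (hz : 2 ≤ z) (hc : c < z) (hL : ∀ i ∈ L, i < z)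
    (hE : ∀ p ∈ E, p.1 < z ∧ p.2 < z) (hN : ∀ p ∈ N, p.1 < z ∧ p.2 < z) :
    phi G E N v * (cnt G (v 1) (m + 1) (L.map v) (v c) : ℤ) =
      sumOver (genV m z) (phi G (genE m c z E) (genN m c z L N)) v := by
  induction m generalizing c z L E N v with
  | zero =>
    rw [cnt_succ]
    have : (∑ z, if v c ∈ L.map v then 0 else
        if G.Adj (v c) z then cnt G (v 1) 0 (v c :: L.map v) z else 0) =
        if v c ∈ L.map v then 0 else if G.Adj (v c) (v 1) then
          (if v 1 ∈ L.map v then 0 else 1) else 0 := by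
      rw [Finset.sum_eq_single (v 1)]
      · simp only [cnt_zero, if_true]
        by_cases h : G.Adj (v c) (v 1)
        · have := h.ne'
          simp [h, this]
        · simp [h]
      · intro b _ hb
        simp [cnt_zero, hb]
      · simp
    rw [this]
    simp only [sumOver, genV, genE, genN, phi, List.map_append, List.prod_append, prod_neq,
      List.map_cons, List.prod_cons, adjI]
    split_ifs <;> simp
  | succ m ih =>
    rw [cnt_succ]
    simp only [genV, sumOver, genE, genN]
    push_cast
    rw [Finset.mul_sum]
    refine Finset.sum_congr rfl fun u _ => ?_
    have hN' : ∀ p ∈ L.map (fun i => (c, i)) ++ N, p.1 < z ∧ p.2 < z := by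
      intro p hp
      rcases List.mem_append.1 hp with hp | hp
      · obtain ⟨i, hi, rfl⟩ := List.mem_map.1 hp
        exact ⟨hc, hL i hi⟩
      · exact hN p hp
    rw [← ih z (z + 1) (c :: L) ((c, z) :: E) _ (update v z u) (by omega) (by omega)
      (by intro i hi; rcases List.mem_cons.1 hi with rfl | hi
          · omega
          · have := hL i hi; omega)
      (by intro p hp; rcases List.mem_cons.1 hp with rfl | hp
          · exact ⟨by simp; omega, by simp⟩
          · have := hE p hp; omega)
      (by intro p hp; have := hN' p hp; omega)]
    have h1 : update v z u 1 = v 1 := update_of_ne (by omega) _ _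
    have h2 : (c :: L).map (update v z u) = v c :: L.map v := by
      rw [List.map_cons, update_of_ne hc.ne]
      congr 1
      exact List.map_congr_left fun i hi => update_of_ne (hL i hi).ne _ _
    have h3 : phi G ((c, z) :: E) (L.map (fun i => (c, i)) ++ N) (update v z u) =
        (if G.Adj (v c) u then 1 else 0) * phi G E (L.map (fun i => (c, i)) ++ N) v := by
      rw [← phi_fresh G E _ v z u hE hN']
      simp only [phi, List.map_cons, List.prod_cons, adjI, update_of_ne hc.ne, update_self,
        mul_assoc]
    have h4 : phi G E (L.map (fun i => (c, i)) ++ N) v =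
        (if v c ∈ L.map v then 0 else 1) * phi G E N v := by
      simp only [phi, List.map_append, List.prod_append, prod_neq]
      ring
    rw [h1, h2, h3, h4, update_self]
    split_ifs <;> simp

end Count

lemma good_all : ∀ m < 6, good1 (genN m 0 2 [] []).length (genV m 2) (genE m 0 2 [])
    (genN m 0 2 [] []) = true := by
  decide +kernel

lemma genV_ok : ∀ m < 6, (genV m 2).Nodup ∧ ∀ a ∈ genV m 2, 2 ≤ a := by
  decide +kernel

end SRGPath

/-- If `G` and `H` are strongly regular graphs with the same
parameters `(n, k, l, m)`, and `x ≠ y` in `G`, `x' ≠ y'` in `H` are such that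
`x, y` are adjacent iff `x', y'` are adjacent, then for every `2 ≤ ℓ ≤ 7` the
number of paths on `ℓ` vertices from `x` to `y` in `G` equals the number of
paths on `ℓ` vertices from `x'` to `y'` in `H`. -/
theorem srg_path_count_invariant {V W : Type*} [Fintype V] [Fintype W]
    (G : SimpleGraph V) (H : SimpleGraph W)
    [DecidableRel G.Adj] [DecidableRel H.Adj] (n k l m : ℕ)
    (hG : G.IsSRGWith n k l m) (hH : H.IsSRGWith n k l m)
    (x y : V) (x' y' : W) (hxy : x ≠ y) (hxy' : x' ≠ y')
    (hadj : G.Adj x y ↔ H.Adj x' y') :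
    ∀ ℓ : ℕ, 2 ≤ ℓ → ℓ ≤ 7 →
      Nat.card {p : G.Walk x y // p.IsPath ∧ p.length = ℓ - 1} =
      Nat.card {p : H.Walk x' y' // p.IsPath ∧ p.length = ℓ - 1} := by
  classical
  intro ℓ h2 h7
  obtain ⟨r, rfl⟩ : ∃ r, ℓ = r + 2 := ⟨ℓ - 2, by omega⟩
  have hr : r < 6 := by omega
  have e1 := SRGPath.cnt_eq G r 0 2 [] [] [] (fun i => if i = 0 then x else y)
    (by omega) (by omega) (by simp) (by simp) (by simp)
  have e2 := SRGPath.cnt_eq H r 0 2 [] [] [] (fun i => if i = 0 then x' else y')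
    (by omega) (by omega) (by simp) (by simp) (by simp)
  have e3 := SRGPath.good1_sound hG hH _ _ _ _ (SRGPath.good_all r hr)
    (SRGPath.genV_ok r hr).1 (SRGPath.genV_ok r hr).2
    (fun i => if i = 0 then x else y) (fun i => if i = 0 then x' else y')
    ⟨by simpa using hxy, by simpa using hxy', by simpa using hadj⟩
  rw [← e1, ← e2] at e3
  simpa [SRGPath.phi, SRGPath.cnt] using e3
end

section
/- Let G and H be finite simple graphs that are both strongly regular with the same parameters (n, k, λ, μ). Let x ≠ y be vertices of G and x' ≠ y' be vertices of H such that x and y are adjacent in G if and only if x' and y' are adjacent in H. Then for every s with 3 ≤ s ≤ 5, the number of s-cycles through x and y in G equals the number of s-cycles through x' and y' in H. -/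
namespace SRGCyc

open Finset SimpleGraph

open scoped Classical in
/-- Integer equality indicator. -/
noncomputable def E {V : Type*} (u v : V) : ℤ := if u = v then 1 else 0

open scoped Classical in
/-- Integer adjacency indicator. -/
noncomputable def A {V : Type*} (G : SimpleGraph V) (u v : V) : ℤ := if G.Adj u v then 1 else 0

section basic
variable {V : Type*} (G : SimpleGraph V)

lemma A_comm (u v : V) : A G u v = A G v u := by
  have := G.adj_comm u v
  unfold A; split_ifs <;> simp_all
lemma A_self (u : V) : A G u u = 0 := by simp [A]
lemma A_sq (u v : V) : A G u v * A G u v = A G u v := by unfold A; split_ifs <;> simp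
lemma A_cases (u v : V) : (A G u v = 0 ∧ ¬ G.Adj u v) ∨ (A G u v = 1 ∧ G.Adj u v) := by
  unfold A; split_ifs <;> simp_all
lemma E_self (u : V) : E u u = 1 := by simp [E]
lemma E_ne {u v : V} (h : u ≠ v) : E u v = 0 := by simp [E, h]
lemma E_comm (u v : V) : E u v = E v u := by
  unfold E; split_ifs <;> simp_all

variable [Fintype V]

lemma sum_E (f : V → ℤ) (y : V) : ∑ b, E b y * f b = f y := by
  classical
  rw [sum_eq_single y (fun b _ hb => by rw [E_ne hb, zero_mul]) (by simp), E_self, one_mul]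

lemma sum_not1 (f : V → ℤ) (u : V) :
    ∑ b, f b * (1 - E b u) = ∑ b, f b - f u := by
  rw [← sum_E f u, ← sum_sub_distrib]
  exact sum_congr rfl fun b _ => by ring

lemma sum_not2 (f : V → ℤ) {u v : V} (h : u ≠ v) :
    ∑ b, f b * (1 - E b u) * (1 - E b v) = ∑ b, f b - f u - f v := by
  rw [sum_not1 (fun b => f b * (1 - E b u)) v, sum_not1, E_ne h.symm]
  ring

end basic

section srg
variable {V : Type*} [Fintype V] {G : SimpleGraph V} [DecidableRel G.Adj] {n k l m : ℕ}

lemma sum_A (hG : G.IsSRGWith n k l m) (u : V) : ∑ b, A G u b = k := by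
  classical
  have := hG.regular u
  rw [← this, ← G.card_neighborFinset_eq_degree, neighborFinset_eq_filter, card_filter]
  push_cast
  refine sum_congr rfl fun b _ => ?_
  unfold A; congr

lemma S_eq (hG : G.IsSRGWith n k l m) (u v : V) :
    ∑ b, A G u b * A G b v = m + (l - m) * A G u v + (k - m) * E u v := by
  classical
  by_cases huv : u = v
  · subst huv
    rw [E_self, A_self, ← (by ring : (k : ℤ) = m + (l - m) * 0 + (k - m) * 1), ← sum_A hG u]
    exact sum_congr rfl fun b _ => by rw [A_comm G b u, A_sq]
  · have h1 : ∑ b, A G u b * A G b v = (Fintype.card (G.commonNeighbors u v) : ℤ) := by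
      rw [Fintype.card_subtype, card_filter]
      push_cast
      refine sum_congr rfl fun b _ => ?_
      simp only [mem_commonNeighbors, A, G.adj_comm b v]
      split_ifs <;> simp_all
    rw [h1, E_ne huv]
    rcases A_cases G u v with ⟨h, h'⟩ | ⟨h, h'⟩
    · rw [h, hG.of_not_adj huv h']; ring
    · rw [h, hG.of_adj _ _ h']; ring

lemma S_eq' (hG : G.IsSRGWith n k l m) {u v : V} (h : u ≠ v) :
    ∑ b, A G u b * A G b v = m + (l - m) * A G u v := by
  rw [S_eq hG, E_ne h]; ring

/-- Sum over neighbours of `x` other than `y` of an affine function of adjacency to `y`. -/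
lemma sum_aff (hG : G.IsSRGWith n k l m) {x y : V} (h : x ≠ y) (α β : ℤ) :
    ∑ d, A G d x * (1 - E d y) * (α + β * A G d y)
      = α * (k - A G x y) + β * (m + (l - m) * A G x y) := by
  have : ∀ d, A G d x * (1 - E d y) * (α + β * A G d y)
    = (α * A G x d + β * (A G x d * A G d y)) * (1 - E d y) := fun d => by
      rw [A_comm G d x]; ring
  simp only [this]
  rw [sum_not1, sum_add_distrib, ← mul_sum, ← mul_sum, sum_A hG, S_eq' hG h, A_self]
  ring

/-- Number of paths of length three. -/
lemma T_eq (hG : G.IsSRGWith n k l m) {x y : V} (h : x ≠ y) :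
    ∑ c, ∑ d, A G y c * A G c d * A G d x * (1 - E c x) * (1 - E d y)
      = (m - A G x y) * (k - A G x y) + (l - m) * (m + (l - m) * A G x y) := by
  rw [sum_comm, ← sum_aff hG h]
  refine sum_congr rfl fun d _ => ?_
  have : ∀ c, A G y c * A G c d * A G d x * (1 - E c x) * (1 - E d y)
    = A G d x * (1 - E d y) * ((A G y c * A G c d) * (1 - E c x)) := fun c => by ring
  simp only [this]
  rw [← mul_sum, sum_not1, S_eq hG, A_comm G y d, A_comm G y x, A_comm G d x]
  by_cases hd : y = d
  · subst hd; rw [E_self]; ring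
  · rw [E_ne hd]; linear_combination (-(1 - E d y) * A G x y) * A_sq G x d

lemma T2_eq (hG : G.IsSRGWith n k l m) {x y : V} (h : x ≠ y) :
    ∑ c, ∑ d, A G y c * A G c d * A G d x * (1 - E c x) * (1 - E d y) * A G d y
      = (m + (l - m) * A G x y) * (l - A G x y) := by
  rw [sum_comm, ← S_eq' hG h, sum_mul]
  refine sum_congr rfl fun d _ => ?_
  have : ∀ c, A G y c * A G c d * A G d x * (1 - E c x) * (1 - E d y) * A G d y
    = A G d x * A G d y * (1 - E d y) * ((A G y c * A G c d) * (1 - E c x)) := fun c => by ring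
  simp only [this]
  rw [← mul_sum, sum_not1, S_eq hG, A_comm G y d, A_comm G y x, A_comm G d x]
  by_cases hd : y = d
  · subst hd; rw [A_self]; ring
  · rw [E_ne hd, E_ne (Ne.symm hd)]
    rcases A_cases G x d with ⟨e, -⟩ | ⟨e, -⟩ <;> rcases A_cases G d y with ⟨e', -⟩ | ⟨e', -⟩ <;>
      rw [e, e'] <;> ring

lemma T1_eq (hG : G.IsSRGWith n k l m) {x y : V} (h : x ≠ y) :
    ∑ c, ∑ d, A G y c * A G c d * A G d x * (1 - E c x) * (1 - E d y) * A G x c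
      = (m + (l - m) * A G x y) * (l - A G x y) := by
  rw [A_comm G x y, ← T2_eq hG h.symm, sum_comm]
  refine sum_congr rfl fun d _ => sum_congr rfl fun c _ => ?_
  rw [A_comm G y c, A_comm G c d, A_comm G d x, A_comm G x c]; ring

/-- Number of 5-cycles with `y` adjacent to `x` on the cycle (per position). -/
noncomputable def F1 (k l m t : ℤ) : ℤ :=
  t * ((k * m + (l - m) * m - 2 * l) * (k - 1) + (-k + (l - m) ^ 2 + 3 - m) * l)

/-- The number of paths of length three. -/
noncomputable def FT (k l m t : ℤ) : ℤ := (m - t) * (k - t) + (l - m) * (m + (l - m) * t)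

/-- Number of 5-cycles with `y` opposite to `x` (per position). -/
noncomputable def F2 (k l m t : ℤ) : ℤ :=
  (m + (l - m) * t) * FT k l m t - 2 * (m + (l - m) * t) * (l - t)

lemma N1_eq (hG : G.IsSRGWith n k l m) {x y : V} (h : x ≠ y) :
    ∑ b, ∑ c, ∑ d, A G x y * A G y b * A G b c * A G c d * A G d x *
      ((1 - E b x) * (1 - E c x) * (1 - E c y) * (1 - E d y) * (1 - E b d))
      = F1 k l m (A G x y) := by
  rcases A_cases G x y with ⟨e, -⟩ | ⟨e, -⟩
  · simp [e, F1]
  have h1 : ∀ b, ∑ c, ∑ d, A G x y * A G y b * A G b c * A G c d * A G d x *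
      ((1 - E b x) * (1 - E c x) * (1 - E c y) * (1 - E d y) * (1 - E b d))
      = ∑ d, A G d x * (1 - E d y) * (A G y b * (m + (l - m) * A G b d - A G b x - A G y d) *
        (1 - E b x) * (1 - E b d)) := by
    intro b
    rw [sum_comm]
    refine sum_congr rfl fun d _ => ?_
    have : ∀ c, A G x y * A G y b * A G b c * A G c d * A G d x *
      ((1 - E b x) * (1 - E c x) * (1 - E c y) * (1 - E d y) * (1 - E b d))
      = (A G y b * A G d x * (1 - E b x) * (1 - E d y) * (1 - E b d)) *
        ((A G b c * A G c d) * (1 - E c x) * (1 - E c y)) := fun c => by rw [e]; ring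
    simp only [this]
    rw [← mul_sum, sum_not2 _ h, S_eq hG, A_comm G b y, A_comm G x d]
    by_cases hb : b = d
    · subst hb; rw [E_self]; ring
    · rw [E_ne hb]
      rcases A_cases G d x with ⟨e, -⟩ | ⟨e, -⟩ <;>
      rcases A_cases G y b with ⟨e', -⟩ | ⟨e', -⟩ <;> rw [e, e'] <;> ring
  simp only [h1]
  rw [sum_comm]
  have h2 : ∀ d, ∑ b, A G d x * (1 - E d y) *
        (A G y b * (m + (l - m) * A G b d - A G b x - A G y d) * (1 - E b x) * (1 - E b d))
      = A G d x * (1 - E d y) * ((k * m + (l - m) * m - 2 * l : ℤ) +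
        (-k + (l - m) ^ 2 + 3 - m : ℤ) * A G d y) := by
    intro d
    rw [← mul_sum]
    rcases A_cases G d x with ⟨e', -⟩ | ⟨e', hd⟩
    · rw [e']; ring
    by_cases hdy : d = y
    · subst hdy; rw [E_self]; ring
    congr 1
    rw [sum_not2 _ hd.ne.symm]
    have : ∀ b, A G y b * (m + (l - m) * A G b d - A G b x - A G y d)
      = (m - A G y d) * A G y b + (l - m) * (A G y b * A G b d) - A G y b * A G b x := fun b => by
        ring
    have h3 : ∑ b, A G y b * (m + (l - m) * A G b d - A G b x - A G y d)
      = (m - A G y d) * k + (l - m) * (m + (l - m) * A G y d) - (m + (l - m) * A G y x) := by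
      simp only [this]
      rw [sum_sub_distrib, sum_add_distrib, ← mul_sum, ← mul_sum, sum_A hG,
        S_eq' hG (Ne.symm hdy), S_eq' hG h.symm]
    rw [h3, A_self, A_self, A_comm G x d, e', A_comm G y x, e, A_comm G y d]
    linear_combination A_sq G d y
  simp only [h2]
  rw [sum_aff hG h, F1, e]; ring

lemma N4_eq (hG : G.IsSRGWith n k l m) {x y : V} (h : x ≠ y) :
    ∑ a, ∑ b, ∑ c, A G x a * A G a b * A G b c * A G c y * A G y x *
      ((1 - E a y) * (1 - E b x) * (1 - E b y) * (1 - E c x) * (1 - E a c))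
      = F1 k l m (A G x y) := by
  rw [A_comm G x y, ← N1_eq hG h.symm]
  refine sum_congr rfl fun a _ => sum_congr rfl fun b _ => sum_congr rfl fun c _ => ?_
  ring

lemma N2_eq (hG : G.IsSRGWith n k l m) {x y : V} (h : x ≠ y) :
    ∑ a, ∑ c, ∑ d, A G x a * A G a y * A G y c * A G c d * A G d x *
      ((1 - E c x) * (1 - E d y) * (1 - E a c) * (1 - E a d))
      = F2 k l m (A G x y) := by
  have h1 : ∀ c d, ∑ a, A G x a * A G a y * A G y c * A G c d * A G d x *
      ((1 - E c x) * (1 - E d y) * (1 - E a c) * (1 - E a d))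
      = (m + (l - m) * A G x y) * (A G y c * A G c d * A G d x * (1 - E c x) * (1 - E d y))
        - A G y c * A G c d * A G d x * (1 - E c x) * (1 - E d y) * A G x c
        - A G y c * A G c d * A G d x * (1 - E c x) * (1 - E d y) * A G d y := by
    intro c d
    rcases A_cases G c d with ⟨e', -⟩ | ⟨e', hd⟩
    · simp [e']
    have : ∀ a, A G x a * A G a y * A G y c * A G c d * A G d x *
      ((1 - E c x) * (1 - E d y) * (1 - E a c) * (1 - E a d))
      = (A G y c * A G c d * A G d x * (1 - E c x) * (1 - E d y)) *
      ((A G x a * A G a y) * (1 - E a c) * (1 - E a d)) := fun a => by ring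
    simp only [this]
    rw [← mul_sum, sum_not2 _ hd.ne, S_eq' hG h, A_comm G c y, A_comm G x d]
    rcases A_cases G d x with ⟨e, -⟩ | ⟨e, -⟩ <;>
      rcases A_cases G y c with ⟨e', -⟩ | ⟨e', -⟩ <;> rw [e, e'] <;> ring
  rw [sum_comm]
  have h2 : ∀ c, ∑ a, ∑ d, A G x a * A G a y * A G y c * A G c d * A G d x *
      ((1 - E c x) * (1 - E d y) * (1 - E a c) * (1 - E a d)) =
    ∑ d, ((m + (l - m) * A G x y) * (A G y c * A G c d * A G d x * (1 - E c x) * (1 - E d y))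
        - A G y c * A G c d * A G d x * (1 - E c x) * (1 - E d y) * A G x c
        - A G y c * A G c d * A G d x * (1 - E c x) * (1 - E d y) * A G d y) := by
    intro c
    rw [sum_comm]
    exact sum_congr rfl fun d _ => h1 c d
  simp only [h2, sum_sub_distrib, ← mul_sum]
  rw [T_eq hG h, T1_eq hG h, T2_eq hG h, F2, FT]
  ring

lemma N3_eq (hG : G.IsSRGWith n k l m) {x y : V} (h : x ≠ y) :
    ∑ a, ∑ b, ∑ d, A G x a * A G a b * A G b y * A G y d * A G d x *
      ((1 - E a y) * (1 - E b x) * (1 - E a d) * (1 - E b d))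
      = F2 k l m (A G x y) := by
  rw [A_comm G x y, ← N2_eq hG h.symm]
  have : ∀ a, ∑ b, ∑ d, A G x a * A G a b * A G b y * A G y d * A G d x *
      ((1 - E a y) * (1 - E b x) * (1 - E a d) * (1 - E b d)) =
      ∑ d, ∑ b, A G x a * A G a b * A G b y * A G y d * A G d x *
      ((1 - E a y) * (1 - E b x) * (1 - E a d) * (1 - E b d)) := fun a => sum_comm
  simp only [this]
  rw [sum_comm]
  refine sum_congr rfl fun d _ => sum_congr rfl fun a _ => sum_congr rfl fun b _ => ?_
  rw [E_comm a d, E_comm b d]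
  ring

end srg

section walks
variable {V : Type*} (G : SimpleGraph V)

lemma card3 (x y : V) (hxy : x ≠ y) :
    Nat.card {w : G.Walk x x // w.IsCycle ∧ w.length = 3 ∧ y ∈ w.support} =
    Nat.card {t : V × V // (G.Adj x t.1 ∧ G.Adj t.1 t.2 ∧ G.Adj t.2 x) ∧
      (t.1 = y ∨ t.2 = y)} := by
  symm
  refine Nat.card_congr (Equiv.ofBijective (fun t => ⟨.cons t.2.1.1 (.cons t.2.1.2.1
    (.cons t.2.1.2.2 .nil)), ?_⟩) ⟨?_, ?_⟩)
  · obtain ⟨⟨a, b⟩, ⟨h1, h2, h3⟩, h4⟩ := t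
    have := h1.ne; have := h2.ne; have := h3.ne
    simp only at *
    refine ⟨?_, rfl, ?_⟩
    · simp [Walk.cons_isCycle_iff]; grind
    · simp; grind
  · rintro ⟨⟨a, b⟩, h⟩ ⟨⟨a', b'⟩, h'⟩ heq
    have := congrArg (fun w => w.1.support) heq
    simpa using this
  · rintro ⟨w, hw, hl, hy⟩
    match w, hl with
    | .cons (v := a) h1 (.cons (v := b) h2 (.cons h3 .nil)), _ =>
      refine ⟨⟨(a, b), ⟨h1, h2, h3⟩, ?_⟩, rfl⟩
      simp at hy; grind

lemma card4 (x y : V) (hxy : x ≠ y) :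
    Nat.card {w : G.Walk x x // w.IsCycle ∧ w.length = 4 ∧ y ∈ w.support} =
    Nat.card {t : V × V × V // (G.Adj x t.1 ∧ G.Adj t.1 t.2.1 ∧ G.Adj t.2.1 t.2.2 ∧
      G.Adj t.2.2 x) ∧ (t.2.1 ≠ x ∧ t.1 ≠ t.2.2) ∧
      (t.1 = y ∨ t.2.1 = y ∨ t.2.2 = y)} := by
  symm
  refine Nat.card_congr (Equiv.ofBijective (fun t => ⟨.cons t.2.1.1 (.cons t.2.1.2.1
    (.cons t.2.1.2.2.1 (.cons t.2.1.2.2.2 .nil))), ?_⟩) ⟨?_, ?_⟩)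
  · obtain ⟨⟨a, b, c⟩, ⟨h1, h2, h3, h5⟩, h6, h4⟩ := t
    have := h1.ne; have := h2.ne; have := h3.ne; have := h5.ne
    simp only at *
    refine ⟨?_, rfl, ?_⟩
    · simp [Walk.cons_isCycle_iff]; grind
    · simp; grind
  · rintro ⟨⟨a, b, c⟩, h⟩ ⟨⟨a', b', c'⟩, h'⟩ heq
    have := congrArg (fun w => w.1.support) heq
    simpa using this
  · rintro ⟨w, hw, hl, hy⟩
    match w, hl with
    | .cons (v := a) h1 (.cons (v := b) h2 (.cons (v := c) h3 (.cons h4 .nil))), _ =>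
      refine ⟨⟨(a, b, c), ⟨h1, h2, h3, h4⟩, ?_, ?_⟩, rfl⟩
      · simp [Walk.cons_isCycle_iff] at hw; grind
      · simp at hy; grind

lemma card5 (x y : V) (hxy : x ≠ y) :
    Nat.card {w : G.Walk x x // w.IsCycle ∧ w.length = 5 ∧ y ∈ w.support} =
    Nat.card {t : V × V × V × V // (G.Adj x t.1 ∧ G.Adj t.1 t.2.1 ∧ G.Adj t.2.1 t.2.2.1 ∧
      G.Adj t.2.2.1 t.2.2.2 ∧ G.Adj t.2.2.2 x) ∧ (t.2.1 ≠ x ∧ t.2.2.1 ≠ x ∧ t.1 ≠ t.2.2.1 ∧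
        t.1 ≠ t.2.2.2 ∧ t.2.1 ≠ t.2.2.2) ∧
      (t.1 = y ∨ t.2.1 = y ∨ t.2.2.1 = y ∨ t.2.2.2 = y)} := by
  symm
  refine Nat.card_congr (Equiv.ofBijective (fun t => ⟨.cons t.2.1.1 (.cons t.2.1.2.1
    (.cons t.2.1.2.2.1 (.cons t.2.1.2.2.2.1 (.cons t.2.1.2.2.2.2 .nil)))), ?_⟩) ⟨?_, ?_⟩)
  · obtain ⟨⟨a, b, c, d⟩, ⟨h1, h2, h3, h5, h7⟩, h6, h4⟩ := t
    have := h1.ne; have := h2.ne; have := h3.ne; have := h5.ne; have := h7.ne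
    simp only at *
    refine ⟨?_, rfl, ?_⟩
    · simp [Walk.cons_isCycle_iff]; grind
    · simp; grind
  · rintro ⟨⟨a, b, c, d⟩, h⟩ ⟨⟨a', b', c', d'⟩, h'⟩ heq
    have := congrArg (fun w => w.1.support) heq
    simpa using this
  · rintro ⟨w, hw, hl, hy⟩
    match w, hl with
    | .cons (v := a) h1 (.cons (v := b) h2 (.cons (v := c) h3 (.cons (v := d) h4
        (.cons h5 .nil)))), _ =>
      refine ⟨⟨(a, b, c, d), ⟨h1, h2, h3, h4, h5⟩, ?_, ?_⟩, rfl⟩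
      · simp [Walk.cons_isCycle_iff] at hw; grind
      · simp at hy; grind

end walks

section final
variable {V : Type*} [Fintype V] {G : SimpleGraph V} [DecidableRel G.Adj] {n k l m : ℕ}

lemma count3 (hG : G.IsSRGWith n k l m) {x y : V} (h : x ≠ y) :
    (Nat.card {w : G.Walk x x // w.IsCycle ∧ w.length = 3 ∧ y ∈ w.support} : ℤ) =
      2 * A G x y * (m + (l - m) * A G x y) := by
  classical
  rw [card3 G x y h, Nat.card_eq_fintype_card, Fintype.card_subtype, card_filter]
  push_cast
  rw [Fintype.sum_prod_type]
  have h1 : ∀ a b : V, (if (G.Adj x a ∧ G.Adj a b ∧ G.Adj b x) ∧ (a = y ∨ b = y) then 1 else 0 : ℤ)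
    = E a y * (A G x a * A G a b * A G b x) + E b y * (A G x a * A G a b * A G b x) := by
    intro a b
    by_cases hab : G.Adj a b
    · have := hab.ne
      simp only [A, E]
      grind
    · simp [A, hab]
  simp only [h1, sum_add_distrib, sum_E, ← mul_sum]
  simp only [mul_assoc, ← mul_sum]
  simp only [← mul_assoc, ← sum_mul]
  rw [S_eq' hG h, S_eq' hG h.symm, A_comm G y x]
  ring

lemma count4 (hG : G.IsSRGWith n k l m) {x y : V} (h : x ≠ y) :
    (Nat.card {w : G.Walk x x // w.IsCycle ∧ w.length = 4 ∧ y ∈ w.support} : ℤ) =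
      2 * A G x y * FT k l m (A G x y) +
        ((m + (l - m) * A G x y) ^ 2 - (m + (l - m) * A G x y)) := by
  classical
  rw [card4 G x y h, Nat.card_eq_fintype_card, Fintype.card_subtype, card_filter]
  push_cast
  simp only [Fintype.sum_prod_type]
  have h1 : ∀ a b c : V, (if (G.Adj x a ∧ G.Adj a b ∧ G.Adj b c ∧ G.Adj c x) ∧
      (b ≠ x ∧ a ≠ c) ∧ (a = y ∨ b = y ∨ c = y) then 1 else 0 : ℤ)
    = E a y * (A G x a * A G a b * A G b c * A G c x * ((1 - E b x) * (1 - E a c)))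
    + E b y * (A G x a * A G a b * A G b c * A G c x * ((1 - E b x) * (1 - E a c)))
    + E c y * (A G x a * A G a b * A G b c * A G c x * ((1 - E b x) * (1 - E a c))) := by
    intro a b c
    by_cases hab : G.Adj a b
    · by_cases hbc : G.Adj b c
      · have := hab.ne
        have := hbc.ne
        simp only [A, E]
        grind
      · simp [A, hbc]
    · simp [A, hab]
  simp only [h1, sum_add_distrib, ← mul_sum, sum_E]
  have e1 : ∑ b, ∑ c, A G x y * A G y b * A G b c * A G c x * ((1 - E b x) * (1 - E y c))
      = A G x y * FT k l m (A G x y) := by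
    rw [FT, ← T_eq hG h, mul_sum]
    refine sum_congr rfl fun b _ => ?_
    rw [mul_sum]
    refine sum_congr rfl fun c _ => ?_
    rw [E_comm y c]; ring
  have e2 : ∑ a, ∑ b, A G x a * A G a b * A G b y * A G y x * ((1 - E b x) * (1 - E a y))
      = A G x y * FT k l m (A G x y) := by
    rw [A_comm G x y, FT, ← T_eq hG h.symm, mul_sum]
    refine sum_congr rfl fun b _ => ?_
    rw [mul_sum]
    refine sum_congr rfl fun c _ => ?_
    ring
  have e3 : ∑ a, ∑ c, A G x a * A G a y * A G y c * A G c x * ((1 - E y x) * (1 - E a c))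
      = (m + (l - m) * A G x y) ^ 2 - (m + (l - m) * A G x y) := by
    have : ∀ a, ∑ c, A G x a * A G a y * A G y c * A G c x * ((1 - E y x) * (1 - E a c))
      = (A G x a * A G a y) * (m + (l - m) * A G x y) - A G x a * A G a y := by
      intro a
      have : ∀ c, A G x a * A G a y * A G y c * A G c x * ((1 - E y x) * (1 - E a c))
        = (A G x a * A G a y) * ((A G y c * A G c x) * (1 - E c a)) := fun c => by
          rw [E_ne h.symm, E_comm a c]; ring
      simp only [this]
      rw [← mul_sum, sum_not1, S_eq' hG h.symm, A_comm G y x, A_comm G y a, A_comm G a x]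
      rcases A_cases G x a with ⟨e, -⟩ | ⟨e, -⟩ <;>
        rcases A_cases G a y with ⟨e', -⟩ | ⟨e', -⟩ <;> rw [e, e'] <;> ring
    simp only [this]
    rw [sum_sub_distrib, ← sum_mul, S_eq' hG h]; ring
  rw [e1, e2, e3]; ring

lemma count5 (hG : G.IsSRGWith n k l m) {x y : V} (h : x ≠ y) :
    (Nat.card {w : G.Walk x x // w.IsCycle ∧ w.length = 5 ∧ y ∈ w.support} : ℤ) =
      2 * F1 k l m (A G x y) + 2 * F2 k l m (A G x y) := by
  classical
  rw [card5 G x y h, Nat.card_eq_fintype_card, Fintype.card_subtype, card_filter]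
  push_cast
  simp only [Fintype.sum_prod_type]
  have h1 : ∀ a b c d : V, (if (G.Adj x a ∧ G.Adj a b ∧ G.Adj b c ∧ G.Adj c d ∧ G.Adj d x) ∧
      (b ≠ x ∧ c ≠ x ∧ a ≠ c ∧ a ≠ d ∧ b ≠ d) ∧ (a = y ∨ b = y ∨ c = y ∨ d = y) then 1 else 0 : ℤ)
    = E a y * (A G x a * A G a b * A G b c * A G c d * A G d x *
        ((1 - E b x) * (1 - E c x) * (1 - E a c) * (1 - E a d) * (1 - E b d)))
    + E b y * (A G x a * A G a b * A G b c * A G c d * A G d x *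
        ((1 - E b x) * (1 - E c x) * (1 - E a c) * (1 - E a d) * (1 - E b d)))
    + E c y * (A G x a * A G a b * A G b c * A G c d * A G d x *
        ((1 - E b x) * (1 - E c x) * (1 - E a c) * (1 - E a d) * (1 - E b d)))
    + E d y * (A G x a * A G a b * A G b c * A G c d * A G d x *
        ((1 - E b x) * (1 - E c x) * (1 - E a c) * (1 - E a d) * (1 - E b d))) := by
    intro a b c d
    by_cases hall : (G.Adj x a ∧ G.Adj a b ∧ G.Adj b c ∧ G.Adj c d ∧ G.Adj d x) ∧
      (b ≠ x ∧ c ≠ x ∧ a ≠ c ∧ a ≠ d ∧ b ≠ d)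
    · obtain ⟨⟨p1, p2, p3, p4, p5⟩, q1, q2, q3, q4, q5⟩ := hall
      have := p2.ne
      have := p3.ne
      have := p4.ne
      simp only [A, E, p1, p2, p3, p4, p5, q1, q2, q3, q4, q5]
      grind
    · have hz : A G x a * A G a b * A G b c * A G c d * A G d x *
        ((1 - E b x) * (1 - E c x) * (1 - E a c) * (1 - E a d) * (1 - E b d)) = 0 := by
        by_contra hne
        apply hall
        simp only [mul_eq_zero, not_or, A, E] at hne
        grind
      rw [hz, if_neg (fun hh => hall ⟨hh.1, hh.2.1⟩)]; ring
  simp only [h1, sum_add_distrib, ← mul_sum, sum_E]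
  have e : ∀ p q r s : ℤ, p = F1 k l m (A G x y) → q = F2 k l m (A G x y) →
      r = F2 k l m (A G x y) → s = F1 k l m (A G x y) →
      p + q + r + s = 2 * F1 k l m (A G x y) + 2 * F2 k l m (A G x y) := by
    rintro _ _ _ _ rfl rfl rfl rfl; ring
  apply e
  · rw [← N1_eq hG h]
    refine sum_congr rfl fun b _ => sum_congr rfl fun c _ => sum_congr rfl fun d _ => ?_
    rw [E_comm y c, E_comm y d]
    try ring
  · rw [← N2_eq hG h]
    refine sum_congr rfl fun b _ => sum_congr rfl fun c _ => sum_congr rfl fun d _ => ?_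
    rw [E_ne h.symm, E_comm y d]
    try ring
  · rw [← N3_eq hG h]
    refine sum_congr rfl fun b _ => sum_congr rfl fun c _ => sum_congr rfl fun d _ => ?_
    rw [E_ne h.symm]; ring
  · rw [← N4_eq hG h]
    refine sum_congr rfl fun b _ => sum_congr rfl fun c _ => sum_congr rfl fun d _ => ?_
    ring

end final

end SRGCyc

/-- If `G` and `H` are strongly regular graphs with the same
parameters, `x ≠ y` in `G` and `x' ≠ y'` in `H` with matching adjacency, then
for every `3 ≤ s ≤ 5` the number of `s`-cycles through `x` and `y` in `G`
equals the number of `s`-cycles through `x'` and `y'` in `H`. -/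
theorem srg_cycle_through_pair_count_invariant {V W : Type*} [Fintype V] [Fintype W]
    (G : SimpleGraph V) (H : SimpleGraph W)
    [DecidableRel G.Adj] [DecidableRel H.Adj] (n k l m : ℕ)
    (hG : G.IsSRGWith n k l m) (hH : H.IsSRGWith n k l m)
    (x y : V) (x' y' : W) (hxy : x ≠ y) (hxy' : x' ≠ y')
    (hadj : G.Adj x y ↔ H.Adj x' y') :
    ∀ s : ℕ, 3 ≤ s → s ≤ 5 →
      Nat.card {w : G.Walk x x // w.IsCycle ∧ w.length = s ∧ y ∈ w.support} =
      Nat.card {w : H.Walk x' x' // w.IsCycle ∧ w.length = s ∧ y' ∈ w.support} := by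
  have hA : SRGCyc.A G x y = SRGCyc.A H x' y' := by
    simp only [SRGCyc.A, hadj]; congr
  intro s h3 h5
  obtain rfl | rfl | rfl : s = 3 ∨ s = 4 ∨ s = 5 := by omega
  · have h1 := SRGCyc.count3 hG hxy
    rw [hA, ← SRGCyc.count3 hH hxy'] at h1
    exact_mod_cast h1
  · have h1 := SRGCyc.count4 hG hxy
    rw [hA, ← SRGCyc.count4 hH hxy'] at h1
    exact_mod_cast h1
  · have h1 := SRGCyc.count5 hG hxy
    rw [hA, ← SRGCyc.count5 hH hxy'] at h1
    exact_mod_cast h1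
end

section
/- Let V be a finite type, let α : V → V → C define an association scheme, and let G be a constituent graph of this scheme. Then for every s with 3 ≤ s ≤ 7 and any vertices x, y, x', y' with G.Adj x y and G.Adj x' y', the number of s-cycles containing the edge {x, y} equals the number of s-cycles containing the edge {x', y'}. -/
namespace CycCount

/-- Rename the vertex `v` to `u`. -/
def ren (v u : ℕ) (n : ℕ) : ℕ := bif Nat.beq n v then u else n

def renP (v u : ℕ) (p : ℕ × ℕ) : ℕ × ℕ := (ren v u p.1, ren v u p.2)

/-- Is the vertex `v` an end of the pair `p`? -/
def inc (v : ℕ) (p : ℕ × ℕ) : Bool := Nat.beq p.1 v || Nat.beq p.2 v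

/-- The end of `p` other than `v`. -/
def oth (v : ℕ) (p : ℕ × ℕ) : ℕ := bif Nat.beq p.1 v then p.2 else p.1

/-- The two pairs agree as unordered pairs. -/
def same (p q : ℕ × ℕ) : Bool :=
  (Nat.beq p.1 q.1 && Nat.beq p.2 q.2) || (Nat.beq p.1 q.2 && Nat.beq p.2 q.1)

/-- Remove the first element satisfying `f`. -/
def pick {X : Type} (f : X → Bool) : List X → Option (X × List X)
  | [] => none
  | a :: l => bif f a then some (a, l) else
    match pick f l with
    | none => none
    | some (b, l') => some (b, a :: l')

def nbrs (v : ℕ) : List (ℕ × ℕ) → List ℕ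
  | [] => []
  | p :: l =>
    bif inc v p then
      bif Nat.beq (oth v p) v || (nbrs v l).any (fun u => Nat.beq u (oth v p)) then nbrs v l
      else oth v p :: nbrs v l
    else nbrs v l

/-- Symbolic elimination procedure. -/
def chk : ℕ → List ℕ → List (ℕ × ℕ) → List (ℕ × ℕ) → Bool
  | 0, _, _, _ => false
  | fuel + 1, vars, hard, soft =>
    bif soft.any (fun p => Nat.beq p.1 p.2) then true else
    match vars with
    | [] => hard.all (fun p => Nat.ble p.1 1 && Nat.ble p.2 1) &&
        soft.all (fun p => Nat.ble p.1 1 && Nat.ble p.2 1)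
    | a :: vs =>
      match pick (fun v => Nat.ble (nbrs v hard).length 2) (a :: vs) with
      | none => false
      | some (v, L) =>
        match pick (inc v) soft with
        | some (p, S) =>
          bif hard.any (same p) || Nat.ble (nbrs v (soft ++ hard)).length 2 then chk fuel (v :: L) (p :: hard) S
          else bif S.any (same p) then chk fuel (v :: L) hard S
          else
            chk fuel (v :: L) hard S &&
            chk fuel L (hard.map (renP v (oth v p))) (S.map (renP v (oth v p)))
        | none =>
          let u := (nbrs v hard).getD 0 0
          let w := (nbrs v hard).getD 1 0
          (!(Nat.beq u v)) && (!(Nat.beq w v)) &&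
          (hard.filter (inc v)).all
            (fun p => Nat.beq (oth v p) u || Nat.beq (oth v p) w || Nat.beq (oth v p) v) &&
          chk fuel L ((u, w) :: hard.filter (fun p => !inc v p)) soft

def pairsOf : List ℕ → List (ℕ × ℕ)
  | [] => []
  | a :: l => l.map (fun b => (a, b)) ++ pairsOf l

def hardE (s : ℕ) : List (ℕ × ℕ) :=
  (s - 1, 0) :: (List.range (s - 2)).map (fun i => (i + 1, i + 2))
def varsE (s : ℕ) : List ℕ := ((List.range (s - 2)).map (fun i => i + 2)).reverse
def softE (s : ℕ) : List (ℕ × ℕ) := pairsOf ((List.range (s - 1)).map (fun i => i + 1) ++ [0])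

theorem chk7 : chk 100 (varsE 7) (hardE 7) (softE 7) = true := by decide +kernel
theorem chk6 : chk 100 (varsE 6) (hardE 6) (softE 6) = true := by decide +kernel
theorem chk5 : chk 100 (varsE 5) (hardE 5) (softE 5) = true := by decide +kernel
theorem chk4 : chk 100 (varsE 4) (hardE 4) (softE 4) = true := by decide +kernel
theorem chk3 : chk 100 (varsE 3) (hardE 3) (softE 3) = true := by decide +kernel

section Sound

variable {V C : Type*}

/-- Sum of `F` over all values of the listed variables (head innermost). -/
noncomputable def T [Fintype V] : List ℕ → ((ℕ → V) → ℤ) → (ℕ → V) → ℤ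
  | [], F => F
  | v :: L, F => T L (fun e => ∑ z, F (Function.update e v z))

noncomputable def hval (H : List ((ℕ × ℕ) × (V → V → ℤ))) (e : ℕ → V) : ℤ :=
  (H.map fun f => f.2 (e f.1.1) (e f.1.2)).prod

open Classical in
noncomputable def neq (a b : V) : ℤ := if a = b then 0 else 1

noncomputable def sval (S : List (ℕ × ℕ)) (e : ℕ → V) : ℤ :=
  (S.map fun p => neq (e p.1) (e p.2)).prod

theorem beqF {a b : ℕ} : Nat.beq a b = false ↔ a ≠ b := by
  rw [← Bool.not_eq_true, Nat.beq_eq]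

theorem neq_self (a : V) : neq a a = 0 := by simp [neq]
theorem neq_comm (a b : V) : neq a b = neq b a := by
  unfold neq; split_ifs <;> simp_all

theorem T_sub [Fintype V] (L : List ℕ) : ∀ F G : (ℕ → V) → ℤ,
    T L (fun e => F e - G e) = fun e => T L F e - T L G e := by
  induction L with
  | nil => intro F G; rfl
  | cons v L ih =>
    intro F G
    simp only [T, Finset.sum_sub_distrib]
    exact ih _ _

theorem T_zero [Fintype V] (L : List ℕ) : T L (fun _ : ℕ → V => (0 : ℤ)) = fun _ => 0 := by
  induction L with
  | nil => rfl
  | cons v L ih => simpa [T] using ih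

theorem T_perm [Fintype V] {L L' : List ℕ} (h : L.Perm L') :
    ∀ F : (ℕ → V) → ℤ, T L F = T L' F := by
  induction h with
  | nil => intro F; rfl
  | cons v _ ih => intro F; exact ih _
  | swap a b L =>
    intro F
    simp only [T]
    congr 1
    funext e
    by_cases hab : a = b
    · subst hab; rfl
    · rw [Finset.sum_comm]
      refine Finset.sum_congr rfl fun z _ => Finset.sum_congr rfl fun z' _ => ?_
      rw [Function.update_comm hab]
  | trans _ _ ih1 ih2 => intro F; rw [ih1, ih2]

theorem pick_some {X : Type} (f : X → Bool) : ∀ (l : List X) (a : X) (l' : List X),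
    pick f l = some (a, l') → f a = true ∧ l.Perm (a :: l') := by
  intro l
  induction l with
  | nil => intro a l' h; simp [pick] at h
  | cons b l ih =>
    intro a l' h
    rw [pick] at h
    cases hb : f b with
    | true =>
      rw [hb] at h
      simp only [cond_true, Option.some.injEq, Prod.mk.injEq] at h
      obtain ⟨rfl, rfl⟩ := h
      exact ⟨hb, List.Perm.refl _⟩
    | false =>
      rw [hb] at h
      simp only [cond_false] at h
      cases hp : pick f l with
      | none => simp [hp] at h
      | some q =>
        obtain ⟨c, l''⟩ := q
        simp only [hp, Option.some.injEq, Prod.mk.injEq] at h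
        obtain ⟨rfl, rfl⟩ := h
        obtain ⟨h1, h2⟩ := ih _ _ hp
        exact ⟨h1, (h2.cons b).trans (List.Perm.swap _ _ _)⟩

theorem pick_none {X : Type} (f : X → Bool) : ∀ (l : List X),
    pick f l = none → ∀ a ∈ l, f a = false := by
  intro l
  induction l with
  | nil => simp
  | cons b l ih =>
    intro h
    rw [pick] at h
    cases hb : f b with
    | true => simp [hb] at h
    | false =>
      rw [hb] at h
      simp only [cond_false] at h
      cases hp : pick f l with
      | none => 
        intro a ha
        rcases List.mem_cons.1 ha with rfl | ha
        · exact hb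
        · exact ih hp a ha
      | some q => simp [hp] at h

theorem update_ren (e : ℕ → V) (v u n : ℕ) :
    Function.update e v (e u) n = e (ren v u n) := by
  unfold ren
  by_cases h : n = v
  · subst h; simp
  · have : Nat.beq n v = false := beqF.2 h
    simp [h, this]

theorem hval_ren (H : List ((ℕ × ℕ) × (V → V → ℤ))) (e : ℕ → V) (v u : ℕ) :
    hval H (Function.update e v (e u)) = hval (H.map fun f => (renP v u f.1, f.2)) e := by
  simp [hval, update_ren, renP, Function.comp_def]

theorem sval_ren (S : List (ℕ × ℕ)) (e : ℕ → V) (v u : ℕ) :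
    sval S (Function.update e v (e u)) = sval (S.map (renP v u)) e := by
  simp [sval, update_ren, renP, Function.comp_def]

theorem inc_false {v : ℕ} {p : ℕ × ℕ} (h : inc v p = false) : p.1 ≠ v ∧ p.2 ≠ v := by
  simpa only [inc, Bool.or_eq_false_iff, beqF] using h

theorem sval_update (S : List (ℕ × ℕ)) (e : ℕ → V) (v : ℕ) (z : V)
    (h : ∀ p ∈ S, inc v p = false) : sval S (Function.update e v z) = sval S e := by
  unfold sval
  congr 1
  refine List.map_congr_left fun p hp => ?_
  obtain ⟨h1, h2⟩ := inc_false (h p hp)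
  simp [h1, h2]

theorem hval_update (H : List ((ℕ × ℕ) × (V → V → ℤ))) (e : ℕ → V) (v : ℕ) (z : V)
    (h : ∀ f ∈ H, inc v f.1 = false) : hval H (Function.update e v z) = hval H e := by
  unfold hval
  congr 1
  refine List.map_congr_left fun p hp => ?_
  obtain ⟨h1, h2⟩ := inc_false (h p hp)
  simp [h1, h2]

theorem hval_split (H : List ((ℕ × ℕ) × (V → V → ℤ))) (g : ℕ × ℕ → Bool) (e : ℕ → V) :
    hval H e = hval (H.filter fun f => g f.1) e * hval (H.filter fun f => !g f.1) e := by
  induction H with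
  | nil => simp [hval]
  | cons f H ih =>
    simp only [hval, List.map_cons, List.prod_cons] at ih ⊢
    rw [ih]
    cases hg : g f.1 <;> simp [hg] <;> ring

theorem sval_perm {S S' : List (ℕ × ℕ)} (h : S.Perm S') (e : ℕ → V) : sval S e = sval S' e :=
  (h.map _).prod_eq

theorem sval_cons (p : ℕ × ℕ) (S : List (ℕ × ℕ)) (e : ℕ → V) :
    sval (p :: S) e = neq (e p.1) (e p.2) * sval S e := by simp [sval]

theorem hval_cons (f : (ℕ × ℕ) × (V → V → ℤ)) (H : List ((ℕ × ℕ) × (V → V → ℤ))) (e : ℕ → V) :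
    hval (f :: H) e = f.2 (e f.1.1) (e f.1.2) * hval H e := by simp [hval]

theorem sval_zero {S : List (ℕ × ℕ)} {e : ℕ → V} {p : ℕ × ℕ} (hp : p ∈ S)
    (h : neq (e p.1) (e p.2) = 0) : sval S e = 0 := by
  apply List.prod_eq_zero
  exact List.mem_map.2 ⟨p, hp, h⟩

theorem sval_dup {S : List (ℕ × ℕ)} {p : ℕ × ℕ} (h : S.any (same p) = true) (e : ℕ → V) :
    sval (p :: S) e = sval S e := by
  rw [sval_cons]
  obtain ⟨q, hq, hs⟩ := List.any_eq_true.1 h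
  have hpq : neq (e p.1) (e p.2) = neq (e q.1) (e q.2) := by
    simp only [same, Bool.or_eq_true, Bool.and_eq_true, Nat.beq_eq] at hs
    rcases hs with ⟨h1, h2⟩ | ⟨h1, h2⟩
    · rw [h1, h2]
    · rw [h1, h2, neq_comm]
  by_cases h0 : neq (e p.1) (e p.2) = 0
  · rw [h0, sval_zero hq (by rw [← hpq, h0])]; simp
  · have : neq (e p.1) (e p.2) = 1 := by
      unfold neq at h0 ⊢
      split_ifs at h0 ⊢ <;> simp_all
    rw [this, one_mul]

/-- A matrix in the coherent algebra. -/
def Good (α : V → V → C) (M : V → V → ℤ) : Prop :=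
  ∀ a b a' b', α a b = α a' b' → M a b = M a' b'

def Inv (α : V → V → C) (F : (ℕ → V) → ℤ) : Prop :=
  ∀ e e' : ℕ → V, α (e 0) (e 1) = α (e' 0) (e' 1) → F e = F e'

theorem Good.mul {α : V → V → C} {M N : V → V → ℤ} (hM : Good α M) (hN : Good α N) :
    Good α (fun a b => M a b * N a b) := by
  intro a b a' b' h
  simp only [hM _ _ _ _ h, hN _ _ _ _ h]

theorem Good.ex {α : V → V → C} {M : V → V → ℤ} (hM : Good α M) :
    ∃ p : C → ℤ, ∀ a b, M a b = p (α a b) := by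
  classical
  refine ⟨fun c => if h : ∃ q : V × V, α q.1 q.2 = c then
    M h.choose.1 h.choose.2 else 0, fun a b => ?_⟩
  have h : ∃ q : V × V, α q.1 q.2 = α a b := ⟨(a, b), rfl⟩
  simp only [h, dif_pos]
  exact hM _ _ _ _ h.choose_spec.symm

theorem Good.prod [Fintype V] [Fintype C] {α : V → V → C}
    (hstable : ∀ x y x' y' : V, α x y = α x' y' → ∀ c d : C,
      Nat.card {z : V // α x z = c ∧ α z y = d} =
      Nat.card {z : V // α x' z = c ∧ α z y' = d})
    {P Q : V → V → ℤ} (hP : Good α P) (hQ : Good α Q) :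
    Good α (fun a b => ∑ z, P a z * Q z b) := by
  classical
  obtain ⟨p, hp⟩ := hP.ex
  obtain ⟨q, hq⟩ := hQ.ex
  have key : ∀ a b, ∑ z, P a z * Q z b =
      ∑ c : C, ∑ d : C, (Nat.card {z : V // α a z = c ∧ α z b = d} : ℤ) * (p c * q d) := by
    intro a b
    have h1 : ∀ z, P a z * Q z b =
        ∑ c : C, ∑ d : C, if α a z = c ∧ α z b = d then p c * q d else 0 := by
      intro z
      rw [Finset.sum_eq_single (α a z), Finset.sum_eq_single (α z b)]
      · simp [hp, hq]
      · intro d _ hd; simp [hd.symm]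
      · simp
      · intro c _ hc; simp [hc.symm]
      · simp
    rw [Finset.sum_congr rfl fun z _ => h1 z, Finset.sum_comm]
    refine Finset.sum_congr rfl fun c _ => ?_
    rw [Finset.sum_comm]
    refine Finset.sum_congr rfl fun d _ => ?_
    rw [← Finset.sum_filter, Finset.sum_const, nsmul_eq_mul, Nat.card_eq_fintype_card,
      Fintype.card_subtype]
  intro a b a' b' h
  simp only [key]
  exact Finset.sum_congr rfl fun c _ => Finset.sum_congr rfl fun d _ => by
    rw [hstable _ _ _ _ h]

theorem Good.diag {α : V → V → C} (hdiag : ∀ x y : V, α x x = α y y)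
    {M : V → V → ℤ} (hM : Good α M) (a b : V) : M a a = M b b := hM _ _ _ _ (hdiag a b)

theorem Good.trans {α : V → V → C}
    (htrans : ∀ x y x' y' : V, α x y = α x' y' → α y x = α y' x')
    {M : V → V → ℤ} (hM : Good α M) : Good α (fun a b => M b a) :=
  fun _ _ _ _ h => hM _ _ _ _ (htrans _ _ _ _ h)

theorem good_neq {α : V → V → C} (hdiag : ∀ x y : V, α x x = α y y)
    (hoffdiag : ∀ x y z : V, x ≠ y → α x y ≠ α z z) : Good α (neq : V → V → ℤ) := by
  have h : ∀ a b, a = b ↔ α a b = α a a := fun a b =>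
    ⟨fun h => by rw [← h], fun h => by by_contra hn; exact hoffdiag _ _ _ hn h⟩
  intro a b a' b' hab
  have : a = b ↔ a' = b' := by rw [h a b, h a' b', hab, hdiag a a']
  unfold neq; split_ifs <;> simp_all

theorem elim_aux {α : V → V → C} (hdiag : ∀ x y : V, α x x = α y y)
    (htrans : ∀ x y x' y' : V, α x y = α x' y' → α y x = α y' x')
    {v u w : ℕ} (hu : u ≠ v) (hw : w ≠ v) (H : List ((ℕ × ℕ) × (V → V → ℤ)))
    (hg : ∀ f ∈ H, Good α f.2) (hi : ∀ f ∈ H, inc v f.1 = true)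
    (ho : ∀ f ∈ H, oth v f.1 = u ∨ oth v f.1 = w ∨ oth v f.1 = v) :
    ∃ P Q : V → V → ℤ, Good α P ∧ Good α Q ∧ ∀ e z,
      hval H (Function.update e v z) = P (e u) z * Q z (e w) := by
  induction H with
  | nil => exact ⟨fun _ _ => 1, fun _ _ => 1, fun _ _ _ _ _ => rfl, fun _ _ _ _ _ => rfl,
      fun e z => by simp [hval]⟩
  | cons f H ih =>
    obtain ⟨P, Q, hP, hQ, h⟩ := ih (fun f hf => hg f (List.mem_cons_of_mem _ hf))
      (fun f hf => hi f (List.mem_cons_of_mem _ hf)) (fun f hf => ho f (List.mem_cons_of_mem _ hf))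
    have hM := hg f List.mem_cons_self
    have hi' := hi f List.mem_cons_self
    have ho' := ho f List.mem_cons_self
    obtain ⟨⟨i, j⟩, M⟩ := f
    simp only [hval_cons, h]
    simp only [inc, Bool.or_eq_true, Nat.beq_eq] at hi'
    simp only [oth] at ho'
    simp only at hM
    by_cases hiv : i = v
    · subst hiv
      have hb : Nat.beq i i = true := by simp
      rw [hb] at ho'
      simp only [cond_true] at ho'
      rcases ho' with rfl | rfl | rfl
      · refine ⟨fun a z => P a z * M z a, Q, hP.mul (hM.trans htrans), hQ, fun e z => ?_⟩
        simp [hu]; ring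
      · refine ⟨P, fun z b => Q z b * M z b, hP, hQ.mul hM, fun e z => ?_⟩
        simp [hw]; ring
      · refine ⟨P, fun z b => Q z b * M z z, hP, hQ.mul (N := fun z _ => M z z)
          (fun a _ a' _ _ => hM.diag hdiag a a'), fun e z => ?_⟩
        simp; ring
    · have hjv : j = v := by tauto
      subst hjv
      have hb : Nat.beq i j = false := beqF.2 hiv
      rw [hb] at ho'
      simp only [cond_false] at ho'
      rcases ho' with rfl | rfl | rfl
      · refine ⟨fun a z => P a z * M a z, Q, hP.mul hM, hQ, fun e z => ?_⟩
        simp [hu]; ring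
      · refine ⟨P, fun z b => Q z b * M b z, hP, hQ.mul (hM.trans htrans), fun e z => ?_⟩
        simp [hw]; ring
      · exact absurd rfl hiv

theorem final_aux {α : V → V → C} (hdiag : ∀ x y : V, α x x = α y y)
    (htrans : ∀ x y x' y' : V, α x y = α x' y' → α y x = α y' x')
    {M : V → V → ℤ} (hM : Good α M) {i j : ℕ} (hi : i ≤ 1) (hj : j ≤ 1)
    {e e' : ℕ → V} (h : α (e 0) (e 1) = α (e' 0) (e' 1)) : M (e i) (e j) = M (e' i) (e' j) := by
  interval_cases i <;> interval_cases j
  · exact hM.diag hdiag _ _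
  · exact hM _ _ _ _ h
  · exact hM _ _ _ _ (htrans _ _ _ _ h)
  · exact hM.diag hdiag _ _

theorem sound [Fintype V] [Fintype C] {α : V → V → C}
    (hdiag : ∀ x y : V, α x x = α y y)
    (hoffdiag : ∀ x y z : V, x ≠ y → α x y ≠ α z z)
    (htrans : ∀ x y x' y' : V, α x y = α x' y' → α y x = α y' x')
    (hstable : ∀ x y x' y' : V, α x y = α x' y' → ∀ c d : C,
      Nat.card {z : V // α x z = c ∧ α z y = d} =
      Nat.card {z : V // α x' z = c ∧ α z y' = d}) (fuel : ℕ) :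
    ∀ (vars : List ℕ) (H : List ((ℕ × ℕ) × (V → V → ℤ))) (S : List (ℕ × ℕ)),
      (∀ f ∈ H, Good α f.2) → chk fuel vars (H.map Prod.fst) S = true →
      Inv α (T vars (fun e => hval H e * sval S e)) := by
  induction fuel with
  | zero => intro vars H S _ h; simp [chk] at h
  | succ fuel ih =>
    intro vars H S hH h
    unfold chk at h
    cases hloop : S.any (fun p => Nat.beq p.1 p.2) with
    | true =>
      obtain ⟨p, hp, hpp⟩ := List.any_eq_true.1 hloop
      have : (fun e : ℕ → V => hval H e * sval S e) = fun _ => 0 := by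
        funext e
        rw [sval_zero hp (by rw [Nat.eq_of_beq_eq_true hpp, neq_self]), mul_zero]
      rw [this, T_zero]
      intro _ _ _; rfl
    | false =>
    rw [hloop, cond_false] at h
    cases vars with
    | nil =>
      simp only [Bool.and_eq_true, List.all_eq_true, Nat.ble_eq] at h
      obtain ⟨h1, h2⟩ := h
      intro e e' hee
      simp only [T]
      congr 1
      · unfold hval
        congr 1
        refine List.map_congr_left fun f hf => ?_
        have := h1 f.1 (List.mem_map_of_mem hf)
        exact final_aux hdiag htrans (hH f hf) this.1 this.2 hee
      · unfold sval
        congr 1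
        refine List.map_congr_left fun p hp => ?_
        exact final_aux hdiag htrans (good_neq hdiag hoffdiag) (h2 p hp).1 (h2 p hp).2 hee
    | cons a vs =>
    simp only at h
    cases hpk : pick (fun v => Nat.ble (nbrs v (H.map Prod.fst)).length 2) (a :: vs) with
    | none => simp [hpk] at h
    | some q =>
    obtain ⟨v, L⟩ := q
    rw [T_perm (pick_some _ _ _ _ hpk).2]
    simp only [hpk] at h
    cases hps : pick (inc v) S with
    | some q =>
      obtain ⟨p, R⟩ := q
      obtain ⟨hinc, hperm⟩ := pick_some _ _ _ _ hps
      simp only [hps] at h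
      have hSR : ∀ e : ℕ → V, sval S e = sval (p :: R) e := sval_perm hperm
      simp only [hSR]
      cases hA : ((H.map Prod.fst).any (same p) ||
          Nat.ble (nbrs v (S ++ H.map Prod.fst)).length 2) with
      | true =>
        rw [hA, cond_true] at h
        have := ih (v :: L) ((p, neq) :: H) R (by
          intro f hf
          rcases List.mem_cons.1 hf with rfl | hf
          · exact good_neq hdiag hoffdiag
          · exact hH f hf) h
        convert this using 3 with e
        rw [sval_cons, hval_cons]; ring
      | false =>
      rw [hA, cond_false] at h
      cases hB : R.any (same p) with
      | true =>
        rw [hB, cond_true] at h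
        simp only [sval_dup hB]
        exact ih _ _ _ hH h
      | false =>
      rw [hB, cond_false, Bool.and_eq_true] at h
      have i1 := ih _ _ _ hH h.1
      have i2 := ih L (H.map fun f => (renP v (oth v p) f.1, f.2)) _ (by
        intro f hf
        obtain ⟨g, hg, rfl⟩ := List.mem_map.1 hf
        exact hH g hg) (by
        have h2 := h.2
        rw [List.map_map] at h2 ⊢
        exact h2)
      have hpne : oth v p ≠ v := by
        intro hc
        have hne : Nat.beq p.1 p.2 = false := by
          have := List.any_eq_false.1 hloop p (hperm.mem_iff.2 List.mem_cons_self)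
          exact beqF.2 (by simpa using this)
        have hne' : p.1 ≠ p.2 := beqF.1 hne
        simp only [inc, Bool.or_eq_true, Nat.beq_eq] at hinc
        unfold oth at hc
        by_cases h1 : p.1 = v
        · have : Nat.beq p.1 v = true := by simpa using h1
          rw [this, cond_true] at hc
          exact hne' (h1.trans hc.symm)
        · have : Nat.beq p.1 v = false := beqF.2 h1
          rw [this, cond_false] at hc
          exact h1 hc
      have hnq : ∀ e : ℕ → V, neq (e p.1) (e p.2) = neq (e v) (e (oth v p)) := by
        intro e
        simp only [inc, Bool.or_eq_true, Nat.beq_eq] at hinc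
        unfold oth
        by_cases h1 : p.1 = v
        · have : Nat.beq p.1 v = true := by simpa using h1
          rw [this, cond_true, h1]
        · have : Nat.beq p.1 v = false := beqF.2 h1
          rw [this, cond_false, neq_comm, show p.2 = v by tauto]
      have hT : T (v :: L) (fun e => hval H e * sval (p :: R) e) = fun e =>
          T (v :: L) (fun e => hval H e * sval R e) e -
          T L (fun e => hval (H.map fun f => (renP v (oth v p) f.1, f.2)) e *
            sval (R.map (renP v (oth v p))) e) e := by
        simp only [T]
        rw [← T_sub]
        congr 1
        funext e
        rw [← hval_ren, ← sval_ren]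
        classical
        have : hval H (Function.update e v (e (oth v p))) *
            sval R (Function.update e v (e (oth v p))) = ∑ z, if z = e (oth v p) then
              hval H (Function.update e v z) * sval R (Function.update e v z) else 0 := by
          simp
        rw [this, ← Finset.sum_sub_distrib]
        refine Finset.sum_congr rfl fun z _ => ?_
        rw [sval_cons, hnq, Function.update_self, Function.update_of_ne hpne]
        unfold neq
        split_ifs <;> ring
      rw [hT]
      intro e e' hee
      simp only [i1 e e' hee, i2 e e' hee]
    | none =>
      have hSn := pick_none _ _ hps
      simp only [hps, Bool.and_eq_true, Bool.not_eq_true'] at h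
      obtain ⟨⟨⟨hu, hw⟩, hall⟩, hc⟩ := h
      generalize (nbrs v (H.map Prod.fst)).getD 0 0 = u at *
      generalize (nbrs v (H.map Prod.fst)).getD 1 0 = w at *
      have hu' : u ≠ v := beqF.1 hu
      have hw' : w ≠ v := beqF.1 hw
      simp only [List.all_eq_true, List.mem_filter, Bool.or_eq_true, Nat.beq_eq] at hall
      obtain ⟨P, Q, hP, hQ, hPQ⟩ := elim_aux hdiag htrans hu' hw'
        (H.filter fun f => inc v f.1) (fun f hf => hH f (List.mem_filter.1 hf).1)
        (fun f hf => by simpa using (List.mem_filter.1 hf).2) (fun f hf => by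
          have h1 := List.mem_filter.1 hf
          have := hall f.1 ⟨List.mem_map_of_mem h1.1, by simpa using h1.2⟩
          tauto)
      have := ih L (((u, w), fun a b => ∑ z, P a z * Q z b) ::
        H.filter fun f => !inc v f.1) S (by
          intro f hf
          rcases List.mem_cons.1 hf with rfl | hf
          · exact Good.prod hstable hP hQ
          · exact hH f (List.mem_filter.1 hf).1) (by
          rw [List.filter_map] at hc
          exact hc)
      simp only [T]
      convert this using 3 with e
      rw [hval_cons, Finset.sum_mul, Finset.sum_mul]
      refine Finset.sum_congr rfl fun z _ => ?_
      rw [hval_split H (inc v), hPQ, sval_update S e v z hSn, hval_update _ e v z]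
      intro f hf
      simpa using (List.mem_filter.1 hf).2

end Sound

section Count

variable {V C : Type*}

open Classical in
/-- Indicator of a proposition. -/
noncomputable def ind (p : Prop) : ℤ := if p then 1 else 0

open Classical in
noncomputable def adjM (G : SimpleGraph V) (a b : V) : ℤ := if G.Adj a b then 1 else 0

/-- Number of walks of length `n` whose support satisfies `P`. -/
noncomputable def A (G : SimpleGraph V) (n : ℕ) (u v : V) (P : List V → Prop) : ℤ :=
  (Nat.card {p : G.Walk u v // p.length = n ∧ P p.support} : ℤ)

theorem A_succ [Fintype V] (G : SimpleGraph V) (n : ℕ) (u v : V) (P : List V → Prop) :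
    A G (n + 1) u v P = ∑ z, adjM G u z * A G n z v (fun l => P (u :: l)) := by
  classical
  have hfin : ∀ (n : ℕ) (u v : V) (P : List V → Prop),
      Finite {p : G.Walk u v // p.length = n ∧ P p.support} := by
    intro n u v P
    have : Finite {p : G.Walk u v // p.length = n} := inferInstance
    exact Finite.of_injective
      (fun p : {p : G.Walk u v // p.length = n ∧ P p.support} =>
        (⟨p.1, p.2.1⟩ : {p : G.Walk u v // p.length = n}))
      (fun p q h => Subtype.ext (by simpa using h))
  let f : (Σ z : {z : V // G.Adj u z},
      {p : G.Walk z.1 v // p.length = n ∧ P (u :: p.support)}) →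
      {p : G.Walk u v // p.length = n + 1 ∧ P p.support} := fun q =>
    ⟨SimpleGraph.Walk.cons q.1.2 q.2.1, by simp [q.2.2.1], by
      simpa using q.2.2.2⟩
  have hf : Function.Bijective f := by
    constructor
    · rintro ⟨⟨z, hz⟩, p, hp⟩ ⟨⟨z', hz'⟩, p', hp'⟩ h
      simp only [f, Subtype.mk.injEq, SimpleGraph.Walk.cons.injEq] at h
      obtain ⟨rfl, h⟩ := h
      cases h
      rfl
    · rintro ⟨p, hl, hP⟩
      cases p with
      | nil => simp at hl
      | cons h q =>
        exact ⟨⟨⟨_, h⟩, q, by simpa using hl, by simpa using hP⟩, rfl⟩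
  have := fun (z : {z : V // G.Adj u z}) => hfin n z.1 v (fun l => P (u :: l))
  unfold A
  rw [← Nat.card_eq_of_bijective f hf, Nat.card_sigma, Nat.cast_sum]
  simp only [adjM, ite_mul, one_mul, zero_mul]
  rw [← Finset.sum_filter]
  exact (Finset.sum_subtype _ (by simp) (fun z => (Nat.card {p : G.Walk z v // p.length = n ∧
    P (u :: p.support)} : ℤ))).symm

open Classical in
theorem A_zero (G : SimpleGraph V) (u v : V) (P : List V → Prop) :
    A G 0 u v P = if u = v then (if P [u] then 1 else 0) else 0 := by
  unfold A
  by_cases h : u = v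
  · subst h
    by_cases hP : P [u]
    · simp only [hP, if_true]
      have : Nat.card {p : G.Walk u u // p.length = 0 ∧ P p.support} = 1 := by
        rw [Nat.card_eq_one_iff_unique]
        refine ⟨⟨fun ⟨p, hp⟩ ⟨q, hq⟩ => ?_⟩, ⟨⟨.nil, rfl, by simpa using hP⟩⟩⟩
        cases p with
        | nil => 
          cases q with
          | nil => rfl
          | cons h q => simp at hq
        | cons h q => simp at hp
      rw [this]; rfl
    · simp only [hP, if_true, if_false]
      have : IsEmpty {p : G.Walk u u // p.length = 0 ∧ P p.support} := by
        refine ⟨fun ⟨p, hp⟩ => ?_⟩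
        cases p with
        | nil => exact hP (by simpa using hp)
        | cons h q => simp at hp
      rw [Nat.card_of_isEmpty]; rfl
  · simp only [h, if_false]
    have : IsEmpty {p : G.Walk u v // p.length = 0 ∧ P p.support} := by
      refine ⟨fun ⟨p, hp⟩ => ?_⟩
      exact h (SimpleGraph.Walk.eq_of_length_eq_zero hp.1)
    rw [Nat.card_of_isEmpty]; rfl

open Classical in
theorem A_one [Fintype V] (G : SimpleGraph V) (u v : V) (P : List V → Prop) :
    A G 1 u v P = adjM G u v * ind (P [u, v]) := by
  rw [show (1 : ℕ) = 0 + 1 from rfl, A_succ]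
  simp only [A_zero, mul_ite, mul_zero]
  rw [Finset.sum_ite_eq']
  simp [ind]

open Classical in
theorem sval_pairs (l : List ℕ) (e : ℕ → V) :
    sval (pairsOf l) e = ind (l.map e).Nodup := by
  induction l with
  | nil => simp [pairsOf, sval, ind]
  | cons a l ih =>
    have h1 : sval (pairsOf (a :: l)) e =
        (l.map fun b => neq (e a) (e b)).prod * sval (pairsOf l) e := by
      simp [pairsOf, sval, Function.comp_def]
    have h2 : ∀ l : List ℕ, (l.map fun b => neq (e a) (e b)).prod =
        if e a ∈ l.map e then 0 else 1 := by
      intro l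
      induction l with
      | nil => simp
      | cons b l ih' =>
        rw [List.map_cons, List.prod_cons, ih']
        unfold neq
        by_cases hab : e a = e b
        · simp [hab]
        · simp [hab]
    rw [h1, h2, ih, List.map_cons, List.nodup_cons]
    by_cases ha : e a ∈ l.map e <;> simp [ha, ind]

theorem A_rev (G : SimpleGraph V) (n : ℕ) (u v : V) :
    A G n u v List.Nodup = A G n v u List.Nodup := by
  unfold A
  congr 1
  refine Nat.card_eq_of_bijective (fun p => ⟨p.1.reverse, by simpa using p.2⟩) ⟨?_, ?_⟩
  · rintro ⟨p, hp⟩ ⟨q, hq⟩ h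
    simp only [Subtype.mk.injEq] at h
    exact Subtype.ext (SimpleGraph.Walk.reverse_injective h)
  · rintro ⟨p, hp⟩
    exact ⟨⟨p.reverse, by simpa using hp⟩, by simp⟩

theorem cycles_eq (G : SimpleGraph V) (s : ℕ) (hs : 3 ≤ s) (x y : V) (h : G.Adj x y) :
    (Nat.card {w : G.Walk x x // w.IsCycle ∧ w.length = s ∧ w.getVert 1 = y} : ℤ) =
      A G (s - 1) y x List.Nodup := by
  unfold A
  congr 1
  symm
  refine Nat.card_eq_of_bijective (fun p => ⟨SimpleGraph.Walk.cons h p.1, ?_, ?_, ?_⟩) ⟨?_, ?_⟩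
  · obtain ⟨p, hl, hn⟩ := p
    rw [SimpleGraph.Walk.cons_isCycle_iff]
    refine ⟨(SimpleGraph.Walk.isPath_def _).2 hn, ?_⟩
    intro hmem
    cases p with
    | nil => simp at hmem
    | @cons _ z _ h' q =>
      simp only [SimpleGraph.Walk.support_cons, List.nodup_cons] at hn
      simp only [SimpleGraph.Walk.edges_cons, List.mem_cons] at hmem
      rcases hmem with hmem | hmem
      · have hz : z = x := by
          rw [Sym2.eq_iff] at hmem
          rcases hmem with ⟨h1, h2⟩ | ⟨h1, h2⟩
          · exact absurd h1 h.ne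
          · exact h1.symm
        subst hz
        have hq : q.IsPath := (SimpleGraph.Walk.isPath_def _).2 hn.2
        have hq0 : q.length = 0 := SimpleGraph.Walk.length_eq_zero_iff.2
          (SimpleGraph.Walk.isPath_iff_nil.1 hq)
        simp only [SimpleGraph.Walk.length_cons] at hl
        omega
      · exact hn.1 (SimpleGraph.Walk.snd_mem_support_of_mem_edges _ hmem)
  · have := p.2.1
    simp only [SimpleGraph.Walk.length_cons]
    omega
  · simp
  · rintro ⟨p, hp⟩ ⟨q, hq⟩ h
    simpa using h
  · rintro ⟨w, hc, hl, hv⟩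
    cases w with
    | nil => simp at hl; omega
    | @cons _ z _ h' q =>
      have hz : z = y := by simpa using hv
      subst hz
      rw [SimpleGraph.Walk.cons_isCycle_iff] at hc
      refine ⟨⟨q, ?_, (SimpleGraph.Walk.isPath_def _).1 hc.1⟩, rfl⟩
      simp at hl
      omega

theorem T_eq [Fintype V] (G : SimpleGraph V) (s : ℕ) (h3 : 3 ≤ s) (h7 : s ≤ 7) (x y : V) :
    A G (s - 1) y x List.Nodup =
      T (varsE s) (fun e => hval ((hardE s).map fun p => (p, adjM G)) e * sval (softE s) e)
        (fun n => if n = 0 then x else y) := by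
  classical
  have A2 : ∀ (n : ℕ) (u v : V) (P : List V → Prop),
      A G (n + 2) u v P = ∑ z, adjM G u z * A G (n + 1) z v (fun l => P (u :: l)) :=
    fun n u v P => A_succ G (n + 1) u v P
  simp only [softE, sval_pairs]
  interval_cases s
  all_goals
    simp only [Nat.reduceSub, A2 0, A2 1, A2 2, A2 3, A2 4, A_one, Nat.reduceAdd, zero_add,
      varsE, hardE, List.range_succ, List.range_zero, List.nil_append, List.cons_append,
      List.map_cons, List.map_nil, List.reverse_cons, List.reverse_nil, T, hval,
      List.prod_cons, List.prod_nil, Finset.mul_sum]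
    repeat refine Finset.sum_congr rfl fun _ _ => ?_
    simp [Function.update]
    try ring

end Count

end CycCount

open CycCount in
theorem constituent_cycle_through_edge_count_invariant
    {V C : Type*} [Fintype V] [Fintype C] (α : V → V → C)
    (hdiag : ∀ x y : V, α x x = α y y)
    (hoffdiag : ∀ x y z : V, x ≠ y → α x y ≠ α z z)
    (htrans : ∀ x y x' y' : V, α x y = α x' y' → α y x = α y' x')
    (hstable : ∀ x y x' y' : V, α x y = α x' y' → ∀ c d : C,
      Nat.card {z : V // α x z = c ∧ α z y = d} =
      Nat.card {z : V // α x' z = c ∧ α z y' = d})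
    (G : SimpleGraph V) (c₀ : C) (hc₀ : ∀ x : V, c₀ ≠ α x x)
    (hG : ∀ x y : V, G.Adj x y ↔ (α x y = c₀ ∨ α y x = c₀)) :
    ∀ s : ℕ, 3 ≤ s → s ≤ 7 → ∀ x y x' y' : V, G.Adj x y → G.Adj x' y' →
      Nat.card {w : G.Walk x x // w.IsCycle ∧ w.length = s ∧ w.getVert 1 = y} =
      Nat.card {w : G.Walk x' x' // w.IsCycle ∧ w.length = s ∧ w.getVert 1 = y'} := by
  intro s h3 h7
  have hgood : Good α (adjM G) := by
    intro a b a' b' h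
    have h' := htrans _ _ _ _ h
    have : G.Adj a b ↔ G.Adj a' b' := by rw [hG, hG, h, h']
    unfold adjM
    split_ifs <;> simp_all
  have hchk : chk 100 (varsE s) (hardE s) (softE s) = true := by
    interval_cases s
    · exact chk3
    · exact chk4
    · exact chk5
    · exact chk6
    · exact chk7
  have hinv := sound hdiag hoffdiag htrans hstable 100 (varsE s)
    ((hardE s).map fun p => (p, adjM G)) (softE s) (by
      intro f hf
      obtain ⟨p, _, rfl⟩ := List.mem_map.1 hf
      exact hgood) (by
      rw [List.map_map]
      simpa [Function.comp_def] using hchk)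
  have hcol : ∀ x y x' y' : V, α x y = α x' y' →
      A G (s - 1) y x List.Nodup = A G (s - 1) y' x' List.Nodup := by
    intro x y x' y' h
    rw [T_eq G s h3 h7, T_eq G s h3 h7]
    exact hinv _ _ (by simpa using h)
  intro x y x' y' hxy hxy'
  apply Nat.cast_injective (R := ℤ)
  rw [cycles_eq G s h3 x y hxy, cycles_eq G s h3 x' y' hxy']
  have e1 : ∀ x y, G.Adj x y → ∃ a b, α a b = c₀ ∧
      A G (s - 1) y x List.Nodup = A G (s - 1) b a List.Nodup := by
    intro x y h
    rcases (hG x y).1 h with h | h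
    · exact ⟨x, y, h, rfl⟩
    · exact ⟨y, x, h, A_rev _ _ _ _⟩
  obtain ⟨a, b, hab, h1⟩ := e1 x y hxy
  obtain ⟨a', b', hab', h2⟩ := e1 x' y' hxy'
  rw [h1, h2]
  exact hcol _ _ _ _ (hab.trans hab'.symm)
end

section
/- Let V be a finite type, let α : V → V → C define an association scheme, and let G be a constituent graph of this scheme. Then for all vertices x, y, x', y' with α x y = α x' y', the pairs (x, y) and (x', y') have the same stable WL2-color in G, i.e., R_i (x, y) (x', y') holds for every i ∈ ℕ. -/
/-- The iterated 2-dimensional Weisfeiler-Leman equivalence relations `R_i` on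
pairs of vertices of a simple graph `G`. -/
def wlRel {V : Type*} (G : SimpleGraph V) : ℕ → V × V → V × V → Prop
  | 0, p, q => ((p.1 = p.2) ↔ (q.1 = q.2)) ∧ (G.Adj p.1 p.2 ↔ G.Adj q.1 q.2)
  | i + 1, p, q => wlRel G i p q ∧ ∀ uv u'v' : V × V,
      Nat.card {z : V // wlRel G i (p.1, z) uv ∧ wlRel G i (z, p.2) u'v'} =
      Nat.card {z : V // wlRel G i (q.1, z) uv ∧ wlRel G i (z, q.2) u'v'}

theorem wlRel_symm_aux {V : Type*} (G : SimpleGraph V) (i : ℕ) :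
    ∀ p q : V × V, wlRel G i p q → wlRel G i q p := by
  induction i with
  | zero =>
    intro p q h
    simp only [wlRel] at h ⊢
    exact ⟨h.1.symm, h.2.symm⟩
  | succ i ih =>
    intro p q h
    simp only [wlRel] at h ⊢
    exact ⟨ih _ _ h.1, fun a b => (h.2 a b).symm⟩

theorem wlRel_trans_aux {V : Type*} (G : SimpleGraph V) (i : ℕ) :
    ∀ p q r : V × V, wlRel G i p q → wlRel G i q r → wlRel G i p r := by
  induction i with
  | zero =>
    intro p q r h k
    simp only [wlRel] at h k ⊢
    exact ⟨h.1.trans k.1, h.2.trans k.2⟩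
  | succ i ih =>
    intro p q r h k
    simp only [wlRel] at h k ⊢
    exact ⟨ih _ _ _ h.1 k.1, fun a b => (h.2 a b).trans (k.2 a b)⟩

/-- If `α : V → V → C` defines an association scheme and `G` is a
constituent graph of this scheme, then pairs of vertices with equal scheme color have
the same stable WL2-color in `G`: `R_i (x, y) (x', y')` holds for all `i`. -/
theorem constituent_scheme_color_determines_wl_color
    {V C : Type*} [Fintype V] [Fintype C] (α : V → V → C)
    (hdiag : ∀ x y : V, α x x = α y y)
    (hoffdiag : ∀ x y z : V, x ≠ y → α x y ≠ α z z)
    (htrans : ∀ x y x' y' : V, α x y = α x' y' → α y x = α y' x')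
    (hstable : ∀ x y x' y' : V, α x y = α x' y' → ∀ c d : C,
      Nat.card {z : V // α x z = c ∧ α z y = d} =
      Nat.card {z : V // α x' z = c ∧ α z y' = d})
    (G : SimpleGraph V) (c₀ : C) (hc₀ : ∀ x : V, c₀ ≠ α x x)
    (hG : ∀ x y : V, G.Adj x y ↔ (α x y = c₀ ∨ α y x = c₀)) :
    ∀ x y x' y' : V, α x y = α x' y' → ∀ i : ℕ, wlRel G i (x, y) (x', y') := by
  intro x y x' y' h i
  induction i generalizing x y x' y' with
  | zero =>
    simp only [wlRel]
    refine ⟨⟨?_, ?_⟩, ?_⟩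
    · rintro rfl
      by_contra hne
      exact hoffdiag _ _ _ hne h.symm
    · rintro rfl
      by_contra hne
      exact hoffdiag _ _ _ hne h
    · rw [hG, hG, h, htrans _ _ _ _ h]
  | succ i ih =>
    simp only [wlRel]
    refine ⟨ih _ _ _ _ h, fun uv wt => ?_⟩
    have hf : ∀ c : C × C, Nonempty ({z : V // (α x z, α z y) = c} ≃
        {z : V // (α x' z, α z y') = c}) := by
      rintro ⟨c, d⟩
      simp only [Prod.mk.injEq]
      exact Finite.card_eq.mp (hstable _ _ _ _ h c d)
    let e : V ≃ V := Equiv.ofFiberEquiv (f := fun z => (α x z, α z y))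
      (g := fun z => (α x' z, α z y')) (fun c => (hf c).some)
    have he : ∀ z, (α x' (e z), α (e z) y') = (α x z, α z y) := fun z =>
      Equiv.ofFiberEquiv_map (f := fun z => (α x z, α z y))
        (g := fun z => (α x' z, α z y')) (fun c => (hf c).some) z
    refine Nat.card_congr (e.subtypeEquiv fun z => ?_)
    have h1 := he z
    simp only [Prod.mk.injEq] at h1
    have a := ih _ _ _ _ h1.1
    have b := ih _ _ _ _ h1.2
    constructor
    · rintro ⟨p, q⟩
      exact ⟨wlRel_trans_aux G i _ _ _ a p, wlRel_trans_aux G i _ _ _ b q⟩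
    · rintro ⟨p, q⟩
      exact ⟨wlRel_trans_aux G i _ _ _ (wlRel_symm_aux G i _ _ a) p,
        wlRel_trans_aux G i _ _ _ (wlRel_symm_aux G i _ _ b) q⟩
end

section
/- Let G be a finite simple graph that is 1/2-regular. Then for every s with 2 ≤ s ≤ 7, the number of paths on s vertices starting at a vertex x is the same for every vertex x of G. -/
set_option linter.unusedSectionVars false

namespace HalfReg

open Finset

/-! ### The stable relation -/

section WL
variable {V : Type*} (G : SimpleGraph V)

lemma wl_refl (i : ℕ) (p : V × V) : wlRel G i p p := by
  induction i with
  | zero => simp [wlRel]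
  | succ i ih => exact ⟨ih, fun _ _ => rfl⟩

lemma wl_symm (i : ℕ) {p q : V × V} (h : wlRel G i p q) : wlRel G i q p := by
  induction i with
  | zero => exact ⟨h.1.symm, h.2.symm⟩
  | succ i ih => exact ⟨ih h.1, fun a b => (h.2 a b).symm⟩

lemma wl_trans (i : ℕ) {p q s : V × V} (h : wlRel G i p q) (h' : wlRel G i q s) :
    wlRel G i p s := by
  induction i with
  | zero => exact ⟨h.1.trans h'.1, h.2.trans h'.2⟩
  | succ i ih => exact ⟨ih h.1 h'.1, fun a b => (h.2 a b).trans (h'.2 a b)⟩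

lemma wl_swap (i : ℕ) {p q : V × V} (h : wlRel G i p q) :
    wlRel G i p.swap q.swap := by
  induction i generalizing p q with
  | zero =>
    refine ⟨?_, ?_⟩
    · simpa [eq_comm] using h.1
    · simpa [G.adj_comm] using h.2
  | succ i ih =>
    have sw : ∀ p q : V × V, wlRel G i p.swap q ↔ wlRel G i p q.swap := fun p q =>
      ⟨fun h => by simpa using ih h, fun h => by simpa using ih h⟩
    refine ⟨ih h.1, fun a b => ?_⟩
    have := h.2 b.swap a.swap
    simp only [← sw] at this
    simp only [Prod.swap_prod_mk] at this
    simp only [Prod.fst_swap, Prod.snd_swap]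
    simp only [and_comm]
    simpa only [and_comm] using this

lemma wl_anti {i j : ℕ} (hij : i ≤ j) {p q : V × V} (h : wlRel G j p q) : wlRel G i p q := by
  induction j, hij using Nat.le_induction with
  | base => exact h
  | succ j _ ih => exact ih h.1

/-- The stable relation. -/
def st (p q : V × V) : Prop := ∀ i, wlRel G i p q

/-- The stable setoid. -/
def stSetoid : Setoid (V × V) where
  r := st G
  iseqv := ⟨fun p i => wl_refl G i p, fun h i => wl_symm G i (h i),
    fun h h' i => wl_trans G i (h i) (h' i)⟩

lemma st_level [Finite V] : ∃ n, ∀ p q : V × V, wlRel G n p q ↔ st G p q := by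
  classical
  have := Fintype.ofFinite V
  have h : ∀ t : (V × V) × (V × V), ∃ i, ¬ st G t.1 t.2 → ¬ wlRel G i t.1 t.2 := by
    intro t
    by_cases h : st G t.1 t.2
    · exact ⟨0, fun h' => absurd h h'⟩
    · have h2 := h
      unfold st at h2
      push Not at h2
      obtain ⟨i, hi⟩ := h2
      exact ⟨i, fun _ => hi⟩
  choose N hN using h
  refine ⟨univ.sup N, fun p q => ⟨fun h => ?_, fun h => h _⟩⟩
  by_contra hc
  exact hN (p, q) hc (wl_anti G (Finset.le_sup (mem_univ (p, q))) h)

/-- Matrices constant on the stable classes. -/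
def Alg (M : V → V → ℤ) : Prop :=
  ∀ p q : V × V, st G p q → M p.1 p.2 = M q.1 q.2

variable {G}

lemma Alg.mul {M N : V → V → ℤ} (hM : Alg G M) (hN : Alg G N) :
    Alg G (fun x y => M x y * N x y) := fun p q h => by
  simp only [hM p q h, hN p q h]

lemma Alg.one : Alg G (fun _ _ => 1) := fun _ _ _ => rfl

lemma Alg.swap {M : V → V → ℤ} (hM : Alg G M) : Alg G (fun x y => M y x) :=
  fun p q h => hM p.swap q.swap (fun i => wl_swap G i (h i))

lemma Alg.adj [DecidableRel G.Adj] : Alg G (fun x y => if G.Adj x y then 1 else 0) := by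
  intro p q h
  have := (h 0).2
  simp only [this]

lemma Alg.diag {M : V → V → ℤ} (hM : Alg G M)
    (hreg : ∀ x x' : V, ∀ i : ℕ, wlRel G i (x, x) (x', x')) (x x' : V) :
    M x x = M x' x' := hM (x, x) (x', x') (hreg x x')

lemma Alg.comp [Fintype V] {M N : V → V → ℤ} (hM : Alg G M) (hN : Alg G N) :
    Alg G (fun x y => ∑ z, M x z * N z y) := by
  classical
  intro p q h
  obtain ⟨n, hn⟩ := st_level G
  let Q := Quotient (stSetoid G)
  let _ : Fintype Q := Fintype.ofFinite Q
  let M' : Q → ℤ := Quotient.lift (fun p => M p.1 p.2) hM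
  let N' : Q → ℤ := Quotient.lift (fun p => N p.1 p.2) hN
  let c : V × V → Q := Quotient.mk (stSetoid G)
  have key : ∀ p : V × V, ∑ z, M p.1 z * N z p.2 =
      ∑ d : Q × Q, (Nat.card {z : V // c (p.1, z) = d.1 ∧ c (z, p.2) = d.2} : ℤ)
        * (M' d.1 * N' d.2) := by
    intro p
    rw [← Finset.sum_fiberwise univ (fun z => (c (p.1, z), c (z, p.2)))]
    refine Finset.sum_congr rfl fun d _ => ?_
    have : ∀ z ∈ univ.filter (fun z => (c (p.1, z), c (z, p.2)) = d),
        M p.1 z * N z p.2 = M' d.1 * N' d.2 := by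
      intro z hz
      rw [mem_filter] at hz
      rw [← hz.2]
      rfl
    rw [Finset.sum_congr rfl this, sum_const, nsmul_eq_mul, Nat.card_eq_fintype_card,
      Fintype.card_subtype]
    simp only [Prod.ext_iff]
  simp only
  rw [key p, key q]
  refine Finset.sum_congr rfl fun d _ => ?_
  congr 2
  obtain ⟨u, hu⟩ := Quotient.exists_rep d.1
  obtain ⟨v, hv⟩ := Quotient.exists_rep d.2
  have h1 := (h (n + 1)).2 u v
  have hc : ∀ a b : V × V, c a = Quotient.mk (stSetoid G) b ↔ wlRel G n a b := by
    intro a b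
    rw [hn]
    exact Quotient.eq (r := stSetoid G)
  rw [← hu, ← hv]
  simp only [hc]
  exact h1

end WL

/-! ### Patterns and elimination -/

section Pattern
variable {V : Type*} {G : SimpleGraph V} {ι : Type}

/-- The value of a pattern at an assignment. -/
def ev (l : List (ι × ι × (V → V → ℤ))) (f : ι → V) : ℤ :=
  (l.map fun e => e.2.2 (f e.1) (f e.2.1)).prod

lemma ev_cons (e : ι × ι × (V → V → ℤ)) (l) (f : ι → V) :
    ev (e :: l) f = e.2.2 (f e.1) (f e.2.1) * ev l f := by simp [ev]

lemma ev_split (hreg : ∀ x x' : V, ∀ i : ℕ, wlRel G i (x, x) (x', x'))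
    (k a b : ι) (l : List (ι × ι × (V → V → ℤ))) (hA : ∀ e ∈ l, Alg G e.2.2)
    (h1 : ∀ e ∈ l, e.1 = k → e.2.1 = k ∨ e.2.1 = a ∨ e.2.1 = b)
    (h2 : ∀ e ∈ l, e.2.1 = k → e.1 = k ∨ e.1 = a ∨ e.1 = b) :
    ∃ L R : V → V → ℤ, ∃ l' : List (ι × ι × (V → V → ℤ)), Alg G L ∧ Alg G R ∧
      (∀ e ∈ l', e ∈ l ∧ e.1 ≠ k ∧ e.2.1 ≠ k) ∧
      ∀ f : ι → V, ev l f = L (f a) (f k) * R (f k) (f b) * ev l' f := by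
  induction l with
  | nil => exact ⟨_, _, [], Alg.one, Alg.one, by simp, by simp [ev]⟩
  | cons e l ih =>
    obtain ⟨L, R, l', hL, hR, hl', hev⟩ := ih (fun e he => hA e (by simp [he]))
      (fun e he => h1 e (by simp [he])) (fun e he => h2 e (by simp [he]))
    have hM := hA e (by simp)
    have k1 := h1 e (by simp)
    have k2 := h2 e (by simp)
    obtain ⟨i, j, M⟩ := e
    simp only at hM k1 k2
    have hl'' : ∀ e ∈ l', e ∈ (i, j, M) :: l ∧ e.1 ≠ k ∧ e.2.1 ≠ k :=
      fun e he => ⟨by simp [(hl' e he).1], (hl' e he).2⟩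
    have loop : i = k → j = k → ∃ L R : V → V → ℤ, ∃ l' : List (ι × ι × (V → V → ℤ)),
      Alg G L ∧ Alg G R ∧
      (∀ e ∈ l', e ∈ (i, j, M) :: l ∧ e.1 ≠ k ∧ e.2.1 ≠ k) ∧
      ∀ f : ι → V, ev ((i, j, M) :: l) f = L (f a) (f k) * R (f k) (f b) * ev l' f := by
      rintro rfl rfl
      refine ⟨fun x y => M y y * L x y, R, l', Alg.mul (fun p q _ => hM.diag hreg _ _) hL, hR,
        hl'', fun f => ?_⟩
      rw [ev_cons, hev]; ring
    by_cases hi : i = k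
    · rcases k1 hi with hj | hj | hj
      · exact loop hi hj
      · subst hi; subst hj
        refine ⟨_, R, l', Alg.mul hM.swap hL, hR, hl'', fun f => ?_⟩
        rw [ev_cons, hev]; ring
      · subst hi; subst hj
        refine ⟨L, _, l', hL, Alg.mul hM hR, hl'', fun f => ?_⟩
        rw [ev_cons, hev]; ring
    · by_cases hj : j = k
      · rcases k2 hj with hi | hi | hi
        · exact loop hi hj
        · subst hi; subst hj
          refine ⟨_, R, l', Alg.mul hM hL, hR, hl'', fun f => ?_⟩
          rw [ev_cons, hev]; ring
        · subst hi; subst hj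
          refine ⟨L, _, l', hL, Alg.mul hM.swap hR, hl'', fun f => ?_⟩
          rw [ev_cons, hev]; ring
      · refine ⟨L, R, (i, j, M) :: l', hL, hR, ?_, fun f => ?_⟩
        · intro e he
          rcases List.mem_cons.1 he with rfl | he
          · exact ⟨by simp, hi, hj⟩
          · exact hl'' e he
        · rw [ev_cons, ev_cons, hev]; ring

lemma sum_update [Fintype V] [Fintype ι] [DecidableEq ι] (k : ι) (F : (ι → V) → ℤ) :
    ∑ f : ι → V, ∑ z : V, F (Function.update f k z) = Fintype.card V * ∑ f : ι → V, F f := by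
  have e : ∑ t : (ι → V) × V, F (Function.update t.1 k t.2) = ∑ t : (ι → V) × V, F t.1 := by
    refine Finset.sum_bij' (fun t _ => (Function.update t.1 k t.2, t.1 k))
      (fun t _ => (Function.update t.1 k t.2, t.1 k)) ?_ ?_ ?_ ?_ ?_ <;> simp
  rw [Fintype.sum_prod_type, Fintype.sum_prod_type] at e
  rw [e]
  simp [mul_sum]

lemma ev_congr (l : List (ι × ι × (V → V → ℤ))) (f g : ι → V)
    (h : ∀ e ∈ l, f e.1 = g e.1 ∧ f e.2.1 = g e.2.1) : ev l f = ev l g := by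
  unfold ev
  congr 1
  apply List.map_congr_left
  intro e he
  rw [(h e he).1, (h e he).2]

/-- The sum of a pattern over all assignments sending the root to `x`. -/
def S [Fintype V] [DecidableEq V] [Fintype ι] [DecidableEq ι] (r : ι)
    (l : List (ι × ι × (V → V → ℤ))) (x : V) : ℤ :=
  ∑ f : ι → V, if f r = x then ev l f else 0

variable [Fintype V] [DecidableEq V] [Fintype ι] [DecidableEq ι]

variable (G) in
/-- Every pattern supported on `E` has a rooted count that does not depend on the root image. -/
def Good (r : ι) (E : Finset (Sym2 ι)) : Prop :=
  ∀ l : List (ι × ι × (V → V → ℤ)), (∀ e ∈ l, Alg G e.2.2) →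
    (∀ e ∈ l, e.1 ≠ e.2.1 → s(e.1, e.2.1) ∈ E) → ∀ x y : V, S r l x = S r l y

/-- Edges at `k`. -/
def D (E : Finset (Sym2 ι)) (k : ι) : Finset (Sym2 ι) := E.filter (fun e => k ∈ e)

lemma elim (hreg : ∀ x x' : V, ∀ i : ℕ, wlRel G i (x, x) (x', x'))
    (r k a b : ι) (hk : k ≠ r) (ha : a ≠ k) (hb : b ≠ k) (E E' : Finset (Sym2 ι))
    (hD : ∀ j, j ≠ k → s(k, j) ∈ E → j = a ∨ j = b)
    (hE' : ∀ e ∈ E, k ∉ e → e ∈ E') (hab : a ≠ b → s(a, b) ∈ E')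
    (hg : Good G r E') : Good G r E := by
  intro l hA hl x x'
  obtain ⟨L, R, l', hL, hR, hl', hev⟩ := ev_split hreg k a b l hA
    (by
      intro e he h
      by_cases h' : e.2.1 = k
      · exact Or.inl h'
      · have := hl e he (by rw [h]; exact Ne.symm h')
        rw [h] at this
        exact Or.inr (hD _ h' this))
    (by
      intro e he h
      by_cases h' : e.1 = k
      · exact Or.inl h'
      · have := hl e he (by rw [h]; exact h')
        rw [h, Sym2.eq_swap] at this
        exact Or.inr (hD _ h' this))
  have key : ∀ x, (Fintype.card V : ℤ) * S r l x =
      S r ((a, b, fun u v => ∑ z, L u z * R z v) :: l') x := by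
    intro x
    unfold S
    rw [← sum_update k]
    refine Finset.sum_congr rfl fun f _ => ?_
    simp only [Function.update_of_ne hk.symm]
    split_ifs
    · rw [ev_cons]
      simp only
      rw [Finset.sum_mul]
      refine Finset.sum_congr rfl fun z _ => ?_
      rw [hev, Function.update_self, Function.update_of_ne ha, Function.update_of_ne hb]
      congr 1
      apply ev_congr
      intro e he
      rw [Function.update_of_ne (hl' e he).2.1, Function.update_of_ne (hl' e he).2.2]
      exact ⟨rfl, rfl⟩
    · simp
  have hne : (Fintype.card V : ℤ) ≠ 0 := by
    have : Nonempty V := ⟨x⟩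
    exact_mod_cast Fintype.card_ne_zero
  apply mul_left_cancel₀ hne
  rw [key, key]
  apply hg
  · intro e he
    rcases List.mem_cons.1 he with rfl | he
    · exact hL.comp hR
    · exact hA e (hl' e he).1
  · intro e he hne
    rcases List.mem_cons.1 he with rfl | he
    · exact hab hne
    · apply hE' _ (hl e (hl' e he).1 hne)
      rw [Sym2.mem_iff]
      push Not
      exact ⟨(hl' e he).2.1.symm, (hl' e he).2.2.symm⟩

lemma step (hreg : ∀ x x' : V, ∀ i : ℕ, wlRel G i (x, x) (x', x'))
    (r k : ι) (hk : k ≠ r) (E : Finset (Sym2 ι)) (hE : ∀ e ∈ E, ¬ e.IsDiag)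
    (h1 : 1 ≤ (D E k).card) (h2 : (D E k).card ≤ 2)
    (ih : ∀ E' : Finset (Sym2 ι), (∀ e ∈ E', ¬ e.IsDiag) → E'.card < E.card → Good G r E') :
    Good G r E := by
  have hcard : (D E k).card + (E.filter (fun e => ¬ k ∈ e)).card = E.card :=
    Finset.card_filter_add_card_filter_not _
  have hmem : ∀ e ∈ D E k, ∃ a, a ≠ k ∧ e = s(k, a) := by
    intro e he
    rw [D, mem_filter] at he
    obtain ⟨a, rfl⟩ := Sym2.mem_iff_exists.1 he.2
    refine ⟨a, ?_, rfl⟩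
    rintro rfl
    exact hE _ he.1 (by simp)
  have hinD : ∀ j, s(k, j) ∈ E → s(k, j) ∈ D E k := fun j h => by simp [D, h]
  obtain h | h : (D E k).card = 1 ∨ (D E k).card = 2 := by omega
  · obtain ⟨e, he⟩ := Finset.card_eq_one.1 h
    obtain ⟨a, ha, rfl⟩ := hmem e (by simp [he])
    refine elim hreg r k a a hk ha ha E (E.filter (fun e => ¬ k ∈ e)) ?_ ?_ (by simp) ?_
    · intro j hj hjE
      have := hinD j hjE
      rw [he, mem_singleton, Sym2.congr_right] at this
      exact Or.inl this
    · intro e he hk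
      simp [he, hk]
    · apply ih
      · intro e he
        exact hE e (mem_filter.1 he).1
      · omega
  · obtain ⟨e, e', hne, he⟩ := Finset.card_eq_two.1 h
    obtain ⟨a, ha, rfl⟩ := hmem e (by simp [he])
    obtain ⟨b, hb, rfl⟩ := hmem e' (by simp [he])
    have hab : a ≠ b := by rintro rfl; exact hne rfl
    refine elim hreg r k a b hk ha hb E (insert s(a, b) (E.filter (fun e => ¬ k ∈ e)))
      ?_ ?_ (by simp) ?_
    · intro j hj hjE
      have := hinD j hjE
      rw [he, mem_insert, mem_singleton, Sym2.congr_right, Sym2.congr_right] at this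
      exact this
    · intro e he hk
      simp [he, hk]
    · apply ih
      · intro e he
        rcases mem_insert.1 he with rfl | he
        · simpa using hab
        · exact hE e (mem_filter.1 he).1
      · have := Finset.card_insert_le s(a, b) (E.filter (fun e => ¬ k ∈ e))
        omega

lemma good_empty (hreg : ∀ x x' : V, ∀ i : ℕ, wlRel G i (x, x) (x', x')) (r : ι) :
    Good G r ∅ := by
  intro l hA hl x x'
  have hloop : ∀ e ∈ l, e.1 = e.2.1 := fun e he => by
    by_contra h
    simpa using hl e he h
  have hc : ∀ f g : ι → V, ev l f = ev l g := by
    intro f g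
    unfold ev
    congr 1
    apply List.map_congr_left
    intro e he
    rw [← hloop e he]
    exact (hA e he).diag hreg _ _
  unfold S
  refine Finset.sum_bij' (fun f _ => Equiv.swap x x' ∘ f) (fun f _ => Equiv.swap x x' ∘ f)
    ?_ ?_ ?_ ?_ ?_
  · simp
  · simp
  · intro f _; funext i; simp
  · intro f _; funext i; simp
  · intro f _
    have : (Equiv.swap x x' ∘ f) r = x' ↔ f r = x := by
      simp [Equiv.swap_apply_eq_iff]
    simp only [this]
    rw [hc f (Equiv.swap x x' ∘ f)]

lemma three (r k : ι) (E : Finset (Sym2 ι)) (hE : ∀ e ∈ E, ¬ e.IsDiag)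
    (h : 3 ≤ (D E k).card) : ∃ a b, a ≠ b ∧ a ≠ k ∧ b ≠ k ∧ a ≠ r ∧ b ≠ r ∧
      1 ≤ (D E a).card ∧ 1 ≤ (D E b).card := by
  have h1 : 1 < ((D E k).erase s(k, r)).card := by
    have := Finset.pred_card_le_card_erase (s := D E k) (a := s(k, r))
    omega
  obtain ⟨e, he, e', he', hne⟩ := Finset.one_lt_card.1 h1
  have aux : ∀ e ∈ (D E k).erase s(k, r), ∃ a, e = s(k, a) ∧ a ≠ k ∧ a ≠ r ∧
      1 ≤ (D E a).card := by
    intro e he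
    rw [mem_erase, D, mem_filter] at he
    obtain ⟨a, rfl⟩ := Sym2.mem_iff_exists.1 he.2.2
    refine ⟨a, rfl, ?_, ?_, ?_⟩
    · rintro rfl
      exact hE _ he.2.1 (by simp)
    · rintro rfl
      exact he.1 rfl
    · exact Finset.card_pos.2 ⟨s(k, a), by simp [D, he.2.1]⟩
  obtain ⟨a, rfl, h2, h3, h4⟩ := aux e he
  obtain ⟨b, rfl, h5, h6, h7⟩ := aux e' he'
  exact ⟨a, b, by rintro rfl; exact hne rfl, h2, h5, h3, h6, h4, h7⟩

lemma three_card (E : Finset (Sym2 ι)) (u v w : ι) (huv : u ≠ v) (huw : u ≠ w) (hvw : v ≠ w)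
    (hu : 3 ≤ (D E u).card) (hv : 3 ≤ (D E v).card) (hw : 3 ≤ (D E w).card) :
    6 ≤ E.card := by
  have aux : ∀ u v : ι, u ≠ v → D E u ∩ D E v ⊆ {s(u, v)} := by
    intro u v huv e he
    simp only [D, mem_inter, mem_filter] at he
    rw [mem_singleton]
    exact (Sym2.mem_and_mem_iff huv).1 ⟨he.1.2, he.2.2⟩
  have h1 := Finset.card_union_add_card_inter (D E u) (D E v)
  have h2 := Finset.card_union_add_card_inter (D E u ∪ D E v) (D E w)
  have h3 : (D E u ∩ D E v).card ≤ 1 := by simpa using card_le_card (aux u v huv)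
  have h4 : ((D E u ∪ D E v) ∩ D E w).card ≤ 2 := by
    rw [Finset.union_inter_distrib_right]
    refine (card_union_le _ _).trans ?_
    have a1 : (D E u ∩ D E w).card ≤ 1 := by simpa using card_le_card (aux u w huw)
    have a2 : (D E v ∩ D E w).card ≤ 1 := by simpa using card_le_card (aux v w hvw)
    omega
  have h5 : ((D E u ∪ D E v) ∪ D E w).card ≤ E.card := by
    apply card_le_card
    simp only [D]
    intro e he
    simp only [mem_union, mem_filter] at he
    tauto
  omega

lemma exists_nonroot (r : ι) (E : Finset (Sym2 ι)) (hE : ∀ e ∈ E, ¬ e.IsDiag)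
    (h : E.Nonempty) : ∃ k, k ≠ r ∧ 1 ≤ (D E k).card := by
  obtain ⟨e, he⟩ := h
  induction e using Sym2.ind with
  | _ a b =>
    have hab : a ≠ b := by simpa using hE _ he
    by_cases har : a = r
    · exact ⟨b, by rw [← har]; exact hab.symm, card_pos.2 ⟨s(a, b), by simp [D, he]⟩⟩
    · exact ⟨a, har, card_pos.2 ⟨s(a, b), by simp [D, he]⟩⟩

/-- Either some vertex can be eliminated, or there are three nonroot vertices of high degree. -/
lemma dichotomy (r : ι) (E : Finset (Sym2 ι)) (hE : ∀ e ∈ E, ¬ e.IsDiag)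
    (h : E.Nonempty) : (∃ k, k ≠ r ∧ 1 ≤ (D E k).card ∧ (D E k).card ≤ 2) ∨
    ∃ u v w, u ≠ v ∧ u ≠ w ∧ v ≠ w ∧ u ≠ r ∧ v ≠ r ∧ w ≠ r ∧ 3 ≤ (D E u).card ∧
      3 ≤ (D E v).card ∧ 3 ≤ (D E w).card := by
  by_cases hc : ∃ k, k ≠ r ∧ 1 ≤ (D E k).card ∧ (D E k).card ≤ 2
  · exact Or.inl hc
  right
  have hc' : ∀ k, k ≠ r → 1 ≤ (D E k).card → 3 ≤ (D E k).card := by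
    intro k h1 h2
    by_contra h3
    exact hc ⟨k, h1, h2, by omega⟩
  obtain ⟨k, hk, hk1⟩ := exists_nonroot r E hE h
  obtain ⟨a, b, hab, hak, hbk, har, hbr, ha, hb⟩ := three r k E hE (hc' k hk hk1)
  exact ⟨k, a, b, hak.symm, hbk.symm, hab, hk, har, hbr, hc' _ hk hk1, hc' _ har ha, hc' _ hbr hb⟩

lemma good_five (hreg : ∀ x x' : V, ∀ i : ℕ, wlRel G i (x, x) (x', x')) (r : ι) (n : ℕ) :
    ∀ E : Finset (Sym2 ι), (∀ e ∈ E, ¬ e.IsDiag) → E.card = n → n ≤ 5 → Good G r E := by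
  induction n using Nat.strong_induction_on with
  | _ n ih =>
    intro E hE hn h5
    rcases E.eq_empty_or_nonempty with rfl | hne
    · exact good_empty hreg r
    rcases dichotomy r E hE hne with ⟨k, hk, h1, h2⟩ | ⟨u, v, w, a, b, c, _, _, _, d, e, f⟩
    · refine step hreg r k hk E hE h1 h2 fun E' hE' hlt => ?_
      exact ih E'.card (by omega) E' hE' rfl (by omega)
    · have := three_card E u v w a b c d e f
      omega

/-- Edges of the walk `q 0, ..., q n`. -/
def wE (q : ℕ → ι) (n : ℕ) : Finset (Sym2 ι) :=
  ((range n).image fun i => s(q i, q (i + 1))).filter fun e => ¬ e.IsDiag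

lemma wE_slots (q : ℕ → ι) (v : ι) (hv : v ≠ q 0) (h : 3 ≤ (D (wE q 6) v).card) :
    2 ≤ ((Icc 1 6).filter fun i => q i = v).card := by
  have hsub : D (wE q 6) v ⊆ ((Icc 1 6).filter fun i => q i = v).biUnion
      fun i => {s(q (i - 1), q i), s(q i, q (i + 1))} := by
    intro e he
    simp only [D, wE, mem_filter, mem_image, mem_range] at he
    obtain ⟨⟨⟨i, hi, rfl⟩, _⟩, hm⟩ := he
    rw [mem_biUnion]
    rcases Sym2.mem_iff.1 hm with h | h
    · have h0 : i ≠ 0 := by rintro rfl; exact hv h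
      exact ⟨i, by simp only [mem_filter, mem_Icc]; exact ⟨by omega, h.symm⟩, by simp⟩
    · exact ⟨i + 1, by simp only [mem_filter, mem_Icc]; exact ⟨by omega, h.symm⟩, by simp⟩
  have h1 := card_le_card hsub
  have h2 := Finset.card_biUnion_le_card_mul ((Icc 1 6).filter fun i => q i = v)
    (fun i => ({s(q (i - 1), q i), s(q i, q (i + 1))} : Finset (Sym2 ι))) 2
    (fun i _ => Finset.card_le_two)
  omega

lemma wE_six (q : ℕ → ι) (u v w : ι) (huv : u ≠ v) (huw : u ≠ w) (hvw : v ≠ w)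
    (hu0 : u ≠ q 0) (hv0 : v ≠ q 0) (hw0 : w ≠ q 0)
    (hu : 3 ≤ (D (wE q 6) u).card) (hv : 3 ≤ (D (wE q 6) v).card)
    (hw : 3 ≤ (D (wE q 6) w).card) : False := by
  have su := wE_slots q u hu0 hu
  have sv := wE_slots q v hv0 hv
  have sw := wE_slots q w hw0 hw
  have d1 : Disjoint ((Icc 1 6).filter fun i => q i = u) ((Icc 1 6).filter fun i => q i = v) := by
    rw [Finset.disjoint_filter]
    rintro i _ rfl h
    exact huv h
  have d2 : Disjoint (((Icc 1 6).filter fun i => q i = u) ∪ ((Icc 1 6).filter fun i => q i = v))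
      ((Icc 1 6).filter fun i => q i = w) := by
    rw [Finset.disjoint_union_left, Finset.disjoint_filter, Finset.disjoint_filter]
    constructor
    · rintro i _ rfl h
      exact huw h
    · rintro i _ rfl h
      exact hvw h
  have hall : (((Icc 1 6).filter fun i => q i = u) ∪ ((Icc 1 6).filter fun i => q i = v)) ∪
      ((Icc 1 6).filter fun i => q i = w) = Icc 1 6 := by
    apply Finset.eq_of_subset_of_card_le
    · exact union_subset (union_subset (filter_subset _ _) (filter_subset _ _))
        (filter_subset _ _)
    · rw [card_union_of_disjoint d2, card_union_of_disjoint d1]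
      simp only [Nat.card_Icc]
      omega
  have hq : ∀ i, 1 ≤ i → i ≤ 6 → q i = u ∨ q i = v ∨ q i = w := by
    intro i h1 h2
    have h3 := hall.ge (mem_Icc.2 ⟨h1, h2⟩)
    rcases mem_union.1 h3 with h4 | h4
    · rcases mem_union.1 h4 with h5 | h5
      · exact Or.inl (mem_filter.1 h5).2
      · exact Or.inr (Or.inl (mem_filter.1 h5).2)
    · exact Or.inr (Or.inr (mem_filter.1 h4).2)
  -- a vertex other than `q 1` has at most two neighbours
  have aux : ∀ a b c : ι, a ≠ q 0 → a ≠ q 1 →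
      (∀ i, 1 ≤ i → i ≤ 6 → q i = a ∨ q i = b ∨ q i = c) → (D (wE q 6) a).card ≤ 2 := by
    intro a b c h0 h1 hh
    refine (card_le_card (t := {s(a, b), s(a, c)}) ?_).trans Finset.card_le_two
    intro e he
    simp only [D, wE, mem_filter, mem_image, mem_range] at he
    obtain ⟨⟨⟨i, hi, rfl⟩, hd⟩, hm⟩ := he
    have hd' : q i ≠ q (i + 1) := by simpa using hd
    have hi0 : i ≠ 0 := by
      rintro rfl
      rcases Sym2.mem_iff.1 hm with h | h
      · exact h0 h
      · exact h1 h
    rw [mem_insert, mem_singleton]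
    rcases Sym2.mem_iff.1 hm with h | h
    · rcases hh (i + 1) (by omega) (by omega) with h' | h' | h'
      · exact absurd (h.symm.trans h'.symm) hd'
      · left; rw [h, h']
      · right; rw [h, h']
    · rcases hh i (by omega) (by omega) with h' | h' | h'
      · exact absurd (h'.trans h) hd'
      · left; rw [h, h', Sym2.eq_swap]
      · right; rw [h, h', Sym2.eq_swap]
  by_cases h1 : u = q 1
  · have := aux v u w hv0 (fun h => huv (h1.trans h.symm))
      (fun i a b => or_left_comm.1 (hq i a b))
    omega
  · have := aux u v w hu0 h1 hq
    omega

lemma wE_card (q : ℕ → ι) (n : ℕ) : (wE q n).card ≤ n := by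
  refine (card_filter_le _ _).trans (card_image_le.trans ?_)
  simp

lemma wE_good (hreg : ∀ x x' : V, ∀ i : ℕ, wlRel G i (x, x) (x', x')) (q : ℕ → ι) (n : ℕ)
    (hn : n ≤ 6) : Good G (q 0) (wE q n) := by
  have hd : ∀ e ∈ wE q n, ¬ e.IsDiag := fun e he => (mem_filter.1 he).2
  have hc := wE_card q n
  by_cases h5 : (wE q n).card ≤ 5
  · exact good_five hreg (q 0) _ _ hd rfl h5
  obtain rfl : n = 6 := by omega
  rcases dichotomy (q 0) (wE q 6) hd (card_pos.1 (by omega)) with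
    ⟨k, hk, h1, h2⟩ | ⟨u, v, w, a, b, c, a', b', c', d, e, f⟩
  · refine step hreg _ k hk _ hd h1 h2 fun E' hE' hlt => ?_
    exact good_five hreg _ _ E' hE' rfl (by omega)
  · exact (wE_six q u v w a b c a' b' c' d e f).elim

end Pattern

/-! ### Inclusion-exclusion -/

section Count
variable {V : Type*} [Fintype V] [DecidableEq V] {G : SimpleGraph V}

/-- The walk indicator. -/
def wInd (G : SimpleGraph V) [DecidableRel G.Adj] (n : ℕ) (f : Fin (n + 1) → V) : ℤ :=
  ∏ i ∈ range n, if G.Adj (f (Fin.ofNat (n + 1) i)) (f (Fin.ofNat (n + 1) (i + 1))) then 1 else 0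

lemma quot_count [DecidableRel G.Adj]
    (hreg : ∀ x x' : V, ∀ i : ℕ, wlRel G i (x, x) (x', x')) (n : ℕ) (hn : n ≤ 6)
    (t : Finset (Fin (n + 1) × Fin (n + 1))) (x x' : V) :
    (∑ f : Fin (n + 1) → V, if f 0 = x then
      wInd G n f * (if ∀ p ∈ t, f p.1 = f p.2 then 1 else 0) else 0) =
    ∑ f : Fin (n + 1) → V, if f 0 = x' then
      wInd G n f * (if ∀ p ∈ t, f p.1 = f p.2 then 1 else 0) else 0 := by
  classical
  let ρ : Fin (n + 1) → Fin (n + 1) → Prop := fun i j => (i, j) ∈ t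
  let ι := Quot ρ
  let _ : Fintype ι := Fintype.ofFinite ι
  let q : ℕ → ι := fun i => Quot.mk ρ (Fin.ofNat (n + 1) i)
  let l : List (ι × ι × (V → V → ℤ)) := (List.range n).map fun i =>
    (q i, q (i + 1), fun x y => if G.Adj x y then 1 else 0)
  have key : ∀ x, (∑ f : Fin (n + 1) → V, if f 0 = x then
      wInd G n f * (if ∀ p ∈ t, f p.1 = f p.2 then 1 else 0) else 0) = S (q 0) l x := by
    intro x
    unfold S
    symm
    refine Finset.sum_of_injOn (fun g => g ∘ Quot.mk ρ) ?_ ?_ ?_ ?_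
    · intro g _ g' _ h
      funext c
      induction c using Quot.ind with
      | _ i => exact congrFun h i
    · intro g _; simp
    · intro f _ hf
      have : ¬ ∀ p ∈ t, f p.1 = f p.2 := by
        intro h
        apply hf
        exact ⟨Quot.lift f (fun i j hij => h (i, j) hij), by simp, rfl⟩
      rw [if_neg this, mul_zero, ite_self]
    · intro g _
      have h1 : ∀ p ∈ t, (g ∘ Quot.mk ρ) p.1 = (g ∘ Quot.mk ρ) p.2 := by
        intro p hp
        exact congrArg g (Quot.sound hp)
      have h2 : ev l g = wInd G n (g ∘ Quot.mk ρ) := by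
        simp only [ev, wInd, l, q, List.map_map]
        rfl
      rw [if_pos h1, mul_one, h2]
      rfl
  rw [key, key]
  apply wE_good hreg q n hn l
  · intro e he
    simp only [l, List.mem_map] at he
    obtain ⟨i, _, rfl⟩ := he
    exact Alg.adj
  · intro e he hne
    simp only [l, List.mem_map, List.mem_range] at he
    obtain ⟨i, hi, rfl⟩ := he
    simp only [wE, mem_filter, mem_image, mem_range]
    exact ⟨⟨i, hi, rfl⟩, by simpa using hne⟩

lemma inj_expand (n : ℕ) (f : Fin (n + 1) → V) :
    (if Function.Injective f then (1 : ℤ) else 0) =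
    ∑ t ∈ ((univ : Finset (Fin (n + 1) × Fin (n + 1))).filter fun p => p.1 ≠ p.2).powerset,
      (-1) ^ t.card * (if ∀ p ∈ t, f p.1 = f p.2 then 1 else 0) := by
  have h1 : (if Function.Injective f then (1 : ℤ) else 0) =
      ∏ p ∈ (univ : Finset (Fin (n + 1) × Fin (n + 1))).filter fun p => p.1 ≠ p.2,
        (-(if f p.1 = f p.2 then (1 : ℤ) else 0) + 1) := by
    split_ifs with h
    · symm
      apply Finset.prod_eq_one
      intro p hp
      have : f p.1 ≠ f p.2 := fun h' => (mem_filter.1 hp).2 (h h')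
      simp [this]
    · symm
      unfold Function.Injective at h
      push Not at h
      obtain ⟨a, b, hab, hne⟩ := h
      exact Finset.prod_eq_zero (i := (a, b)) (by simp [hne]) (by simp [hab])
  rw [h1, Finset.prod_add]
  refine Finset.sum_congr rfl fun t _ => ?_
  rw [Finset.prod_neg, Finset.prod_const_one, mul_one, Finset.prod_boole]
  congr

lemma inj_count [DecidableRel G.Adj]
    (hreg : ∀ x x' : V, ∀ i : ℕ, wlRel G i (x, x) (x', x')) (n : ℕ) (hn : n ≤ 6) (x x' : V) :
    (∑ f : Fin (n + 1) → V, if f 0 = x then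
      wInd G n f * (if Function.Injective f then 1 else 0) else 0) =
    ∑ f : Fin (n + 1) → V, if f 0 = x' then
      wInd G n f * (if Function.Injective f then 1 else 0) else 0 := by
  have key : ∀ x, (∑ f : Fin (n + 1) → V, if f 0 = x then
      wInd G n f * (if Function.Injective f then 1 else 0) else 0) =
      ∑ t ∈ ((univ : Finset (Fin (n + 1) × Fin (n + 1))).filter fun p => p.1 ≠ p.2).powerset,
      (-1) ^ t.card * ∑ f : Fin (n + 1) → V, if f 0 = x then
      wInd G n f * (if ∀ p ∈ t, f p.1 = f p.2 then 1 else 0) else 0 := by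
    intro x
    simp_rw [Finset.mul_sum]
    rw [Finset.sum_comm]
    refine Finset.sum_congr rfl fun f _ => ?_
    by_cases h : f 0 = x
    · simp only [if_pos h]
      rw [inj_expand, Finset.mul_sum]
      refine Finset.sum_congr rfl fun t _ => ?_
      ring
    · simp only [if_neg h, mul_zero, Finset.sum_const_zero]
  rw [key, key]
  refine Finset.sum_congr rfl fun t _ => ?_
  rw [quot_count hreg n hn t x x']

lemma walk_of_fun (G : SimpleGraph V) (n : ℕ) : ∀ (f : ℕ → V),
    (∀ i < n, G.Adj (f i) (f (i + 1))) →
    ∃ p : G.Walk (f 0) (f n), p.length = n ∧ ∀ i ≤ n, p.getVert i = f i := by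
  induction n with
  | zero => exact fun f _ => ⟨.nil, rfl, fun i hi => by simp [Nat.le_zero.1 hi]⟩
  | succ n ih =>
    intro f hf
    obtain ⟨p, hp, hv⟩ := ih (fun i => f (i + 1)) (fun i hi => hf (i + 1) (by omega))
    refine ⟨.cons (hf 0 (by omega)) p, by simp [hp], fun i hi => ?_⟩
    cases i with
    | zero => simp
    | succ i => simpa using hv i (by omega)

lemma path_card [DecidableRel G.Adj] (n : ℕ) (x : V) :
    ((Nat.card (Σ y : V, {p : G.Walk x y // p.IsPath ∧ p.length = n}) : ℕ) : ℤ) =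
    ∑ f : Fin (n + 1) → V, if f 0 = x then
      wInd G n f * (if Function.Injective f then 1 else 0) else 0 := by
  have h1 : ∀ f : Fin (n + 1) → V, (if f 0 = x then
      wInd G n f * (if Function.Injective f then 1 else 0) else 0) =
      if (f 0 = x ∧ (∀ i < n, G.Adj (f (Fin.ofNat (n + 1) i)) (f (Fin.ofNat (n + 1) (i + 1))))
        ∧ Function.Injective f) then (1 : ℤ) else 0 := by
    intro f
    unfold wInd
    rw [Finset.prod_boole]
    simp only [mem_range]
    by_cases a : f 0 = x <;> by_cases c : Function.Injective f <;> simp [a, c]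
  simp_rw [h1]
  rw [Finset.sum_boole, ← Fintype.card_subtype, ← Nat.card_eq_fintype_card]
  congr 1
  have hofNat : ∀ i, i ≤ n → ((Fin.ofNat (n + 1) i : Fin (n + 1)) : ℕ) = i := by
    intro i hi
    simp [Fin.ofNat, Nat.mod_eq_of_lt (Nat.lt_succ_of_le hi)]
  refine Nat.card_congr (Equiv.ofBijective (fun w => ⟨fun i => w.2.1.getVert i, ?_, ?_, ?_⟩)
    ⟨?_, ?_⟩)
  · simp
  · obtain ⟨y, p, hp, hl⟩ := w
    intro i hi
    simp only
    rw [hofNat i hi.le, hofNat (i + 1) hi]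
    exact p.adj_getVert_succ (by omega)
  · obtain ⟨y, p, hp, hl⟩ := w
    intro i j hij
    exact Fin.ext (hp.getVert_injOn (by simp; omega) (by simp; omega) hij)
  · rintro ⟨y, p, hp, hl⟩ ⟨y', p', hp', hl'⟩ h
    simp only [Subtype.mk.injEq] at h
    have hv : ∀ i, i ≤ n → p.getVert i = p'.getVert i := by
      intro i hi
      have := congrFun h ⟨i, by omega⟩
      simpa using this
    have hy : y = y' := by
      have := hv n le_rfl
      rw [← hl, p.getVert_length, hl, ← hl', p'.getVert_length] at this
      exact this
    subst hy
    have : p = p' := SimpleGraph.Walk.ext_getVert_le_length (hl.trans hl'.symm)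
      (fun i hi => hv i (by omega))
    subst this
    rfl
  · rintro ⟨f, rfl, ha, hi⟩
    obtain ⟨p, hp, hv⟩ := walk_of_fun G n (fun i => f (Fin.ofNat (n + 1) i)) ha
    refine ⟨⟨_, p, ?_, hp⟩, ?_⟩
    · rw [← SimpleGraph.Walk.IsPath.getVert_injOn_iff]
      intro i h1 j h2 hij
      have h1' : i ≤ n := hp ▸ h1
      have h2' : j ≤ n := hp ▸ h2
      rw [hv i h1', hv j h2'] at hij
      have := congrArg Fin.val (hi hij)
      rwa [hofNat i h1', hofNat j h2'] at this
    · apply Subtype.ext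
      funext i
      simp only
      rw [hv i (by omega)]
      congr 1
      exact Fin.ext (hofNat i (by omega))

end Count

end HalfReg

/-- In a `1/2`-regular finite graph `G`, for every `2 ≤ s ≤ 7`
the number of paths on `s` vertices emanating from a vertex `x` is the same for
every vertex `x`. -/
theorem half_regular_path_count_invariant {V : Type*} [Fintype V]
    (G : SimpleGraph V)
    (hreg : ∀ x x' : V, ∀ i : ℕ, wlRel G i (x, x) (x', x')) :
    ∀ s : ℕ, 2 ≤ s → s ≤ 7 → ∀ x x' : V,
      Nat.card (Σ y : V, {p : G.Walk x y // p.IsPath ∧ p.length = s - 1}) =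
      Nat.card (Σ y : V, {p : G.Walk x' y // p.IsPath ∧ p.length = s - 1}) := by
  intro s _ hs x x'
  classical
  have h1 := HalfReg.path_card (G := G) (s - 1) x
  have h2 := HalfReg.path_card (G := G) (s - 1) x'
  have h3 := HalfReg.inj_count hreg (s - 1) (by omega) x x'
  exact_mod_cast h1.trans (h3.trans h2.symm)
end

section
/- Let G be a finite simple graph that is 1/2-regular. Then for every s with 3 ≤ s ≤ 7, the number of s-cycles through a vertex x is the same for every vertex x of G. -/
/-- Other endpoints of the edges at `v`, without repetition. -/
def hrNbrs {m : ℕ} (E : List (Fin m × Fin m)) (v : Fin m) : List (Fin m) :=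
  E.foldr (fun e acc =>
    let acc' := if e.1 = v ∧ e.2 ≠ v ∧ e.2 ∉ acc then e.2 :: acc else acc
    if e.2 = v ∧ e.1 ≠ v ∧ e.1 ∉ acc' then e.1 :: acc' else acc') []

/-- Search for a vertex (not the root) of degree one or two. -/
def hrFind {m : ℕ} (r : Fin m) (E : List (Fin m × Fin m)) :
    List (Fin m) → Option (Fin m × Fin m × Fin m)
  | [] => none
  | v :: vs => if v = r then hrFind r E vs else
    match hrNbrs E v with
    | [u] => some (v, u, u)
    | [u, w] => some (v, u, w)
    | _ => hrFind r E vs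

/-- Does the edge meet `v`? -/
def hrInc {m : ℕ} (v : Fin m) (e : Fin m × Fin m) : Bool := decide (e.1 = v) || decide (e.2 = v)

/-- Are both ends of the edge among `u, v, w`? -/
def hrIn3 {m : ℕ} (u v w : Fin m) (e : Fin m × Fin m) : Bool :=
  (decide (e.1 = u) || decide (e.1 = v) || decide (e.1 = w)) &&
  (decide (e.2 = u) || decide (e.2 = v) || decide (e.2 = w))

/-- Series-parallel elimination test. -/
def hrCheck {m : ℕ} (r : Fin m) : ℕ → List (Fin m × Fin m) → Bool
  | 0, E => E.all fun e => decide (e.1 = e.2)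
  | k + 1, E => (E.all fun e => decide (e.1 = e.2)) ||
    match hrFind r E (List.finRange m) with
    | none => false
    | some (v, u, w) =>
      decide (v ≠ r) && decide (u ≠ v) && decide (w ≠ v) &&
      (E.all fun e => !hrInc v e || hrIn3 u v w e) &&
      hrCheck r k ((u, w) :: E.filter fun e => !hrInc v e)

/-- Replace `v` by `u`. -/
def hrSub {m : ℕ} (u v : Fin m) (a : Fin m) : Fin m := if a = v then u else a

/-- Replace `v` by `u` in an edge. -/
def hrSubE {m : ℕ} (u v : Fin m) (e : Fin m × Fin m) : Fin m × Fin m :=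
  (hrSub u v e.1, hrSub u v e.2)

/-- Branch over the disequalities. -/
def hrBranch {m : ℕ} (r : Fin m) : ℕ → List (Fin m × Fin m) → List (Fin m × Fin m) → Bool
  | _, E, [] => hrCheck r m E
  | 0, _, _ :: _ => false
  | k + 1, E, (u, v) :: D =>
    decide (u = v) ||
    (hrBranch r k E D &&
      (decide ((u, v) ∈ E) || decide ((v, u) ∈ E) || decide ((u, v) ∈ D) || decide ((v, u) ∈ D) ||
        (if v = r then
          (E.any fun e => decide ((hrSubE v u e).1 = (hrSubE v u e).2)) ||
          (decide (u ≠ r) && hrBranch r k (E.map (hrSubE v u)) (D.map (hrSubE v u)))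
        else
          (E.any fun e => decide ((hrSubE u v e).1 = (hrSubE u v e).2)) ||
          hrBranch r k (E.map (hrSubE u v)) (D.map (hrSubE u v)))))

/-- Edges of the cycle. -/
def hrCyc (m : ℕ) : List (Fin (m + 1) × Fin (m + 1)) :=
  (List.finRange (m + 1)).map fun i => (i, i + 1)

/-- All pairs. -/
def hrPairs (m : ℕ) : List (Fin (m + 1) × Fin (m + 1)) :=
  ((List.finRange (m + 1)).flatMap fun i => (List.finRange (m + 1)).map fun j => (i, j)).filter
    fun p => decide (p.1 < p.2)


section WL
variable {V : Type*} {G : SimpleGraph V}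

theorem wlRel_refl (i : ℕ) (p : V × V) : wlRel G i p p := by
  induction i with
  | zero => exact ⟨Iff.rfl, Iff.rfl⟩
  | succ i ih => exact ⟨ih, fun _ _ => rfl⟩

theorem wlRel_symm (i : ℕ) {p q : V × V} (h : wlRel G i p q) : wlRel G i q p := by
  induction i with
  | zero => exact ⟨h.1.symm, h.2.symm⟩
  | succ i ih => exact ⟨ih h.1, fun a b => (h.2 a b).symm⟩

theorem wlRel_trans (i : ℕ) {p q r : V × V} (h : wlRel G i p q) (h' : wlRel G i q r) :
    wlRel G i p r := by
  induction i with
  | zero => exact ⟨h.1.trans h'.1, h.2.trans h'.2⟩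
  | succ i ih => exact ⟨ih h.1 h'.1, fun a b => (h.2 a b).trans (h'.2 a b)⟩

theorem wlRel_mono {i j : ℕ} (hij : i ≤ j) {p q : V × V} (h : wlRel G j p q) : wlRel G i p q := by
  induction hij with
  | refl => exact h
  | step _ ih => exact ih h.1

theorem wlRel_swap (i : ℕ) {p q : V × V} (h : wlRel G i p q) : wlRel G i p.swap q.swap := by
  induction i generalizing p q with
  | zero =>
    refine ⟨?_, ?_⟩
    · have := h.1
      simp only [Prod.fst_swap, Prod.snd_swap]
      rw [eq_comm, this, eq_comm]
    · have := h.2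
      simp only [Prod.fst_swap, Prod.snd_swap]
      rw [G.adj_comm, this, G.adj_comm]
  | succ i ih =>
    refine ⟨ih h.1, fun a b => ?_⟩
    have key : ∀ (s t c : V × V), wlRel G i s c ↔ wlRel G i s.swap c.swap := by
      intro s t c
      exact ⟨fun h => ih h, fun h => by simpa using ih h⟩
    have h2 := h.2 b.swap a.swap
    have e : ∀ p : V × V, (fun z : V => wlRel G i (p.swap.1, z) a ∧ wlRel G i (z, p.swap.2) b) =
        fun z => wlRel G i (p.1, z) b.swap ∧ wlRel G i (z, p.2) a.swap := by
      intro p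
      funext z
      rw [key (p.swap.1, z) p a, key (z, p.swap.2) p b]
      exact propext and_comm
    have e1 := congrArg (fun P : V → Prop => Nat.card {z // P z}) (e p)
    have e2 := congrArg (fun P : V → Prop => Nat.card {z // P z}) (e q)
    exact (e1.trans h2).trans e2.symm

/-- A matrix constant on the classes of some `R_i`. -/
def HRInv (G : SimpleGraph V) (f : V → V → ℚ) : Prop :=
  ∃ i, ∀ p q : V × V, wlRel G i p q → f p.1 p.2 = f q.1 q.2

theorem HRInv.const (c : ℚ) : HRInv G (fun _ _ => c) := ⟨0, fun _ _ _ => rfl⟩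

theorem HRInv.mul {f g : V → V → ℚ} (hf : HRInv G f) (hg : HRInv G g) :
    HRInv G (fun x y => f x y * g x y) := by
  obtain ⟨i, hi⟩ := hf
  obtain ⟨j, hj⟩ := hg
  refine ⟨max i j, fun p q h => ?_⟩
  simp only
  rw [hi p q (wlRel_mono (le_max_left _ _) h), hj p q (wlRel_mono (le_max_right _ _) h)]

theorem HRInv.swap {f : V → V → ℚ} (hf : HRInv G f) : HRInv G (fun x y => f y x) := by
  obtain ⟨i, hi⟩ := hf
  exact ⟨i, fun p q h => hi p.swap q.swap (wlRel_swap i h)⟩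

theorem HRInv.comp [Fintype V] {f g : V → V → ℚ} (hf : HRInv G f) (hg : HRInv G g) :
    HRInv G (fun x y => ∑ z, f x z * g z y) := by
  classical
  obtain ⟨i, hi⟩ := hf
  obtain ⟨j, hj⟩ := hg
  set k := max i j
  have hi' : ∀ p q : V × V, wlRel G k p q → f p.1 p.2 = f q.1 q.2 :=
    fun p q h => hi p q (wlRel_mono (le_max_left _ _) h)
  have hj' : ∀ p q : V × V, wlRel G k p q → g p.1 p.2 = g q.1 q.2 :=
    fun p q h => hj p q (wlRel_mono (le_max_right _ _) h)
  let S : Setoid (V × V) := ⟨wlRel G k, ⟨wlRel_refl k, wlRel_symm k, wlRel_trans k⟩⟩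
  refine ⟨k + 1, fun p q h => ?_⟩
  let φ : V × V → V → Quotient S × Quotient S :=
    fun p z => (Quotient.mk S (p.1, z), Quotient.mk S (z, p.2))
  have main : ∀ p : V × V, ∑ z, f p.1 z * g z p.2 =
      ∑ c : Quotient S × Quotient S,
        (Nat.card {z : V // wlRel G k (p.1, z) c.1.out ∧ wlRel G k (z, p.2) c.2.out} : ℚ) *
          (f c.1.out.1 c.1.out.2 * g c.2.out.1 c.2.out.2) := by
    intro p
    rw [← Finset.sum_fiberwise Finset.univ (φ p)]
    refine Finset.sum_congr rfl fun c _ => ?_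
    have hiff : ∀ z, φ p z = c ↔
        (wlRel G k (p.1, z) c.1.out ∧ wlRel G k (z, p.2) c.2.out) := by
      intro z
      rw [Prod.ext_iff]
      refine and_congr ?_ ?_
      · constructor
        · intro h
          have : Quotient.mk S (p.1, z) = Quotient.mk S c.1.out := by rw [Quotient.out_eq]; exact h
          exact Quotient.exact this
        · intro h
          have : Quotient.mk S (p.1, z) = Quotient.mk S c.1.out := Quotient.sound h
          rw [Quotient.out_eq] at this
          exact this
      · constructor
        · intro h
          have : Quotient.mk S (z, p.2) = Quotient.mk S c.2.out := by rw [Quotient.out_eq]; exact h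
          exact Quotient.exact this
        · intro h
          have : Quotient.mk S (z, p.2) = Quotient.mk S c.2.out := Quotient.sound h
          rw [Quotient.out_eq] at this
          exact this
    have hc : (Nat.card {z : V // wlRel G k (p.1, z) c.1.out ∧ wlRel G k (z, p.2) c.2.out}) =
        (Finset.univ.filter fun z => φ p z = c).card := by
      rw [Nat.card_eq_fintype_card, Fintype.card_subtype]
      congr 1
      ext z
      simp [hiff z]
    rw [hc, ← nsmul_eq_mul]
    apply Finset.sum_eq_card_nsmul
    intro z hz
    have hz' := (hiff z).1 (Finset.mem_filter.1 hz).2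
    rw [← hi' _ _ hz'.1, ← hj' _ _ hz'.2]
  simp only
  rw [main p, main q]
  refine Finset.sum_congr rfl fun c _ => ?_
  rw [h.2 c.1.out c.2.out]

open Classical in
theorem HRInv.adj : HRInv G (fun x y => if G.Adj x y then 1 else 0) := by
  refine ⟨0, fun p q h => ?_⟩
  simp only [h.2]

theorem HRInv.diag (hreg : ∀ x x' : V, ∀ i : ℕ, wlRel G i (x, x) (x', x'))
    {f : V → V → ℚ} (hf : HRInv G f) : ∃ c, ∀ x, f x x = c := by
  obtain ⟨i, hi⟩ := hf
  rcases isEmpty_or_nonempty V with h | ⟨⟨x0⟩⟩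
  · exact ⟨0, fun x => (h.false x).elim⟩
  · exact ⟨f x0 x0, fun x => hi (x, x) (x0, x0) (hreg _ _ i)⟩

end WL

section Net
variable {V : Type*} [Fintype V] {m : ℕ}

theorem hr_avg (v : Fin m) (g : (Fin m → V) → ℚ) [Nonempty V] :
    ∑ σ, g σ = ∑ σ : Fin m → V, (1 / (Fintype.card V : ℚ)) * ∑ a, g (Function.update σ v a) := by
  classical
  rw [← Finset.mul_sum]
  have hinv : Function.Involutive
      (fun p : (Fin m → V) × V => (Function.update p.1 v p.2, p.1 v)) := by
    intro p
    simp
  have h1 : ∑ σ : Fin m → V, ∑ a, g (Function.update σ v a) =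
      ∑ p : (Fin m → V) × V, g (Function.update p.1 v p.2) :=
    (Fintype.sum_prod_type (fun p : (Fin m → V) × V => g (Function.update p.1 v p.2))).symm
  have h2 : ∑ p : (Fin m → V) × V, g (Function.update p.1 v p.2) =
      ∑ p : (Fin m → V) × V, g p.1 :=
    Fintype.sum_equiv hinv.toPerm _ _ (fun p => rfl)
  have h3 : ∑ p : (Fin m → V) × V, g p.1 = (Fintype.card V : ℚ) * ∑ σ, g σ := by
    rw [Fintype.sum_prod_type]
    simp [Finset.mul_sum]
  rw [h1, h2, h3, ← mul_assoc]
  have : (Fintype.card V : ℚ) ≠ 0 := by exact_mod_cast Fintype.card_ne_zero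
  field_simp

open Classical in
/-- Rooted sum. -/
noncomputable def hrSum (r : Fin m) (g : (Fin m → V) → ℚ) (x : V) : ℚ :=
  ∑ σ : Fin m → V, (if σ r = x then 1 else 0) * g σ

theorem hrSum_avg {r v : Fin m} (hv : v ≠ r) (g : (Fin m → V) → ℚ) (x : V) :
    hrSum r g x = hrSum r (fun σ => (1 / (Fintype.card V : ℚ)) *
      ∑ a, g (Function.update σ v a)) x := by
  classical
  have : Nonempty V := ⟨x⟩
  unfold hrSum
  rw [hr_avg v]
  refine Finset.sum_congr rfl fun σ _ => ?_
  simp only [Function.update_of_ne hv.symm]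
  rw [← Finset.mul_sum]
  ring

theorem hrSum_const (r : Fin m) (c : ℚ) (x x' : V) :
    hrSum r (fun _ => c) x = hrSum r (fun _ => c) x' := by
  classical
  unfold hrSum
  refine Fintype.sum_equiv (Equiv.arrowCongr (Equiv.refl _) (Equiv.swap x x')) _ _ fun σ => ?_
  congr 1
  have : (Equiv.arrowCongr (Equiv.refl (Fin m)) (Equiv.swap x x')) σ r =
    Equiv.swap x x' (σ r) := rfl
  rw [this]
  have h : (Equiv.swap x x' (σ r) = x') ↔ σ r = x := by
    rw [Equiv.swap_apply_eq_iff, Equiv.swap_apply_right]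
  simp only [h]

/-- Product of the edge weights. -/
def hrProd (L : List ((Fin m × Fin m) × (V → V → ℚ))) (σ : Fin m → V) : ℚ :=
  (L.map fun e => e.2 (σ e.1.1) (σ e.1.2)).prod

variable {G : SimpleGraph V}

/-- All networks on this pattern have root-independent value. -/
def HRGood (G : SimpleGraph V) (r : Fin m) (E : List (Fin m × Fin m)) : Prop :=
  ∀ L : List ((Fin m × Fin m) × (V → V → ℚ)), L.map Prod.fst = E →
    (∀ e ∈ L, HRInv G e.2) → ∀ x x', hrSum r (hrProd L) x = hrSum r (hrProd L) x'

theorem HRGood.base (hreg : ∀ x x' : V, ∀ i : ℕ, wlRel G i (x, x) (x', x')) (r : Fin m)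
    (E : List (Fin m × Fin m)) (hE : ∀ e ∈ E, e.1 = e.2) : HRGood G r E := by
  rintro L rfl hL x x'
  have : ∃ c, hrProd L = fun _ => c := by
    induction L with
    | nil => exact ⟨1, rfl⟩
    | cons e L ih =>
      obtain ⟨c, hc⟩ := ih (fun e he => hE e (by simp at he ⊢; exact Or.inr he))
        (fun e he => hL e (List.mem_cons_of_mem _ he))
      obtain ⟨d, hd⟩ := HRInv.diag hreg (hL e List.mem_cons_self)
      refine ⟨d * c, ?_⟩
      funext σ
      have h1 : e.1.1 = e.1.2 := hE e.1 (by simp)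
      have h2 := congrFun hc σ
      simp only [hrProd] at h2
      simp only [hrProd, List.map_cons, List.prod_cons, h2, h1, hd]
  obtain ⟨c, hc⟩ := this
  rw [hc]
  exact hrSum_const r c x x'

theorem hr_split (hreg : ∀ x x' : V, ∀ i : ℕ, wlRel G i (x, x) (x', x')) {u v w : Fin m}
    (hu : u ≠ v) (hw : w ≠ v)
    (L : List ((Fin m × Fin m) × (V → V → ℚ))) (hL : ∀ e ∈ L, HRInv G e.2)
    (h3 : ∀ e ∈ L, hrInc v e.1 = true → hrIn3 u v w e.1 = true) :
    ∃ P Q : V → V → ℚ, HRInv G P ∧ HRInv G Q ∧ ∀ σ a,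
      hrProd L (Function.update σ v a) =
        P (σ u) a * Q a (σ w) * hrProd (L.filter fun e => !hrInc v e.1) σ := by
  induction L with
  | nil => exact ⟨_, _, HRInv.const 1, HRInv.const 1, fun σ a => by simp [hrProd]⟩
  | cons e L ih =>
    obtain ⟨P, Q, hP, hQ, h⟩ := ih (fun e he => hL e (List.mem_cons_of_mem _ he))
      (fun e he => h3 e (List.mem_cons_of_mem _ he))
    have hM := hL e List.mem_cons_self
    have h3e := h3 e List.mem_cons_self
    obtain ⟨⟨p, q⟩, M⟩ := e
    simp only at hM h3e
    have hcons : ∀ τ, hrProd (((p, q), M) :: L) τ = M (τ p) (τ q) * hrProd L τ := by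
      intro τ; simp [hrProd]
    by_cases hinc : hrInc v (p, q) = true
    · have hf : (((p, q), M) :: L).filter (fun e => !hrInc v e.1) =
          L.filter (fun e => !hrInc v e.1) := by
        simp [hinc]
      have h3' := h3e hinc
      simp only [hrInc, hrIn3, Bool.or_eq_true, Bool.and_eq_true, decide_eq_true_eq] at hinc h3'
      rw [hf]
      by_cases hpv : p = v
      · subst hpv
        by_cases hqv : q = p
        · subst hqv
          obtain ⟨c, hc⟩ := HRInv.diag hreg hM
          refine ⟨_, Q, HRInv.mul (HRInv.const c) hP, hQ, fun σ a => ?_⟩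
          rw [hcons, h, hc]; ring
        · rcases h3'.2 with (hq | hq) | hq
          · subst hq
            refine ⟨_, Q, HRInv.mul hM.swap hP, hQ, fun σ a => ?_⟩
            rw [hcons, h, Function.update_self, Function.update_of_ne hqv]; ring
          · exact absurd hq hqv
          · subst hq
            refine ⟨P, _, hP, HRInv.mul hM hQ, fun σ a => ?_⟩
            rw [hcons, h, Function.update_self, Function.update_of_ne hqv]; ring
      · have hqv : q = v := hinc.resolve_left hpv
        subst hqv
        rcases h3'.1 with (hp | hp) | hp
        · subst hp
          refine ⟨_, Q, HRInv.mul hM hP, hQ, fun σ a => ?_⟩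
          rw [hcons, h, Function.update_self, Function.update_of_ne hpv]; ring
        · exact absurd hp hpv
        · subst hp
          refine ⟨P, _, hP, HRInv.mul hM.swap hQ, fun σ a => ?_⟩
          rw [hcons, h, Function.update_self, Function.update_of_ne hpv]; ring
    · have hf : (((p, q), M) :: L).filter (fun e => !hrInc v e.1) =
          ((p, q), M) :: L.filter (fun e => !hrInc v e.1) := by
        simp [hinc]
      refine ⟨P, Q, hP, hQ, fun σ a => ?_⟩
      simp only [hrInc, Bool.or_eq_true, decide_eq_true_eq, not_or] at hinc
      rw [hf, hcons, h, Function.update_of_ne hinc.1, Function.update_of_ne hinc.2]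
      simp only [hrProd, List.map_cons, List.prod_cons]
      ring

theorem HRGood.elim (hreg : ∀ x x' : V, ∀ i : ℕ, wlRel G i (x, x) (x', x')) {r u v w : Fin m}
    (hv : v ≠ r) (hu : u ≠ v) (hw : w ≠ v) (E : List (Fin m × Fin m))
    (h3 : ∀ e ∈ E, hrInc v e = true → hrIn3 u v w e = true)
    (hE : HRGood G r ((u, w) :: E.filter fun e => !hrInc v e)) : HRGood G r E := by
  rintro L rfl hL x x'
  obtain ⟨P, Q, hP, hQ, h⟩ := hr_split hreg hu hw L hL
    (fun e he => h3 e.1 (List.mem_map_of_mem he))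
  have hN := HRInv.mul (HRInv.const (1 / (Fintype.card V : ℚ))) (HRInv.comp hP hQ)
  set L' : List ((Fin m × Fin m) × (V → V → ℚ)) :=
    ((u, w), fun x y => (1 / (Fintype.card V : ℚ)) * ∑ z, P x z * Q z y) ::
      L.filter fun e => !hrInc v e.1 with hL'
  have key : ∀ x, hrSum r (hrProd L) x = hrSum r (hrProd L') x := by
    intro x
    rw [hrSum_avg hv]
    congr 1
    funext σ
    simp only [h]
    rw [← Finset.sum_mul]
    simp only [hL', hrProd, List.map_cons, List.prod_cons]
    ring
  rw [key, key]
  refine hE L' ?_ ?_ x x'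
  · simp only [hL', List.map_cons, List.filter_map]
    rfl
  · intro e he
    rcases List.mem_cons.1 he with rfl | he
    · exact hN
    · exact hL e (List.mem_filter.1 he).1

theorem HRGood.of_check (hreg : ∀ x x' : V, ∀ i : ℕ, wlRel G i (x, x) (x', x')) (r : Fin m)
    (k : ℕ) (E : List (Fin m × Fin m)) (h : hrCheck r k E = true) : HRGood G r E := by
  induction k generalizing E with
  | zero =>
    apply HRGood.base hreg
    simpa [hrCheck] using h
  | succ k ih =>
    unfold hrCheck at h
    rw [Bool.or_eq_true] at h
    rcases h with h | h
    · apply HRGood.base hreg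
      simpa using h
    · split at h
      · exact absurd h (by simp)
      · rename_i v u w _
        simp only [Bool.and_eq_true, decide_eq_true_eq] at h
        obtain ⟨⟨⟨⟨hv, hu⟩, hw⟩, h3⟩, hc⟩ := h
        refine HRGood.elim hreg hv hu hw E ?_ (ih _ hc)
        intro e he hi
        have := List.all_eq_true.1 h3 e he
        simpa [hi] using this

open Classical in
/-- Weight of an assignment: adjacency on `E`, disequality on `D`. -/
noncomputable def hrW (G : SimpleGraph V) (E D : List (Fin m × Fin m)) (σ : Fin m → V) : ℚ :=
  (E.map fun e => if G.Adj (σ e.1) (σ e.2) then (1 : ℚ) else 0).prod *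
    (D.map fun e => if σ e.1 = σ e.2 then (0 : ℚ) else 1).prod

theorem hrW_zero_left {E D : List (Fin m × Fin m)} {σ : Fin m → V} {e : Fin m × Fin m}
    (he : e ∈ E) (h : σ e.1 = σ e.2) : hrW G E D σ = 0 := by
  classical
  unfold hrW
  rw [mul_eq_zero]; left
  apply List.prod_eq_zero
  rw [List.mem_map]
  exact ⟨e, he, by simp [h]⟩

theorem hrW_zero_right {E D : List (Fin m × Fin m)} {σ : Fin m → V} {e : Fin m × Fin m}
    (he : e ∈ D) (h : σ e.1 = σ e.2) : hrW G E D σ = 0 := by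
  classical
  unfold hrW
  rw [mul_eq_zero]; right
  apply List.prod_eq_zero
  rw [List.mem_map]
  exact ⟨e, he, by simp [h]⟩

theorem hr_update_sub (u v : Fin m) (σ : Fin m → V) (a : Fin m) :
    Function.update σ v (σ u) a = σ (hrSub u v a) := by
  unfold hrSub
  by_cases h : a = v
  · subst h; simp
  · simp [h]

theorem hrW_update (u v : Fin m) (E D : List (Fin m × Fin m)) (σ : Fin m → V) :
    hrW G E D (Function.update σ v (σ u)) =
      hrW G (E.map (hrSubE u v)) (D.map (hrSubE u v)) σ := by
  classical
  unfold hrW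
  simp only [hr_update_sub, List.map_map]
  rfl

open Classical in
theorem hrSum_merge {r u v : Fin m} (hv : v ≠ r) (huv : u ≠ v) (E D : List (Fin m × Fin m))
    (x : V) :
    hrSum r (fun σ => (if σ u = σ v then 1 else 0) * hrW G E D σ) x =
      (1 / (Fintype.card V : ℚ)) *
        hrSum r (hrW G (E.map (hrSubE u v)) (D.map (hrSubE u v))) x := by
  rw [hrSum_avg hv]
  unfold hrSum
  rw [Finset.mul_sum]
  refine Finset.sum_congr rfl fun σ _ => ?_
  have : ∑ a, (if (Function.update σ v a) u = (Function.update σ v a) v then (1 : ℚ) else 0) *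
      hrW G E D (Function.update σ v a) =
      hrW G (E.map (hrSubE u v)) (D.map (hrSubE u v)) σ := by
    simp only [Function.update_self, Function.update_of_ne huv]
    rw [← hrW_update]
    simp
  simp only [this]
  ring

open Classical in
theorem hrSum_cons {r u v : Fin m} (E D : List (Fin m × Fin m)) (x : V) :
    hrSum r (hrW G E ((u, v) :: D)) x = hrSum r (hrW G E D) x -
      hrSum r (fun σ => (if σ u = σ v then 1 else 0) * hrW G E D σ) x := by
  unfold hrSum
  rw [← Finset.sum_sub_distrib]
  refine Finset.sum_congr rfl fun σ _ => ?_
  have : hrW G E ((u, v) :: D) σ = (if σ u = σ v then 0 else 1) * hrW G E D σ := by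
    simp only [hrW, List.map_cons, List.prod_cons]; ring
  rw [this]
  by_cases h : σ u = σ v
  · simp [h]
  · simp [h]

theorem hrSum_zero (r : Fin m) (g : (Fin m → V) → ℚ) (h : ∀ σ, g σ = 0) (x : V) :
    hrSum r g x = 0 := by
  simp [hrSum, h]

open Classical in
theorem hr_merge_step {r u v : Fin m} (hv : v ≠ r) (huv : u ≠ v) (E D : List (Fin m × Fin m))
    (h : (∃ e ∈ E, (hrSubE u v e).1 = (hrSubE u v e).2) ∨
      ∀ x x', hrSum r (hrW G (E.map (hrSubE u v)) (D.map (hrSubE u v))) x =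
        hrSum r (hrW G (E.map (hrSubE u v)) (D.map (hrSubE u v))) x') (x x' : V) :
    hrSum r (fun σ => (if σ u = σ v then 1 else 0) * hrW G E D σ) x =
    hrSum r (fun σ => (if σ u = σ v then 1 else 0) * hrW G E D σ) x' := by
  rw [hrSum_merge hv huv, hrSum_merge hv huv]
  rcases h with ⟨e, he, h⟩ | h
  · have : ∀ σ, hrW G (E.map (hrSubE u v)) (D.map (hrSubE u v)) σ = 0 := fun σ =>
      hrW_zero_left (List.mem_map_of_mem he) (by rw [h])
    rw [hrSum_zero r _ this, hrSum_zero r _ this]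
  · rw [h x x']

theorem hr_of_branch (hreg : ∀ x x' : V, ∀ i : ℕ, wlRel G i (x, x) (x', x')) (r : Fin m)
    (k : ℕ) (E D : List (Fin m × Fin m)) (h : hrBranch r k E D = true) (x x' : V) :
    hrSum r (hrW G E D) x = hrSum r (hrW G E D) x' := by
  classical
  have hnil : hrCheck r m E = true → hrSum r (hrW G E []) x = hrSum r (hrW G E []) x' := by
    intro h
    have key : hrW G E [] = hrProd (E.map fun e =>
        (e, fun x y : V => if G.Adj x y then (1 : ℚ) else 0)) := by
      funext σ
      simp [hrW, hrProd, Function.comp_def]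
    rw [key]
    refine HRGood.of_check hreg r m E h _ ?_ ?_ x x'
    · simp [Function.comp_def]
    · intro e he
      obtain ⟨e', _, rfl⟩ := List.mem_map.1 he
      exact HRInv.adj
  induction k generalizing E D x x' with
  | zero =>
    cases D with
    | nil => exact hnil (by simpa [hrBranch] using h)
    | cons _ _ => simp [hrBranch] at h
  | succ k ih =>
    have ih' : ∀ (E D : List (Fin m × Fin m)), hrBranch r k E D = true → ∀ x x' : V,
        hrSum r (hrW G E D) x = hrSum r (hrW G E D) x' := by
      intro E D hb x x'
      refine ih E D hb x x' ?_
      intro h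
      have key : hrW G E [] = hrProd (E.map fun e =>
          (e, fun x y : V => if G.Adj x y then (1 : ℚ) else 0)) := by
        funext σ
        simp [hrW, hrProd, Function.comp_def]
      rw [key]
      refine HRGood.of_check hreg r m E h _ ?_ ?_ x x'
      · simp [Function.comp_def]
      · intro e he
        obtain ⟨e', _, rfl⟩ := List.mem_map.1 he
        exact HRInv.adj
    cases D with
    | nil => exact hnil (by simpa [hrBranch] using h)
    | cons p D =>
      obtain ⟨u, v⟩ := p
      unfold hrBranch at h
      rw [Bool.or_eq_true, Bool.and_eq_true, Bool.or_eq_true, Bool.or_eq_true, Bool.or_eq_true,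
        Bool.or_eq_true] at h
      simp only [decide_eq_true_eq] at h
      by_cases huv : u = v
      · have hz : ∀ σ, hrW G E ((u, v) :: D) σ = 0 := fun σ =>
          hrW_zero_right List.mem_cons_self (by rw [huv])
        rw [hrSum_zero r _ hz, hrSum_zero r _ hz]
      · obtain ⟨hD, h⟩ := h.resolve_left huv
        rw [hrSum_cons, hrSum_cons, ih' E D hD x x']
        congr 1
        have hzero : (∀ σ : Fin m → V, σ u = σ v → hrW G E D σ = 0) →
            hrSum r (fun σ => (if σ u = σ v then 1 else 0) * hrW G E D σ) x =
            hrSum r (fun σ => (if σ u = σ v then 1 else 0) * hrW G E D σ) x' := by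
          intro h0
          have hz : ∀ σ : Fin m → V, (if σ u = σ v then 1 else 0) * hrW G E D σ = 0 := by
            intro σ
            by_cases hs : σ u = σ v
            · rw [h0 σ hs, mul_zero]
            · rw [if_neg hs, zero_mul]
          rw [hrSum_zero r _ hz, hrSum_zero r _ hz]
        rcases h with (((h | h) | h) | h) | h
        · exact hzero fun σ hs => hrW_zero_left h hs
        · exact hzero fun σ hs => hrW_zero_left h hs.symm
        · exact hzero fun σ hs => hrW_zero_right h hs
        · exact hzero fun σ hs => hrW_zero_right h hs.symm
        · by_cases hvr : v = r
          · rw [if_pos hvr, Bool.or_eq_true, Bool.and_eq_true] at h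
            have hur : u ≠ r := fun h' => huv (h'.trans hvr.symm)
            have := hr_merge_step (G := G) hur (Ne.symm huv) E D (h.imp
              (fun h => by simpa only [List.any_eq_true, decide_eq_true_eq] using h)
              (fun h => ih' _ _ h.2)) x x'
            simp only [eq_comm (a := _) (b := _)] at this ⊢
            convert this using 4
          · rw [if_neg hvr, Bool.or_eq_true] at h
            exact hr_merge_step (G := G) hvr huv E D (h.imp
              (fun h => by simpa only [List.any_eq_true, decide_eq_true_eq] using h)
              (fun h => ih' _ _ h)) x x'

end Net

section Cyc
variable {V : Type*} {G : SimpleGraph V}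

/-- The assignment is an injective closed tour starting at `x`. -/
def HRTour (G : SimpleGraph V) (m : ℕ) (x : V) (σ : Fin (m + 1) → V) : Prop :=
  σ 0 = x ∧ (∀ i, G.Adj (σ i) (σ (i + 1))) ∧ Function.Injective σ

theorem hr_card_tour [Fintype V] (m : ℕ) (x : V) :
    (Nat.card {σ : Fin (m + 1) → V // HRTour G m x σ} : ℚ) =
      hrSum 0 (hrW G (hrCyc m) (hrPairs m)) x := by
  classical
  have hW : ∀ σ : Fin (m + 1) → V, hrW G (hrCyc m) (hrPairs m) σ =
      if (∀ i, G.Adj (σ i) (σ (i + 1))) ∧ Function.Injective σ then 1 else 0 := by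
    intro σ
    split_ifs with h
    · unfold hrW
      have h1 : ((hrCyc m).map fun e => if G.Adj (σ e.1) (σ e.2) then (1 : ℚ) else 0).prod = 1 := by
        apply List.prod_eq_one
        intro a ha
        obtain ⟨e, he, rfl⟩ := List.mem_map.1 ha
        obtain ⟨i, _, rfl⟩ := List.mem_map.1 he
        simp [h.1 i]
      have h2 : ((hrPairs m).map fun e => if σ e.1 = σ e.2 then (0 : ℚ) else 1).prod = 1 := by
        apply List.prod_eq_one
        intro a ha
        obtain ⟨e, he, rfl⟩ := List.mem_map.1 ha
        have := (List.mem_filter.1 he).2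
        simp only [decide_eq_true_eq] at this
        rw [if_neg]
        intro h'
        exact this.ne (h.2 h')
      rw [h1, h2, mul_one]
    · rw [not_and_or] at h
      rcases h with h | h
      · push Not at h
        obtain ⟨i, hi⟩ := h
        unfold hrW
        rw [mul_eq_zero]; left
        apply List.prod_eq_zero
        rw [List.mem_map]
        exact ⟨(i, i + 1), List.mem_map.2 ⟨i, List.mem_finRange i, rfl⟩, by simp [hi]⟩
      · have : ∃ i j : Fin (m + 1), i < j ∧ σ i = σ j := by
          unfold Function.Injective at h
          push Not at h
          obtain ⟨i, j, hij, hne⟩ := h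
          rcases lt_or_gt_of_ne hne with h | h
          · exact ⟨i, j, h, hij⟩
          · exact ⟨j, i, h, hij.symm⟩
        obtain ⟨i, j, hij, he⟩ := this
        apply hrW_zero_right (e := (i, j)) _ he
        simp [hrPairs, hij]
  unfold hrSum
  simp only [hW]
  rw [Nat.card_eq_fintype_card, Fintype.card_subtype, Finset.card_filter]
  push_cast
  refine Finset.sum_congr rfl fun σ _ => ?_
  unfold HRTour
  by_cases h1 : σ 0 = x
  · simp [h1]
  · simp [h1]

theorem hr_exists_walk (k : ℕ) (f : ℕ → V) (hf : ∀ i < k, G.Adj (f i) (f (i + 1))) (a b : V)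
    (ha : f 0 = a) (hb : f k = b) :
    ∃ w : G.Walk a b, w.length = k ∧ ∀ i ≤ k, w.getVert i = f i := by
  induction k generalizing f a with
  | zero =>
    subst ha hb
    exact ⟨SimpleGraph.Walk.nil, rfl, fun i hi => by
      obtain rfl : i = 0 := by omega
      rfl⟩
  | succ k ih =>
    obtain ⟨w, hl, hw⟩ := ih (fun i => f (i + 1)) (fun i hi => hf (i + 1) (by omega)) (f 1) rfl hb
    have h0 : G.Adj a (f 1) := ha ▸ hf 0 (by omega)
    refine ⟨SimpleGraph.Walk.cons h0 w, by simp [hl], fun i hi => ?_⟩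
    cases i with
    | zero => simp [ha]
    | succ i => rw [SimpleGraph.Walk.getVert_cons_succ, hw i (by omega)]

theorem hr_card_cycle (m : ℕ) (hm : 2 ≤ m) (x : V) :
    Nat.card {w : G.Walk x x // w.IsCycle ∧ w.length = m + 1} =
      Nat.card {σ : Fin (m + 1) → V // HRTour G m x σ} := by
  have hto : ∀ w : G.Walk x x, w.IsCycle ∧ w.length = m + 1 →
      HRTour G m x (fun i => w.getVert i.val) := by
    rintro w ⟨hc, hl⟩
    refine ⟨by simp, fun i => ?_, fun i j hij => ?_⟩
    · have hadj := w.adj_getVert_succ (i := i.val) (by omega)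
      by_cases hi : i.val = m
      · have : ((i + 1 : Fin (m + 1)).val) = 0 := by
          rw [Fin.val_add]
          rcases m with _ | m
          · omega
          · simp [hi]
        have h2 : w.getVert (i.val + 1) = x := by
          rw [hi, ← hl, SimpleGraph.Walk.getVert_length]
        rw [h2] at hadj
        simpa [this] using hadj
      · have : ((i + 1 : Fin (m + 1)).val) = i.val + 1 := by
          apply Fin.val_add_one_of_lt
          rw [Fin.lt_def]
          have := i.isLt
          simp only [Fin.val_last]
          omega
        simpa [this] using hadj
    · have := hc.getVert_injOn' (x₁ := i.val) (x₂ := j.val)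
        (by simp only [Set.mem_ofPred_eq]; omega) (by simp only [Set.mem_ofPred_eq]; omega) hij
      exact Fin.ext this
  refine Nat.card_eq_of_bijective (fun w => ⟨fun i => w.1.getVert i.val, hto w.1 w.2⟩) ⟨?_, ?_⟩
  · rintro ⟨w, hc, hl⟩ ⟨w', hc', hl'⟩ h
    have h := Subtype.ext_iff.1 h
    simp only at h
    apply Subtype.ext
    apply SimpleGraph.Walk.ext_getVert_le_length (hl.trans hl'.symm)
    intro k hk
    change k ≤ w.length at hk
    change w.getVert k = w'.getVert k
    by_cases hkm : k = m + 1
    · rw [hkm]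
      conv_lhs => rw [← hl, SimpleGraph.Walk.getVert_length]
      conv_rhs => rw [← hl', SimpleGraph.Walk.getVert_length]
    · exact congrFun h ⟨k, by omega⟩
  · rintro ⟨σ, h0, hadj, hinj⟩
    let f : ℕ → V := fun i => σ ⟨i % (m + 1), Nat.mod_lt _ (by omega)⟩
    obtain ⟨w, hl, hw⟩ := hr_exists_walk (G := G) (m + 1) f (fun i _ => by
      have := hadj ⟨i % (m + 1), Nat.mod_lt _ (by omega)⟩
      have he : (⟨i % (m + 1), Nat.mod_lt _ (by omega)⟩ + 1 : Fin (m + 1)) =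
          ⟨(i + 1) % (m + 1), Nat.mod_lt _ (by omega)⟩ := by
        apply Fin.ext
        rw [Fin.val_add]
        simp
      rw [he] at this
      exact this) x x (by simpa [f] using h0) (by simpa [f] using h0)
    have hfi : ∀ i j, i < m + 1 → j < m + 1 → f i = f j → i = j := by
      intro i j hi hj h
      have := Fin.ext_iff.1 (hinj h)
      simpa [Nat.mod_eq_of_lt hi, Nat.mod_eq_of_lt hj] using this
    have hfm : f (m + 1) = f 0 := by simp [f]
    refine ⟨⟨w, ?_, hl⟩, ?_⟩
    · rw [SimpleGraph.Walk.isCycle_iff_isPath_tail_and_le_length]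
      refine ⟨?_, by omega⟩
      rw [← SimpleGraph.Walk.IsPath.getVert_injOn_iff]
      have htl : w.tail.length = m := by
        have := SimpleGraph.Walk.length_tail_add_one (p := w) (by
          intro hn
          have := SimpleGraph.Walk.length_eq_zero_iff.2 hn
          omega)
        omega
      intro i hi j hj hij
      simp only [Set.mem_ofPred_eq, htl] at hi hj
      rw [SimpleGraph.Walk.getVert_tail, SimpleGraph.Walk.getVert_tail, hw _ (by omega),
        hw _ (by omega)] at hij
      by_cases hi' : i = m
      · by_cases hj' : j = m
        · omega
        · rw [hi', hfm] at hij
          have := hfi _ _ (by omega) (by omega) hij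
          omega
      · by_cases hj' : j = m
        · rw [hj', hfm] at hij
          have := hfi _ _ (by omega) (by omega) hij
          omega
        · have := hfi _ _ (by omega) (by omega) hij
          omega
    · apply Subtype.ext
      funext i
      simp only
      rw [hw _ (by omega)]
      simp only [f, Nat.mod_eq_of_lt i.isLt]

end Cyc

theorem hr_check2 : hrBranch (0 : Fin 3) 30 (hrCyc 2) (hrPairs 2) = true := by decide +kernel
theorem hr_check3 : hrBranch (0 : Fin 4) 30 (hrCyc 3) (hrPairs 3) = true := by decide +kernel
theorem hr_check4 : hrBranch (0 : Fin 5) 30 (hrCyc 4) (hrPairs 4) = true := by decide +kernel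
theorem hr_check5 : hrBranch (0 : Fin 6) 30 (hrCyc 5) (hrPairs 5) = true := by decide +kernel
theorem hr_check6 : hrBranch (0 : Fin 7) 30 (hrCyc 6) (hrPairs 6) = true := by decide +kernel

/-- In a `1/2`-regular finite graph `G`, for every `3 ≤ s ≤ 7`
the number of `s`-cycles passing through a vertex `x` is the same for every
vertex `x`. -/
theorem half_regular_cycle_count_invariant {V : Type*} [Fintype V]
    (G : SimpleGraph V)
    (hreg : ∀ x x' : V, ∀ i : ℕ, wlRel G i (x, x) (x', x')) :
    ∀ s : ℕ, 3 ≤ s → s ≤ 7 → ∀ x x' : V,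
      Nat.card {w : G.Walk x x // w.IsCycle ∧ w.length = s} =
      Nat.card {w : G.Walk x' x' // w.IsCycle ∧ w.length = s} := by
  intro s h3 h7 x x'
  have key : ∀ m : ℕ, 2 ≤ m → hrBranch (0 : Fin (m + 1)) 30 (hrCyc m) (hrPairs m) = true →
      Nat.card {w : G.Walk x x // w.IsCycle ∧ w.length = m + 1} =
      Nat.card {w : G.Walk x' x' // w.IsCycle ∧ w.length = m + 1} := by
    intro m hm hb
    rw [hr_card_cycle m hm, hr_card_cycle m hm]
    have h := hr_of_branch hreg (0 : Fin (m + 1)) 30 (hrCyc m) (hrPairs m) hb x x'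
    rw [← hr_card_tour, ← hr_card_tour] at h
    exact_mod_cast h
  interval_cases s
  · exact key 2 (by omega) hr_check2
  · exact key 3 (by omega) hr_check3
  · exact key 4 (by omega) hr_check4
  · exact key 5 (by omega) hr_check5
  · exact key 6 (by omega) hr_check6
end
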